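/- For every integer k ≥ 8, the number 1 − 1/2^{k−5} is a limit point of the set S_k^1. -/

import Mathlib

open Filter Topology FirstOrder

namespace RandomGraphSpectra

/-- The quantifier depth of a first-order (bounded) formula. -/
def qDepth {L : FirstOrder.Language} {α : Type*} :
    ∀ {n : ℕ}, L.BoundedFormula α n → ℕ
  | _, .falsum => 0
  | _, .equal _ _ => 0
  | _, .rel _ _ => 0
  | _, .imp f g => max (qDepth f) (qDepth g)
  | _, .all f => qDepth f + 1

/-- A simple graph satisfies a first-order sentence in the language of graphs. -/
def GraphSat {V : Type*} (G : SimpleGraph V) (φ : FirstOrder.Language.graph.Sentence) : Prop :=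
  @FirstOrder.Language.Sentence.Realize FirstOrder.Language.graph V G.structure φ

/-- The number of edges of a simple graph. -/
noncomputable def edgeCount {V : Type*} (G : SimpleGraph V) : ℕ := Nat.card G.edgeSet

/-- The probability that `G(n,p)` equals a fixed graph `G` on `{1,…,n}`. -/
noncomputable def weight (n : ℕ) (p : ℝ) (G : SimpleGraph (Fin n)) : ℝ :=
  p ^ edgeCount G * (1 - p) ^ (n.choose 2 - edgeCount G)

open Classical in
/-- The probability that the Erdős–Rényi random graph `G(n,p)` satisfies a predicate `P`. -/
noncomputable def probPred (n : ℕ) (p : ℝ) (P : SimpleGraph (Fin n) → Prop) : ℝ :=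
  ∑ᶠ G : SimpleGraph (Fin n), if P G then weight n p G else 0

/-- The probability that `G(n,p)` satisfies a first-order sentence. -/
noncomputable def probSat (n : ℕ) (p : ℝ) (φ : FirstOrder.Language.graph.Sentence) : ℝ :=
  probPred n p (fun G => GraphSat G φ)

open Classical in
/-- The probability that the pair of independent random graphs `G(n,p), G(m,q)`
satisfies a predicate `P`. -/
noncomputable def probPred2 (n m : ℕ) (p q : ℝ)
    (P : SimpleGraph (Fin n) → SimpleGraph (Fin m) → Prop) : ℝ :=
  ∑ᶠ G : SimpleGraph (Fin n), ∑ᶠ H : SimpleGraph (Fin m),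
    if P G H then weight n p G * weight m q H else 0

/-- The spectrum `S_k^1`: the set of `α ∈ (0,1)` such that for some first-order sentence `φ`
of quantifier depth at most `k`, with `p(n) = n^{-α}`, the probability that `G(n,p(n)) ⊨ φ`
does not tend to `0` and does not tend to `1`. -/
def S1 (k : ℕ) : Set ℝ :=
  {α | α ∈ Set.Ioo (0 : ℝ) 1 ∧ ∃ φ : FirstOrder.Language.graph.Sentence, qDepth φ ≤ k ∧
    ¬(Tendsto (fun n : ℕ => probSat n ((n : ℝ) ^ (-α)) φ) atTop (nhds 0) ∨
      Tendsto (fun n : ℕ => probSat n ((n : ℝ) ^ (-α)) φ) atTop (nhds 1))}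

/-- The spectrum `S_k^2`. -/
def S2 (k : ℕ) : Set ℝ :=
  {α | α ∈ Set.Ioo (0 : ℝ) 1 ∧ ∃ φ : FirstOrder.Language.graph.Sentence, qDepth φ ≤ k ∧
    ¬∃ δ : ℝ, (δ = 0 ∨ δ = 1) ∧ ∃ ε : ℝ, 0 < ε ∧ ∀ p : ℕ → ℝ,
      (∀ n : ℕ, 1 ≤ n → (n : ℝ) ^ (-α - ε) < p n ∧ p n < (n : ℝ) ^ (-α + ε)) →
      Tendsto (fun n : ℕ => probSat n (p n) φ) atTop (nhds δ)}

/-- `G(n, p(n))` obeys the zero-one `k`-law. -/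
def ZeroOneKLaw (k : ℕ) (p : ℕ → ℝ) : Prop :=
  ∀ φ : FirstOrder.Language.graph.Sentence, qDepth φ ≤ k →
    Tendsto (fun n : ℕ => probSat n (p n) φ) atTop (nhds 0) ∨
    Tendsto (fun n : ℕ => probSat n (p n) φ) atTop (nhds 1)

/-- The density `ρ(G) = e(G)/v(G)` of a graph. -/
noncomputable def density {V : Type*} (G : SimpleGraph V) : ℝ :=
  (Nat.card G.edgeSet : ℝ) / (Nat.card V : ℝ)

/-- A graph is strictly balanced if every proper subgraph with at least one vertex has
strictly smaller density. -/
def StrictlyBalanced {V : Type*} (G : SimpleGraph V) : Prop :=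
  ∀ H : G.Subgraph, H ≠ ⊤ → H.verts.Nonempty → density H.coe < density G

/-- `ρ^max(G)`: the maximum density of a subgraph of `G` with at least one vertex. -/
noncomputable def maxDensity {V : Type*} (G : SimpleGraph V) : ℝ :=
  sSup {x : ℝ | ∃ H : G.Subgraph, H.verts.Nonempty ∧ x = density H.coe}

/-- The relative density `ρ(K,H) = e(K,H)/v(K,H)` of a pair of nested subgraphs. -/
noncomputable def pairDensity {V : Type*} {G : SimpleGraph V} (K H : G.Subgraph) : ℝ :=
  ((Nat.card K.edgeSet : ℝ) - (Nat.card H.edgeSet : ℝ)) /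
    ((Nat.card K.verts : ℝ) - (Nat.card H.verts : ℝ))

/-- `ρ^max(G,H)` where the ambient graph `G` corresponds to the top subgraph. -/
noncomputable def maxPairDensity {V : Type*} {G : SimpleGraph V} (H : G.Subgraph) : ℝ :=
  sSup {x : ℝ | ∃ K : G.Subgraph, H < K ∧ x = pairDensity K H}

/-- `f_α(K,H) = v(K,H) - α·e(K,H)`. -/
noncomputable def fAlpha (α : ℝ) {V : Type*} {G : SimpleGraph V} (K H : G.Subgraph) : ℝ :=
  ((Nat.card K.verts : ℝ) - (Nat.card H.verts : ℝ)) -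
    α * ((Nat.card K.edgeSet : ℝ) - (Nat.card H.edgeSet : ℝ))

/-- The pair `(G,H)` is `α`-safe: `f_α(S,H) > 0` for every `S` with `H ⊂ S ⊆ G`. -/
def AlphaSafe (α : ℝ) {V : Type*} (G : SimpleGraph V) (H : G.Subgraph) : Prop :=
  ∀ S : G.Subgraph, H < S → 0 < fAlpha α S H

/-- The pair `(G,H)` is strictly balanced: `ρ(G,H) > ρ(K,H)` for every `H ⊂ K ⊂ G`. -/
def StrictlyBalancedPair {V : Type*} (G : SimpleGraph V) (H : G.Subgraph) : Prop :=
  ∀ K : G.Subgraph, H < K → K ≠ ⊤ → pairDensity K H < pairDensity (⊤ : G.Subgraph) H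

/-- The set `E(K) \ (E(H) ∪ E(K∖H))` is non-empty: `K` has an edge, not an edge of `H`,
with at least one endpoint in `V(H)`. -/
def TouchesRoots {V : Type*} {G : SimpleGraph V} (H K : G.Subgraph) : Prop :=
  ∃ u v : V, K.Adj u v ∧ ¬H.Adj u v ∧ (u ∈ H.verts ∨ v ∈ H.verts)

/-- `e^min(G,H)` (`G` being the top subgraph). -/
noncomputable def eMin {V : Type*} {G : SimpleGraph V} (H : G.Subgraph) : ℕ :=
  sInf {e : ℕ | ∃ K : G.Subgraph, H < K ∧ TouchesRoots H K ∧
    pairDensity K H = maxPairDensity H ∧ e = Nat.card K.edgeSet - Nat.card H.edgeSet}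

/-- `f` realizes a `(G,(r 0,…,r (m-1)))`-extension of the tuple `x` in `Γ`: an injective copy
of the vertex set of `G` sending the roots to `x` and containing all edges of `E(G)∖E(H)`
as edges outside the root-induced subgraph. -/
def IsExtension {W V : Type*} (Gp : SimpleGraph W) (H : Gp.Subgraph) {m : ℕ}
    (r : Fin m → W) (Γ : SimpleGraph V) (x : Fin m → V) (f : W → V) : Prop :=
  Function.Injective f ∧ (∀ j : Fin m, f (r j) = x j) ∧
    ∀ u v : W, Gp.Adj u v → ¬H.Adj u v →
      Γ.Adj (f u) (f v) ∧ ¬(u ∈ H.verts ∧ v ∈ H.verts)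

/-- Strict extension: the implication above is an equivalence. -/
def IsStrictExtension {W V : Type*} (Gp : SimpleGraph W) (H : Gp.Subgraph) {m : ℕ}
    (r : Fin m → W) (Γ : SimpleGraph V) (x : Fin m → V) (f : W → V) : Prop :=
  Function.Injective f ∧ (∀ j : Fin m, f (r j) = x j) ∧
    ∀ u v : W, (Gp.Adj u v ∧ ¬H.Adj u v) ↔
      (Γ.Adj (f u) (f v) ∧ ¬(u ∈ H.verts ∧ v ∈ H.verts))

/-- The pair of subgraphs of `Γ` with vertex sets `B ⊆ A` is `(K,T)`-maximal in `Γ`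
(where `T ⊂ K` has roots enumerated by `s`). -/
def PairMaximal {U V : Type*} (Kp : SimpleGraph U) (T : Kp.Subgraph) {t : ℕ}
    (s : Fin t → U) (Γ : SimpleGraph V) (A B : Set V) : Prop :=
  ∀ tup : Fin t → V, Function.Injective tup → (∀ i, tup i ∈ A) → (∃ i, tup i ∉ B) →
    ¬∃ f : U → V, IsStrictExtension Kp T s Γ tup f ∧
      (∀ u : U, f u ∈ A → f u ∈ Set.range tup) ∧
      (∀ u : U, f u ∉ Set.range tup → ∀ a ∈ A, a ∉ Set.range tup → ¬Γ.Adj (f u) a)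

/-- The subgraph of `Γ` with vertex set `A` is `(K,T)`-maximal in `Γ`. -/
def GraphMaximal {U V : Type*} (Kp : SimpleGraph U) (T : Kp.Subgraph) {t : ℕ}
    (s : Fin t → U) (Γ : SimpleGraph V) (A : Set V) : Prop :=
  ∀ tup : Fin t → V, Function.Injective tup → (∀ i, tup i ∈ A) →
    ¬∃ f : U → V, IsStrictExtension Kp T s Γ tup f ∧
      (∀ u : U, f u ∈ A → f u ∈ Set.range tup) ∧
      (∀ u : U, f u ∉ Set.range tup → ∀ a ∈ A, a ∉ Set.range tup → ¬Γ.Adj (f u) a)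

/-- `Γ` contains a copy of `Gp`. -/
def ContainsCopy {W V : Type*} (Gp : SimpleGraph W) (Γ : SimpleGraph V) : Prop :=
  ∃ f : W → V, Function.Injective f ∧ ∀ u v : W, Gp.Adj u v → Γ.Adj (f u) (f v)

/-- The number of copies of `Gp` in `Γ`: subgraphs of `Γ` isomorphic to `Gp`. -/
noncomputable def numCopies {W V : Type*} (Gp : SimpleGraph W) (Γ : SimpleGraph V) : ℕ :=
  Nat.card {H : Γ.Subgraph // Nonempty (Gp ≃g H.coe)}

/-- The matched tuples of chosen vertices induce a partial isomorphism. -/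
def PartialIso {V W : Type*} (G : SimpleGraph V) (H : SimpleGraph W)
    (xs : List V) (ys : List W) : Prop :=
  ∃ h : xs.length = ys.length,
    ∀ j k : Fin xs.length,
      (xs.get j = xs.get k ↔ ys.get (Fin.cast h j) = ys.get (Fin.cast h k)) ∧
      (G.Adj (xs.get j) (xs.get k) ↔ H.Adj (ys.get (Fin.cast h j)) (ys.get (Fin.cast h k)))

/-- Duplicator has a winning strategy in the remaining `i` rounds of the Ehrenfeucht game
on `(G,H)` from the position given by the already chosen vertices `xs`, `ys`. -/
def DuplicatorWinsFrom {V W : Type*} (G : SimpleGraph V) (H : SimpleGraph W) :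
    ℕ → List V → List W → Prop
  | 0, xs, ys => PartialIso G H xs ys
  | (i + 1), xs, ys =>
      (∀ x : V, ∃ y : W, DuplicatorWinsFrom G H i (x :: xs) (y :: ys)) ∧
      (∀ y : W, ∃ x : V, DuplicatorWinsFrom G H i (x :: xs) (y :: ys))

/-- Duplicator has a winning strategy in the Ehrenfeucht game `EHR(G,H,i)`. -/
def DuplicatorWins {V W : Type*} (G : SimpleGraph V) (H : SimpleGraph W) (i : ℕ) : Prop :=
  DuplicatorWinsFrom G H i [] []

end RandomGraphSpectra

namespace RandomGraphSpectra

/-- The class `𝒮` of graphs from Section "Properties which imply the existence of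
Duplicator's winning strategy" (properties 1)–3)). -/
def GoodGraph (k b : ℕ) (α : ℝ) {V : Type*} (Γ : SimpleGraph V) : Prop :=
  -- 1) no strictly balanced subgraph with at most `2^{2k}·b` vertices and density `> 1/α`
  (∀ A : Γ.Subgraph, Nat.card A.verts ≤ 2 ^ (2 * k) * b → StrictlyBalanced A.coe →
      density A.coe ≤ 1 / α) ∧
  -- 2) strict extensions of α-safe pairs which are `(K₁,K₂)`-maximal
  (∀ (l h : ℕ) (H₁ : SimpleGraph (Fin l)) (H₂ : H₁.Subgraph) (r : Fin h → Fin l),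
      Function.Injective r → Set.range r = H₂.verts →
      l ≤ 2 ^ (2 * k) * b + k * 2 ^ k → AlphaSafe α H₁ H₂ →
      ∀ x : Fin h → V, Function.Injective x →
        ∃ f : Fin l → V, IsStrictExtension H₁ H₂ r Γ x f ∧
          ∀ (u t : ℕ) (K₁ : SimpleGraph (Fin u)) (K₂ : K₁.Subgraph) (s : Fin t → Fin u),
            Function.Injective s → Set.range s = K₂.verts →
            u ≤ 2 ^ k → Nat.card K₂.verts ≤ 2 → fAlpha α (⊤ : K₁.Subgraph) K₂ < 0 →
            PairMaximal K₁ K₂ s Γ (Set.range f) (Set.range x)) ∧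
  -- 3) maximal copies of sparse strictly balanced graphs
  (∀ (w : ℕ) (Hp : SimpleGraph (Fin w)), w ≤ 2 ^ (2 * k) * b → StrictlyBalanced Hp →
      density Hp < 1 / α →
      ∃ f : Fin w → V, Function.Injective f ∧
        (∀ u v : Fin w, Hp.Adj u v → Γ.Adj (f u) (f v)) ∧
        ∀ (u t : ℕ) (K₁ : SimpleGraph (Fin u)) (K₂ : K₁.Subgraph) (s : Fin t → Fin u),
          Function.Injective s → Set.range s = K₂.verts →
          u ≤ 2 ^ k → Nat.card K₂.verts ≤ 2 → fAlpha α (⊤ : K₁.Subgraph) K₂ < 0 →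
          GraphMaximal K₁ K₂ s Γ (Set.range f))

end RandomGraphSpectra

namespace RGS
open Classical in
noncomputable def Ex {ι : Type*} (A : Finset ι) (p : ℝ) (f : Finset ι → ℝ) : ℝ :=
  ∑ S ∈ A.powerset, p ^ S.card * (1 - p) ^ (A.card - S.card) * f S

open Classical in
noncomputable def ind (Q : Prop) : ℝ := if Q then 1 else 0

lemma ind_pos {Q : Prop} (h : Q) : ind Q = 1 := by simp [ind, h]
lemma ind_neg {Q : Prop} (h : ¬ Q) : ind Q = 0 := by simp [ind, h]
lemma ind_nonneg (Q : Prop) : 0 ≤ ind Q := by unfold ind; split_ifs <;> norm_num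
lemma ind_le_one (Q : Prop) : ind Q ≤ 1 := by unfold ind; split_ifs <;> norm_num
lemma ind_mono {Q Q' : Prop} (h : Q → Q') : ind Q ≤ ind Q' := by
  by_cases hq : Q
  · rw [ind_pos hq, ind_pos (h hq)]
  · rw [ind_neg hq]; exact ind_nonneg _
lemma ind_and (Q Q' : Prop) : ind (Q ∧ Q') = ind Q * ind Q' := by
  by_cases h : Q <;> by_cases h' : Q' <;> simp [ind, h, h']
lemma ind_congr {Q Q' : Prop} (h : Q ↔ Q') : ind Q = ind Q' := by rw [propext h]

section
variable {ι : Type*} {A : Finset ι} {p : ℝ}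

lemma Ex_congr {f g : Finset ι → ℝ} (h : ∀ S, S ⊆ A → f S = g S) : Ex A p f = Ex A p g := by
  unfold Ex
  apply Finset.sum_congr rfl
  intro S hS
  rw [h S (Finset.mem_powerset.mp hS)]

lemma Ex_mono {f g : Finset ι → ℝ} (h0 : 0 ≤ p) (h1 : p ≤ 1) (h : ∀ S, S ⊆ A → f S ≤ g S) :
    Ex A p f ≤ Ex A p g := by
  unfold Ex
  apply Finset.sum_le_sum
  intro S hS
  apply mul_le_mul_of_nonneg_left (h S (Finset.mem_powerset.mp hS))
  have : 0 ≤ 1 - p := by linarith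
  positivity

lemma Ex_add (f g : Finset ι → ℝ) : Ex A p (fun S => f S + g S) = Ex A p f + Ex A p g := by
  unfold Ex
  rw [← Finset.sum_add_distrib]
  apply Finset.sum_congr rfl
  intros; ring

lemma Ex_mul (c : ℝ) (f : Finset ι → ℝ) : Ex A p (fun S => c * f S) = c * Ex A p f := by
  unfold Ex
  rw [Finset.mul_sum]
  apply Finset.sum_congr rfl
  intros; ring

lemma Ex_zero : Ex A p (fun _ => 0) = 0 := by simp [Ex]

lemma Ex_sum {κ : Type*} (s : Finset κ) (f : κ → Finset ι → ℝ) :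
    Ex A p (fun S => ∑ i ∈ s, f i S) = ∑ i ∈ s, Ex A p (f i) := by
  unfold Ex
  rw [Finset.sum_comm]
  apply Finset.sum_congr rfl
  intro S _
  rw [Finset.mul_sum]

lemma Ex_insert [DecidableEq ι] {e : ι} (he : e ∉ A) (f : Finset ι → ℝ) :
    Ex (insert e A) p f = p * Ex A p (fun S => f (insert e S)) + (1 - p) * Ex A p f := by
  unfold Ex
  rw [Finset.sum_powerset_insert he, add_comm, Finset.mul_sum, Finset.mul_sum]
  congr 1
  · apply Finset.sum_congr rfl
    intro S hS
    have hS := Finset.mem_powerset.mp hS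
    rw [Finset.card_insert_of_notMem he, Finset.card_insert_of_notMem (fun h => he (hS h))]
    rw [Nat.add_sub_add_right]
    ring
  · apply Finset.sum_congr rfl
    intro S hS
    have hS := Finset.mem_powerset.mp hS
    have := Finset.card_le_card hS
    rw [Finset.card_insert_of_notMem he, Nat.sub_add_comm this]
    ring

open Classical in
lemma Ex_one : Ex A p (fun _ => 1) = 1 := by
  induction A using Finset.induction_on with
  | empty => simp [Ex]
  | insert e A he ih => rw [Ex_insert he, ih]; ring

lemma Ex_nonneg {f : Finset ι → ℝ} (h0 : 0 ≤ p) (h1 : p ≤ 1) (h : ∀ S, S ⊆ A → 0 ≤ f S) :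
    0 ≤ Ex A p f := by
  rw [← Ex_zero (A := A) (p := p)]
  exact Ex_mono h0 h1 h

lemma Ex_indep [DecidableEq ι] (T : Finset ι) : ∀ (F G : Finset ι → ℝ),
    (∀ S, F S = F (S ∩ T)) → (∀ S, G S = G (S \ T)) →
    Ex A p (fun S => F S * G S) = Ex A p F * Ex A p G := by
  induction A using Finset.induction_on with
  | empty => intro F G _ _; simp [Ex]
  | insert e A he ih =>
    intro F G hF hG
    rw [Ex_insert he, Ex_insert he, Ex_insert he]
    by_cases heT : e ∈ T
    · have hG' : ∀ S, G (insert e S) = G S := by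
        intro S
        rw [hG (insert e S), hG S, Finset.insert_sdiff_of_mem _ heT]
      simp only [hG']
      rw [ih F G hF hG, ih (fun S => F (insert e S)) G _ hG]
      · ring
      · intro S
        rw [hF (insert e S), hF (insert e (S ∩ T))]
        congr 1
        ext a; simp only [Finset.mem_inter, Finset.mem_insert]; tauto
    · have hF' : ∀ S, F (insert e S) = F S := by
        intro S
        rw [hF (insert e S), hF S, Finset.insert_inter_of_notMem heT]
      simp only [hF']
      rw [ih F G hF hG, ih F (fun S => G (insert e S)) hF]
      · ring
      · intro S
        rw [hG (insert e S), hG (insert e (S \ T))]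
        congr 1
        ext a; simp only [Finset.mem_sdiff, Finset.mem_insert]; tauto

open Classical in
lemma Ex_harris (h0 : 0 ≤ p) (h1 : p ≤ 1) : ∀ (F G : Finset ι → ℝ), Antitone F → Antitone G →
    Ex A p F * Ex A p G ≤ Ex A p (fun S => F S * G S) := by
  induction A using Finset.induction_on with
  | empty => intro F G _ _; simp [Ex]
  | insert e A he ih =>
    intro F G hF hG
    rw [Ex_insert he, Ex_insert he, Ex_insert he]
    have hF1 : Antitone (fun S => F (insert e S)) :=
      fun S T h => hF (Finset.insert_subset_insert _ h)
    have hG1 : Antitone (fun S => G (insert e S)) :=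
      fun S T h => hG (Finset.insert_subset_insert _ h)
    have a1 := ih _ _ hF1 hG1
    have a0 := ih _ _ hF hG
    have b1 : Ex A p (fun S => F (insert e S)) ≤ Ex A p F :=
      Ex_mono h0 h1 fun S _ => hF (Finset.subset_insert _ _)
    have b2 : Ex A p (fun S => G (insert e S)) ≤ Ex A p G :=
      Ex_mono h0 h1 fun S _ => hG (Finset.subset_insert _ _)
    have h1' : 0 ≤ 1 - p := by linarith
    have c1 := mul_le_mul_of_nonneg_left a1 h0
    have c0 := mul_le_mul_of_nonneg_left a0 h1'
    have d := mul_nonneg (mul_nonneg h0 h1') (mul_nonneg (sub_nonneg.2 b1) (sub_nonneg.2 b2))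
    nlinarith [c1, c0, d]

noncomputable def Pr (A : Finset ι) (p : ℝ) (Q : Finset ι → Prop) : ℝ :=
  Ex A p (fun S => ind (Q S))

lemma Pr_nonneg (h0 : 0 ≤ p) (h1 : p ≤ 1) (Q : Finset ι → Prop) : 0 ≤ Pr A p Q :=
  Ex_nonneg h0 h1 (fun S _ => ind_nonneg _)

lemma Pr_mono (h0 : 0 ≤ p) (h1 : p ≤ 1) {Q Q' : Finset ι → Prop}
    (h : ∀ S, S ⊆ A → Q S → Q' S) : Pr A p Q ≤ Pr A p Q' :=
  Ex_mono h0 h1 fun S hS => ind_mono (h S hS)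

lemma Pr_le_one (h0 : 0 ≤ p) (h1 : p ≤ 1) (Q : Finset ι → Prop) : Pr A p Q ≤ 1 := by
  rw [← Ex_one (A := A) (p := p)]
  exact Ex_mono h0 h1 (fun S _ => ind_le_one _)

lemma Pr_not (Q : Finset ι → Prop) : Pr A p (fun S => ¬ Q S) = 1 - Pr A p Q := by
  have : Pr A p (fun S => ¬ Q S) + Pr A p Q = 1 := by
    unfold Pr
    rw [← Ex_add]
    refine Eq.trans ?_ (Ex_one (A := A) (p := p))
    apply Ex_congr
    intro S _
    by_cases h : Q S <;> simp [h, ind]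
  linarith

lemma Pr_and_ge (h0 : 0 ≤ p) (h1 : p ≤ 1) (Q Q' : Finset ι → Prop) :
    Pr A p Q - Pr A p (fun S => ¬ Q' S) ≤ Pr A p (fun S => Q S ∧ Q' S) := by
  have : Pr A p Q ≤ Pr A p (fun S => Q S ∧ Q' S) + Pr A p (fun S => ¬ Q' S) := by
    unfold Pr
    rw [← Ex_add]
    apply Ex_mono h0 h1
    intro S _
    by_cases h : Q S <;> by_cases h' : Q' S <;> simp [h, h', ind]
  linarith

lemma Pr_union (h0 : 0 ≤ p) (h1 : p ≤ 1) {κ : Type*} (s : Finset κ) (Q : κ → Finset ι → Prop) :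
    Pr A p (fun S => ∃ i ∈ s, Q i S) ≤ ∑ i ∈ s, Pr A p (Q i) := by
  unfold Pr
  rw [← Ex_sum]
  apply Ex_mono h0 h1
  intro S _
  have hn : ∀ i ∈ s, (0:ℝ) ≤ ind (Q i S) := fun i _ => ind_nonneg _
  by_cases h : ∃ i ∈ s, Q i S
  · rw [ind_pos h]
    obtain ⟨i, hi, hQ⟩ := h
    have := Finset.single_le_sum hn hi
    simpa [ind_pos hQ] using this
  · rw [ind_neg h]
    exact Finset.sum_nonneg hn

open Classical in
lemma Pr_subset : ∀ (B : Finset ι), B ⊆ A → Pr A p (fun S => B ⊆ S) = p ^ B.card := by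
  unfold Pr
  induction A using Finset.induction_on with
  | empty => intro B hB; simp at hB; subst hB; simp [Ex, ind]
  | insert e A he ih =>
    intro B hB
    rw [Ex_insert he]
    by_cases heB : e ∈ B
    · have h1 : B.erase e ⊆ A := by
        intro a ha
        have := hB (Finset.mem_of_mem_erase ha)
        rcases Finset.mem_insert.mp this with h | h
        · exact absurd h (Finset.ne_of_mem_erase ha)
        · exact h
      have h2 := ih (B.erase e) h1
      rw [Ex_congr (g := fun S => ind (B.erase e ⊆ S)), h2,
        Ex_congr (f := fun S => ind (B ⊆ S)) (g := fun _ => 0), Ex_zero]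
      · rw [Finset.card_erase_of_mem heB]
        have : 0 < B.card := Finset.card_pos.2 ⟨e, heB⟩
        rw [mul_zero, add_zero, ← pow_succ', Nat.sub_add_cancel this]
      · intro S hS
        rw [ind_neg]
        intro h
        exact he (hS (h heB))
      · intro S hS
        simp only [Finset.subset_insert_iff]
    · have h1 : B ⊆ A := by
        intro a ha
        rcases Finset.mem_insert.mp (hB ha) with h | h
        · subst h; exact absurd ha heB
        · exact h
      have h2 := ih B h1
      rw [Ex_congr (f := fun S => ind (B ⊆ insert e S))
        (g := fun S => ind (B ⊆ S)), h2]
      · ring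
      · intro S hS
        simp only [Finset.subset_insert_iff_of_notMem heB]

/-- Cauchy-Schwarz. -/
lemma Ex_sq_le (h0 : 0 ≤ p) (h1 : p ≤ 1) (f : Finset ι → ℝ) :
    (Ex A p f) ^ 2 ≤ Ex A p (fun S => f S ^ 2) * Pr A p (fun S => f S ≠ 0) := by
  unfold Pr Ex
  have h1' : 0 ≤ 1 - p := by linarith
  set w : Finset ι → ℝ := fun S => p ^ S.card * (1 - p) ^ (A.card - S.card) with hw
  have hw0 : ∀ S, 0 ≤ w S := fun S => by positivity
  have key := Finset.sum_mul_sq_le_sq_mul_sq A.powerset (fun S => Real.sqrt (w S) * f S)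
    (fun S => Real.sqrt (w S) * ind (f S ≠ 0))
  have e1 : ∑ S ∈ A.powerset, w S * f S =
      ∑ S ∈ A.powerset, Real.sqrt (w S) * f S * (Real.sqrt (w S) * ind (f S ≠ 0)) := by
    apply Finset.sum_congr rfl
    intro S _
    have := Real.mul_self_sqrt (hw0 S)
    by_cases h : f S = 0
    · simp [h]
    · rw [ind_pos h]; linear_combination (-f S) * this
  have e2 : ∑ S ∈ A.powerset, w S * (f S) ^ 2 =
      ∑ S ∈ A.powerset, (Real.sqrt (w S) * f S) ^ 2 := by
    apply Finset.sum_congr rfl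
    intro S _
    rw [mul_pow, Real.sq_sqrt (hw0 S)]
  have e3 : ∑ S ∈ A.powerset, w S * ind (f S ≠ 0) =
      ∑ S ∈ A.powerset, (Real.sqrt (w S) * ind (f S ≠ 0)) ^ 2 := by
    apply Finset.sum_congr rfl
    intro S _
    rw [mul_pow, Real.sq_sqrt (hw0 S)]
    by_cases h : f S = 0 <;> simp [h, ind]
  rw [← e1, ← e2, ← e3] at key
  exact key

lemma Pr_indep_prod [DecidableEq ι] {κ : Type*} (s : Finset κ) (T : κ → Finset ι) (Q : κ → Finset ι → Prop)
    (hT : ∀ i ∈ s, ∀ j ∈ s, i ≠ j → Disjoint (T i) (T j))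
    (hQ : ∀ i ∈ s, ∀ S, Q i S ↔ Q i (S ∩ T i)) :
    Pr A p (fun S => ∀ i ∈ s, Q i S) = ∏ i ∈ s, Pr A p (Q i) := by
  classical
  induction s using Finset.induction_on with
  | empty => simp [Pr, ind, Ex_one]
  | insert a s ha ih =>
    rw [Finset.prod_insert ha, ← ih (fun i hi j hj => hT i (Finset.mem_insert_of_mem hi) j
      (Finset.mem_insert_of_mem hj)) (fun i hi => hQ i (Finset.mem_insert_of_mem hi))]
    unfold Pr
    rw [← Ex_indep (T a)]
    · apply Ex_congr
      intro S _
      rw [← ind_and]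
      simp only [Finset.forall_mem_insert]
    · intro S
      exact ind_congr (hQ a (Finset.mem_insert_self _ _) S)
    · intro S
      apply ind_congr
      refine forall₂_congr fun i hi => ?_
      rw [hQ i (Finset.mem_insert_of_mem hi) S, hQ i (Finset.mem_insert_of_mem hi) (S \ T a)]
      have hd := hT i (Finset.mem_insert_of_mem hi) a (Finset.mem_insert_self _ _)
        (fun h => ha (h ▸ hi))
      have : S ∩ T i = (S \ T a) ∩ T i := by
        ext x
        simp only [Finset.mem_inter, Finset.mem_sdiff]
        constructor
        · rintro ⟨h1, h2⟩; exact ⟨⟨h1, fun h3 => Finset.disjoint_left.mp hd h2 h3⟩, h2⟩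
        · rintro ⟨⟨h1, _⟩, h2⟩; exact ⟨h1, h2⟩
      rw [this]

open Classical in
lemma Pr_avoid (h0 : 0 ≤ p) (h1 : p ≤ 1) {κ : Type*} (s : Finset κ) (E : κ → Finset ι)
    (hE : ∀ i ∈ s, E i ⊆ A) :
    ∏ i ∈ s, (1 - p ^ (E i).card) ≤ Pr A p (fun S => ∀ i ∈ s, ¬ E i ⊆ S) := by
  induction s using Finset.induction_on with
  | empty => simp [Pr, ind, Ex_one]
  | insert a s ha ih =>
    rw [Finset.prod_insert ha]
    have ih' := ih (fun i hi => hE i (Finset.mem_insert_of_mem hi))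
    have ha' := Pr_subset (p := p) (E a) (hE a (Finset.mem_insert_self _ _))
    have hn := Pr_not (A := A) (p := p) (fun S => E a ⊆ S)
    rw [ha'] at hn
    rw [← hn]
    refine (mul_le_mul_of_nonneg_left ih' (Pr_nonneg h0 h1 _)).trans ?_
    unfold Pr
    refine (Ex_harris h0 h1 _ _ ?_ ?_).trans (Ex_mono h0 h1 ?_)
    · intro S T hST
      exact ind_mono fun h h' => h (h'.trans hST)
    · intro S T hST
      exact ind_mono fun h i hi h' => h i hi (h'.trans hST)
    · intro S _
      rw [← ind_and]
      simp only [Finset.forall_mem_insert]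
      exact le_rfl
end

/-- Edge set of the complete graph. -/
noncomputable def EE (n : ℕ) : Finset (Sym2 (Fin n)) := (⊤ : SimpleGraph (Fin n)).edgeFinset

/-- Graph of an edge finset. -/
def gr {n : ℕ} (S : Finset (Sym2 (Fin n))) : SimpleGraph (Fin n) :=
  SimpleGraph.fromEdgeSet (S : Set (Sym2 (Fin n)))

lemma mem_EE {n : ℕ} {e : Sym2 (Fin n)} : e ∈ EE n ↔ ¬ e.IsDiag := by
  simp [EE]

open Classical in
lemma probPred_eq (n : ℕ) (p : ℝ) (P : SimpleGraph (Fin n) → Prop) :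
    RandomGraphSpectra.probPred n p P = Pr (EE n) p (fun S => P (gr S)) := by
  unfold RandomGraphSpectra.probPred Pr Ex
  rw [finsum_eq_sum_of_fintype]
  symm
  have hgr : ∀ S : Finset (Sym2 (Fin n)), S ⊆ EE n → (gr S).edgeSet = S := by
    intro S hS
    rw [gr, SimpleGraph.edgeSet_fromEdgeSet]
    ext e
    simp only [Set.mem_sdiff, Finset.mem_coe]
    constructor
    · exact fun h => h.1
    · intro h; exact ⟨h, fun h' => mem_EE.1 (hS h) (by simpa using h')⟩
  refine Finset.sum_bij (fun S _ => gr S) (fun _ _ => Finset.mem_univ _) ?_ ?_ ?_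
  · intro S hS T hT h
    rw [Finset.mem_powerset] at hS hT
    have := hgr S hS
    rw [h, hgr T hT] at this
    exact_mod_cast this.symm
  · intro G _
    refine ⟨G.edgeFinset, ?_, ?_⟩
    · rw [Finset.mem_powerset]
      exact SimpleGraph.edgeFinset_mono le_top
    · simp [gr]
  · intro S hS
    rw [Finset.mem_powerset] at hS
    have h1 : RandomGraphSpectra.edgeCount (gr S) = S.card := by
      unfold RandomGraphSpectra.edgeCount
      rw [hgr S hS]; simp
    have h2 : (EE n).card = n.choose 2 := by
      rw [EE, SimpleGraph.card_edgeFinset_top_eq_card_choose_two, Fintype.card_fin]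
    simp only [RandomGraphSpectra.weight, h1, h2]
    by_cases h : P (gr S) <;> simp [h, ind]
end RGS

namespace RGS

lemma SM1 {ι Φ : Type*} [DecidableEq ι] [Fintype Φ] {A : Finset ι} {p : ℝ} (h0 : 0 < p) (h1 : p ≤ 1)
    (E : Φ → Finset ι) (hE : ∀ f, E f ⊆ A) (m : ℕ) (hc : ∀ f, (E f).card = m) :
    (Fintype.card Φ : ℝ) ^ 2 ≤ Pr A p (fun S => ∃ f, E f ⊆ S) *
      ∑ f : Φ, ∑ g : Φ, (p⁻¹) ^ (E f ∩ E g).card := by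
  set X : Finset ι → ℝ := fun S => ∑ f : Φ, ind (E f ⊆ S) with hX
  have hcs := Ex_sq_le (A := A) h0.le h1 X
  have e1 : Ex A p X = (Fintype.card Φ : ℝ) * p ^ m := by
    rw [hX, Ex_sum]
    have : ∀ f ∈ (Finset.univ : Finset Φ), Ex A p (fun S => ind (E f ⊆ S)) = p ^ m := by
      intro f _
      rw [← hc f]
      exact Pr_subset (E f) (hE f)
    rw [Finset.sum_congr rfl this]
    simp
  have e2 : Ex A p (fun S => X S ^ 2) =
      p ^ (2 * m) * ∑ f : Φ, ∑ g : Φ, (p⁻¹) ^ (E f ∩ E g).card := by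
    have : ∀ S, X S ^ 2 = ∑ f : Φ, ∑ g : Φ, ind (E f ∪ E g ⊆ S) := by
      intro S
      rw [sq, hX, Finset.sum_mul_sum]
      refine Finset.sum_congr rfl fun f _ => Finset.sum_congr rfl fun g _ => ?_
      rw [← ind_and]
      exact ind_congr Finset.union_subset_iff.symm
    simp only [this]
    rw [Ex_sum, Finset.mul_sum]
    refine Finset.sum_congr rfl fun f _ => ?_
    rw [Ex_sum, Finset.mul_sum]
    refine Finset.sum_congr rfl fun g _ => ?_
    have h2 := Pr_subset (p := p) (E f ∪ E g) (Finset.union_subset (hE f) (hE g))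
    unfold Pr at h2
    rw [h2]
    have h3 := Finset.card_union_add_card_inter (E f) (E g)
    rw [hc f, hc g] at h3
    have h4 : 2 * m = (E f ∪ E g).card + (E f ∩ E g).card := by omega
    rw [h4, pow_add, mul_assoc, ← mul_pow, mul_inv_cancel₀ h0.ne', one_pow, mul_one]
  have e3 : Pr A p (fun S => X S ≠ 0) ≤ Pr A p (fun S => ∃ f, E f ⊆ S) := by
    apply Pr_mono h0.le h1
    intro S _ h
    by_contra hcon
    push Not at hcon
    apply h
    rw [hX]
    exact Finset.sum_eq_zero fun f _ => ind_neg (hcon f)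
  rw [e1, e2] at hcs
  have hpos : 0 ≤ ∑ f : Φ, ∑ g : Φ, (p⁻¹) ^ (E f ∩ E g).card := by positivity
  have hp2 : 0 < p ^ (2 * m) := by positivity
  have := hcs.trans (mul_le_mul_of_nonneg_left e3 (mul_nonneg hp2.le hpos))
  have h5 : p ^ (2 * m) * (Fintype.card Φ : ℝ) ^ 2 ≤ p ^ (2 * m) *
      (Pr A p (fun S => ∃ f, E f ⊆ S) * ∑ f : Φ, ∑ g : Φ, (p⁻¹) ^ (E f ∩ E g).card) := by
    calc _ = ((Fintype.card Φ : ℝ) * p ^ m) ^ 2 := by ring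
      _ ≤ _ := this
      _ = _ := by ring
  exact le_of_mul_le_mul_left h5 hp2

section pat
set_option linter.unusedSectionVars false
variable {W R ε V : Type} [Fintype W] [Fintype ε]

def inS (S : Finset W) (x : W ⊕ R) : Prop := ∀ w, x = Sum.inl w → w ∈ S

open Classical in
noncomputable def cnt (sr tg : ε → W ⊕ R) (S : Finset W) : ℕ :=
  (Finset.univ.filter fun e => inS S (sr e) ∧ inS S (tg e)).card

def emb {N : ℕ} (ψ : W × Fin N → V) (ρ : R → V) (f : W → Fin N) : W ⊕ R → V :=
  Sum.elim (fun w => ψ (w, f w)) ρ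

open Classical in
noncomputable def Eim (sr tg : ε → W ⊕ R) (φ : W ⊕ R → V) : Finset (Sym2 V) :=
  Finset.univ.image fun e => s(φ (sr e), φ (tg e))

structure PatOK (sr tg : ε → W ⊕ R) : Prop where
  ne : ∀ e, sr e ≠ tg e
  inj : ∀ e e', s(sr e, tg e) = s(sr e', tg e') → e = e'
  root : ∀ e, (∃ w, sr e = Sum.inl w) ∨ (∃ w, tg e = Sum.inl w)

structure EmbOK {N : ℕ} (ψ : W × Fin N → V) (ρ : R → V) : Prop where
  inj1 : Function.Injective ψ
  inj2 : Function.Injective ρ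
  ne : ∀ a b, ψ a ≠ ρ b

lemma emb_eq {N : ℕ} {ψ : W × Fin N → V} {ρ : R → V} (h : EmbOK ψ ρ) (f g : W → Fin N)
    (x y : W ⊕ R) (hxy : emb ψ ρ f x = emb ψ ρ g y) :
    x = y ∧ ∀ w, x = Sum.inl w → f w = g w := by
  rcases x with w | r <;> rcases y with w' | r' <;> simp only [emb, Sum.elim_inl, Sum.elim_inr] at hxy
  · have := h.inj1 hxy
    simp only [Prod.mk.injEq] at this
    obtain ⟨rfl, h2⟩ := this
    refine ⟨rfl, ?_⟩
    rintro w' h3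
    simp only [Sum.inl.injEq] at h3
    subst h3; exact h2
  · exact absurd hxy (h.ne _ _)
  · exact absurd hxy.symm (h.ne _ _)
  · rw [h.inj2 hxy]; simp

lemma Eim_card {sr tg : ε → W ⊕ R} (hP : PatOK sr tg) {φ : W ⊕ R → V}
    (h : Function.Injective φ) : (Eim sr tg φ).card = Fintype.card ε := by
  classical
  unfold Eim
  rw [Finset.card_image_of_injective, Finset.card_univ]
  intro e e' hee
  apply hP.inj
  have : Sym2.map φ s(sr e, tg e) = Sym2.map φ s(sr e', tg e') := by simpa using hee
  exact Sym2.map.injective h this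

lemma emb_inj {N : ℕ} {ψ : W × Fin N → V} {ρ : R → V} (h : EmbOK ψ ρ) (f : W → Fin N) :
    Function.Injective (emb ψ ρ f) := fun x y hxy => (emb_eq h f f x y hxy).1

open Classical in
lemma inter_le {N : ℕ} {sr tg : ε → W ⊕ R} (hP : PatOK sr tg)
    {ψ : W × Fin N → V} {ρ : R → V} (h : EmbOK ψ ρ) (f g : W → Fin N) :
    (Eim sr tg (emb ψ ρ f) ∩ Eim sr tg (emb ψ ρ g)).card ≤
      cnt sr tg (Finset.univ.filter fun w => f w = g w) := by
  unfold cnt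
  refine (Finset.card_le_card (t := ((Finset.univ.filter fun e =>
    inS (Finset.univ.filter fun w => f w = g w) (sr e) ∧
    inS (Finset.univ.filter fun w => f w = g w) (tg e))).image
      fun e => s(emb ψ ρ f (sr e), emb ψ ρ f (tg e))) ?_).trans Finset.card_image_le
  intro x hx
  rw [Finset.mem_inter] at hx
  obtain ⟨h1, h2⟩ := hx
  simp only [Eim, Finset.mem_image, Finset.mem_univ, true_and] at h1 h2
  obtain ⟨e, rfl⟩ := h1
  obtain ⟨e', he'⟩ := h2
  rw [Finset.mem_image]
  refine ⟨e, ?_, rfl⟩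
  rw [Finset.mem_filter]
  refine ⟨Finset.mem_univ _, ?_⟩
  have hee : e' = e := by
    apply hP.inj
    rw [Sym2.eq_iff] at he' ⊢
    rcases he' with ⟨a, b⟩ | ⟨a, b⟩
    · left; exact ⟨(emb_eq h _ _ _ _ a).1, (emb_eq h _ _ _ _ b).1⟩
    · right; exact ⟨(emb_eq h _ _ _ _ a).1, (emb_eq h _ _ _ _ b).1⟩
  subst hee
  rw [Sym2.eq_iff] at he'
  rcases he' with ⟨a, b⟩ | ⟨a, b⟩
  · refine ⟨fun w hw => ?_, fun w hw => ?_⟩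
    · simp only [Finset.mem_filter, Finset.mem_univ, true_and]
      exact ((emb_eq h _ _ _ _ a).2 w hw).symm
    · simp only [Finset.mem_filter, Finset.mem_univ, true_and]
      exact ((emb_eq h _ _ _ _ b).2 w hw).symm
  · exact absurd (emb_eq h _ _ _ _ a).1 (hP.ne e')

open Classical in
lemma pairs_card (N : ℕ) (S : Finset W) :
    ((Finset.univ : Finset ((W → Fin N) × (W → Fin N))).filter
      fun q => ∀ w ∈ S, q.1 w = q.2 w).card * N ^ S.card = N ^ (2 * Fintype.card W) := by
  have h1 : ((Finset.univ : Finset ((W → Fin N) × (W → Fin N))).filter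
      fun q => ∀ w ∈ S, q.1 w = q.2 w).card = (Fintype.piFinset fun w : W =>
      if w ∈ S then (Finset.univ : Finset (Fin N)).diag else Finset.univ).card := by
    refine Finset.card_bij (fun q _ => fun w => (q.1 w, q.2 w)) ?_ ?_ ?_
    · intro q hq
      simp only [Finset.mem_filter, Finset.mem_univ, true_and] at hq
      rw [Fintype.mem_piFinset]
      intro w
      split_ifs with h
      · simp [hq w h]
      · simp
    · intro q _ q' _ h
      have := fun w => congrFun h w
      simp only [Prod.mk.injEq] at this
      exact Prod.ext (funext fun w => (this w).1) (funext fun w => (this w).2)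
    · intro g hg
      rw [Fintype.mem_piFinset] at hg
      refine ⟨(fun w => (g w).1, fun w => (g w).2), ?_, rfl⟩
      simp only [Finset.mem_filter, Finset.mem_univ, true_and]
      intro w hw
      have := hg w
      rw [if_pos hw] at this
      simpa using this
  rw [h1, Fintype.card_piFinset]
  have h2 : ∀ w : W, (if w ∈ S then (Finset.univ : Finset (Fin N)).diag else Finset.univ).card *
      (if w ∈ S then N else 1) = N ^ 2 := by
    intro w
    split_ifs
    · simp [Finset.diag_card, sq]
    · simp [sq]
  have h3 : N ^ S.card = ∏ w : W, (if w ∈ S then N else 1) := by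
    rw [Finset.prod_ite_mem]; simp
  rw [h3, ← Finset.prod_mul_distrib, Finset.prod_congr rfl fun w _ => h2 w]
  simp [← pow_mul]

open Classical in
lemma SM3 {A : Finset (Sym2 V)} {p : ℝ} (h0 : 0 < p) (h1 : p ≤ 1) {N : ℕ} (hN : 0 < N)
    {sr tg : ε → W ⊕ R} (hP : PatOK sr tg)
    {ψ : W × Fin N → V} {ρ : R → V} (h : EmbOK ψ ρ)
    (hA : ∀ f, Eim sr tg (emb ψ ρ f) ⊆ A) :
    1 ≤ Pr A p (fun S => ∃ f, Eim sr tg (emb ψ ρ f) ⊆ S) *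
      ∑ S : Finset W, ((N : ℝ)⁻¹) ^ S.card * (p⁻¹) ^ (cnt sr tg S) := by
  have key := SM1 h0 h1 (fun f => Eim sr tg (emb ψ ρ f)) hA (Fintype.card ε)
    (fun f => Eim_card hP (emb_inj h f))
  have hp1 : 1 ≤ p⁻¹ := (one_le_inv₀ h0).2 h1
  have hN' : (0 : ℝ) < N := by exact_mod_cast hN
  have hle : ∑ f : W → Fin N, ∑ g : W → Fin N,
      (p⁻¹) ^ (Eim sr tg (emb ψ ρ f) ∩ Eim sr tg (emb ψ ρ g)).card ≤
      (N : ℝ) ^ (2 * Fintype.card W) *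
      ∑ S : Finset W, ((N : ℝ)⁻¹) ^ S.card * (p⁻¹) ^ (cnt sr tg S) := by
    rw [← Fintype.sum_prod_type' (fun f g =>
      (p⁻¹) ^ (Eim sr tg (emb ψ ρ f) ∩ Eim sr tg (emb ψ ρ g)).card)]
    calc _ ≤ ∑ q : (W → Fin N) × (W → Fin N), ∑ S : Finset W,
          (if (∀ w ∈ S, q.1 w = q.2 w) then (p⁻¹) ^ (cnt sr tg S) else 0) := by
          apply Finset.sum_le_sum
          intro q _
          have hnn : ∀ S ∈ (Finset.univ : Finset (Finset W)),
            0 ≤ (if (∀ w ∈ S, q.1 w = q.2 w) then (p⁻¹) ^ (cnt sr tg S) else 0) := by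
            intro S _
            split_ifs <;> positivity
          refine le_trans ?_ (Finset.single_le_sum hnn
            (Finset.mem_univ (Finset.univ.filter fun w => q.1 w = q.2 w)))
          rw [if_pos]
          · exact pow_le_pow_right₀ hp1 (inter_le hP h q.1 q.2)
          · intro w hw; simpa using hw
      _ = _ := by
          rw [Finset.sum_comm, Finset.mul_sum]
          apply Finset.sum_congr rfl
          intro S _
          rw [← Finset.sum_filter, Finset.sum_const, nsmul_eq_mul, ← mul_assoc]
          congr 1
          have := pairs_card N S
          have h3 : (((Finset.univ : Finset ((W → Fin N) × (W → Fin N))).filter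
            fun q => ∀ w ∈ S, q.1 w = q.2 w).card : ℝ) * (N : ℝ) ^ S.card =
              (N : ℝ) ^ (2 * Fintype.card W) := by exact_mod_cast this
          rw [← h3, mul_assoc, ← mul_pow, mul_inv_cancel₀ hN'.ne', one_pow, mul_one]
  have hcard : (Fintype.card (W → Fin N) : ℝ) ^ 2 = (N : ℝ) ^ (2 * Fintype.card W) := by
    simp [← pow_mul, mul_comm]
  rw [hcard] at key
  have hpow : (0:ℝ) < (N : ℝ) ^ (2 * Fintype.card W) := by positivity
  have := key.trans (mul_le_mul_of_nonneg_left hle (Pr_nonneg h0.le h1 _))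
  refine le_of_mul_le_mul_left ?_ hpow
  calc _ = (N : ℝ) ^ (2 * Fintype.card W) := mul_one _
    _ ≤ _ := this
    _ = _ := by ring

lemma cnt_empty {sr tg : ε → W ⊕ R} (hP : PatOK sr tg) : cnt sr tg ∅ = 0 := by
  classical
  unfold cnt
  rw [Finset.card_eq_zero, Finset.filter_eq_empty_iff]
  rintro e _ ⟨h1, h2⟩
  rcases hP.root e with ⟨w, hw⟩ | ⟨w, hw⟩
  · simpa using h1 w hw
  · simpa using h2 w hw

open Classical in
lemma SM4 {A : Finset (Sym2 V)} {α η K : ℝ} {n : ℕ} (hn : 1 ≤ n) (hα : 0 ≤ α)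
    (hK : 1 ≤ K) {N : ℕ} (hN : (n : ℝ) ≤ K * N)
    {sr tg : ε → W ⊕ R} (hP : PatOK sr tg)
    {ψ : W × Fin N → V} {ρ : R → V} (h : EmbOK ψ ρ)
    (hA : ∀ f, Eim sr tg (emb ψ ρ f) ⊆ A)
    (hbal : ∀ S : Finset W, S.Nonempty → η ≤ (S.card : ℝ) - α * cnt sr tg S) :
    1 ≤ Pr A ((n : ℝ) ^ (-α)) (fun S => ∃ f, Eim sr tg (emb ψ ρ f) ⊆ S) *
      (1 + 2 ^ Fintype.card W * K ^ Fintype.card W * (n : ℝ) ^ (-η)) := by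
  have hn0 : (0 : ℝ) < n := by exact_mod_cast hn
  have hn1 : (1 : ℝ) ≤ n := by exact_mod_cast hn
  have h0 : 0 < (n : ℝ) ^ (-α) := Real.rpow_pos_of_pos hn0 _
  have h1 : (n : ℝ) ^ (-α) ≤ 1 := Real.rpow_le_one_of_one_le_of_nonpos hn1 (by linarith)
  have hNpos : 0 < N := by
    rcases Nat.eq_zero_or_pos N with h | h
    · subst h; simp at hN; linarith
    · exact h
  have hN' : (0 : ℝ) < N := by exact_mod_cast hNpos
  refine (SM3 h0 h1 hNpos hP h hA).trans ?_
  apply mul_le_mul_of_nonneg_left _ (Pr_nonneg h0.le h1 _)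
  have hterm : ∀ S : Finset W, S ≠ ∅ →
      ((N : ℝ)⁻¹) ^ S.card * (((n : ℝ) ^ (-α))⁻¹) ^ (cnt sr tg S) ≤
        K ^ Fintype.card W * (n : ℝ) ^ (-η) := by
    intro S hS
    have hb := hbal S (Finset.nonempty_iff_ne_empty.2 hS)
    have e1 : (N : ℝ)⁻¹ ≤ K * (n : ℝ)⁻¹ := by
      rw [← div_eq_mul_inv, le_div_iff₀ hn0, inv_mul_le_iff₀ hN', mul_comm]; exact hN
    have e2 : ((N : ℝ)⁻¹) ^ S.card ≤ K ^ Fintype.card W * (n : ℝ) ^ (-(S.card : ℝ)) := by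
      calc ((N : ℝ)⁻¹) ^ S.card ≤ (K * (n : ℝ)⁻¹) ^ S.card :=
            pow_le_pow_left₀ (by positivity) e1 _
        _ = K ^ S.card * (n : ℝ) ^ (-(S.card : ℝ)) := by
            rw [mul_pow, Real.rpow_neg hn0.le, Real.rpow_natCast, inv_pow]
        _ ≤ _ := by
            apply mul_le_mul_of_nonneg_right _ (by positivity)
            exact pow_le_pow_right₀ hK (Finset.card_le_univ S)
    have e3 : (((n : ℝ) ^ (-α))⁻¹) ^ (cnt sr tg S) = (n : ℝ) ^ (α * cnt sr tg S) := by
      rw [Real.rpow_neg hn0.le, inv_inv, ← Real.rpow_natCast, ← Real.rpow_mul hn0.le]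
    rw [e3]
    calc _ ≤ K ^ Fintype.card W * (n : ℝ) ^ (-(S.card : ℝ)) * (n : ℝ) ^ (α * cnt sr tg S) :=
          mul_le_mul_of_nonneg_right e2 (by positivity)
      _ = K ^ Fintype.card W * (n : ℝ) ^ (-(S.card : ℝ) + α * cnt sr tg S) := by
          rw [mul_assoc, ← Real.rpow_add hn0]
      _ ≤ _ := by
          apply mul_le_mul_of_nonneg_left _ (by positivity)
          exact Real.rpow_le_rpow_of_exponent_le hn1 (by linarith)
  rw [← Finset.add_sum_erase _ _ (Finset.mem_univ (∅ : Finset W))]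
  rw [cnt_empty hP]
  simp only [Finset.card_empty, pow_zero, mul_one]
  apply add_le_add le_rfl
  calc _ ≤ ∑ S ∈ (Finset.univ : Finset (Finset W)).erase ∅,
        K ^ Fintype.card W * (n : ℝ) ^ (-η) :=
        Finset.sum_le_sum fun S hS => hterm S (Finset.ne_of_mem_erase hS)
    _ ≤ _ := by
        rw [Finset.sum_const, nsmul_eq_mul, mul_assoc]
        apply mul_le_mul_of_nonneg_right _ (by positivity)
        have : ((Finset.univ : Finset (Finset W)).erase ∅).card ≤ 2 ^ Fintype.card W := by
          refine (Finset.card_erase_le).trans ?_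
          simp
        exact_mod_cast this

end pat
end RGS

namespace RGS

def Sub {V : Type} (Γ : SimpleGraph V) (vs : Finset V) (es : Finset (Sym2 V)) : Prop :=
  ∀ e ∈ es, e ∈ Γ.edgeSet ∧ ∀ v ∈ e, v ∈ vs

noncomputable def mu {V : Type} (α : ℝ) (vs : Finset V) (es : Finset (Sym2 V)) : ℝ :=
  vs.card - α * es.card

def EvN0 {V : Type} (α : ℝ) (C : ℕ) (Γ : SimpleGraph V) : Prop :=
  ∀ vs es, Sub Γ vs es → vs.card ≤ C → 0 ≤ mu α vs es

def EvN {V : Type} (α : ℝ) (C : ℕ) (Γ : SimpleGraph V) : Prop :=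
  ∀ vs es, Sub Γ vs es → 1 ≤ vs.card → vs.card ≤ C → 0 < mu α vs es

lemma mem_gr {n : ℕ} {S : Finset (Sym2 (Fin n))} {e : Sym2 (Fin n)} :
    e ∈ (gr S).edgeSet ↔ e ∈ S ∧ ¬ e.IsDiag := by
  rw [gr, SimpleGraph.edgeSet_fromEdgeSet]
  simp [Set.mem_sdiff]

lemma sum_vs (n C : ℕ) (hn : 1 ≤ n) :
    ∑ vs ∈ (Finset.univ : Finset (Finset (Fin n))).filter (fun vs => vs.card ≤ C),
      (n : ℝ) ^ (-(vs.card : ℝ)) ≤ C + 1 := by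
  have hn0 : (0 : ℝ) < n := by exact_mod_cast hn
  rw [← Finset.sum_fiberwise_of_maps_to (t := Finset.range (C + 1)) (g := Finset.card)]
  · have : ∀ v ∈ Finset.range (C + 1), ∑ vs ∈ ((Finset.univ : Finset (Finset (Fin n))).filter
        (fun vs => vs.card ≤ C)).filter (fun vs => vs.card = v),
        (n : ℝ) ^ (-(vs.card : ℝ)) ≤ 1 := by
      intro v _
      calc _ ≤ ∑ vs ∈ Finset.powersetCard v (Finset.univ : Finset (Fin n)),
              (n : ℝ) ^ (-(vs.card : ℝ)) := by
            apply Finset.sum_le_sum_of_subset_of_nonneg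
            · intro vs hvs
              simp only [Finset.mem_filter] at hvs
              rw [Finset.mem_powersetCard]
              exact ⟨Finset.subset_univ _, hvs.2⟩
            · intros; positivity
        _ = ∑ vs ∈ Finset.powersetCard v (Finset.univ : Finset (Fin n)),
              (n : ℝ) ^ (-(v : ℝ)) := by
            apply Finset.sum_congr rfl
            intro vs hvs
            rw [(Finset.mem_powersetCard.1 hvs).2]
        _ ≤ 1 := by
            rw [Finset.sum_const, Finset.card_powersetCard, nsmul_eq_mul, Finset.card_fin,
              Real.rpow_neg hn0.le, Real.rpow_natCast, ← div_eq_mul_inv,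
              div_le_one (by positivity)]
            exact_mod_cast Nat.choose_le_pow n v
    calc _ ≤ ∑ v ∈ Finset.range (C + 1), (1 : ℝ) := Finset.sum_le_sum this
      _ = C + 1 := by simp
  · intro vs hvs
    simp only [Finset.mem_filter] at hvs
    simp only [Finset.mem_range]
    omega

open Classical in
noncomputable def Bd (n C : ℕ) (α κ : ℝ) : Finset (Σ _ : Finset (Fin n), Finset (Sym2 (Fin n))) :=
  (((Finset.univ : Finset (Finset (Fin n))).filter (fun vs => vs.card ≤ C)).sigma
    (fun vs => vs.sym2.powerset)).filter
    (fun x => x.2 ⊆ EE n ∧ 1 ≤ x.1.card ∧ κ ≤ α * x.2.card - x.1.card)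

lemma sym2_card_le {V : Type} (vs : Finset V) (C : ℕ) (h : vs.card ≤ C) :
    vs.sym2.card ≤ (C + 1) ^ 2 := by
  rw [Finset.card_sym2]
  exact (Nat.choose_le_pow _ _).trans (Nat.pow_le_pow_left (by omega) _)

lemma Bd_term {n C : ℕ} {α κ : ℝ} (hn : 1 ≤ n) {x : Σ _ : Finset (Fin n), Finset (Sym2 (Fin n))}
    (hx : x ∈ Bd n C α κ) :
    ((n : ℝ) ^ (-α)) ^ x.2.card ≤ (n : ℝ) ^ (-κ) * (n : ℝ) ^ (-(x.1.card : ℝ)) := by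
  have hn0 : (0 : ℝ) < n := by exact_mod_cast hn
  have hn1 : (1 : ℝ) ≤ n := by exact_mod_cast hn
  simp only [Bd, Finset.mem_filter] at hx
  rw [← Real.rpow_natCast, ← Real.rpow_mul hn0.le, ← Real.rpow_add hn0]
  apply Real.rpow_le_rpow_of_exponent_le hn1
  linarith [hx.2.2.2]

lemma sum_Bd {n C : ℕ} {α κ : ℝ} (hn : 1 ≤ n) :
    ∑ x ∈ Bd n C α κ, ((n : ℝ) ^ (-α)) ^ x.2.card ≤
      2 ^ ((C + 1) ^ 2) * (C + 1) * (n : ℝ) ^ (-κ) := by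
  classical
  have hn0 : (0 : ℝ) < n := by exact_mod_cast hn
  calc _ ≤ ∑ x ∈ Bd n C α κ, (n : ℝ) ^ (-κ) * (n : ℝ) ^ (-(x.1.card : ℝ)) :=
        Finset.sum_le_sum fun x hx => Bd_term hn hx
    _ ≤ ∑ x ∈ (((Finset.univ : Finset (Finset (Fin n))).filter (fun vs => vs.card ≤ C)).sigma
          (fun vs => vs.sym2.powerset)), (n : ℝ) ^ (-κ) * (n : ℝ) ^ (-(x.1.card : ℝ)) := by
        apply Finset.sum_le_sum_of_subset_of_nonneg
        · exact Finset.filter_subset _ _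
        · intros; positivity
    _ = ∑ vs ∈ ((Finset.univ : Finset (Finset (Fin n))).filter (fun vs => vs.card ≤ C)),
          ∑ es ∈ vs.sym2.powerset, (n : ℝ) ^ (-κ) * (n : ℝ) ^ (-(vs.card : ℝ)) := by
        rw [Finset.sum_sigma]
    _ ≤ ∑ vs ∈ ((Finset.univ : Finset (Finset (Fin n))).filter (fun vs => vs.card ≤ C)),
          (2 ^ ((C + 1) ^ 2) * (n : ℝ) ^ (-κ)) * (n : ℝ) ^ (-(vs.card : ℝ)) := by
        apply Finset.sum_le_sum
        intro vs hvs
        simp only [Finset.mem_filter] at hvs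
        rw [Finset.sum_const, nsmul_eq_mul, Finset.card_powerset, ← mul_assoc]
        apply mul_le_mul_of_nonneg_right _ (by positivity)
        apply mul_le_mul_of_nonneg_right _ (by positivity)
        push_cast
        exact pow_le_pow_right₀ (by norm_num) (sym2_card_le vs C hvs.2)
    _ = (2 ^ ((C + 1) ^ 2) * (n : ℝ) ^ (-κ)) * _ := by rw [← Finset.mul_sum]
    _ ≤ (2 ^ ((C + 1) ^ 2) * (n : ℝ) ^ (-κ)) * (C + 1) :=
        mul_le_mul_of_nonneg_left (sum_vs n C hn) (by positivity)
    _ = _ := by ring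

lemma Sub_mem {n : ℕ} {S : Finset (Sym2 (Fin n))} (_hS : S ⊆ EE n) {vs : Finset (Fin n)}
    {es : Finset (Sym2 (Fin n))} (h : Sub (gr S) vs es) :
    es ⊆ S ∧ es ⊆ EE n ∧ es ⊆ vs.sym2 := by
  refine ⟨fun e he => (mem_gr.1 (h e he).1).1, fun e he => mem_EE.2 (mem_gr.1 (h e he).1).2,
    fun e he => Finset.mem_sym2_iff.2 (h e he).2⟩

lemma exists_kappa (α : ℝ) (C D : ℕ) : ∃ κ : ℝ, 0 < κ ∧ ∀ v e : ℕ, v ≤ C → e ≤ D →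
    (v : ℝ) - α * e < 0 → κ ≤ α * e - v := by
  classical
  set T := ((Finset.range (C + 1)) ×ˢ (Finset.range (D + 1))).filter
    (fun x => (x.1 : ℝ) - α * x.2 < 0) with hT
  by_cases hTe : T.Nonempty
  · obtain ⟨x, hx, hmin⟩ := Finset.exists_min_image T (fun x => α * x.2 - (x.1 : ℝ)) hTe
    refine ⟨α * x.2 - x.1, ?_, ?_⟩
    · simp only [hT, Finset.mem_filter] at hx
      linarith [hx.2]
    · intro v e hv he h
      exact hmin (v, e) (by
        simp only [hT, Finset.mem_filter, Finset.mem_product, Finset.mem_range]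
        exact ⟨⟨by omega, by omega⟩, h⟩)
  · refine ⟨1, one_pos, ?_⟩
    intro v e hv he h
    exact absurd ⟨(v, e), by
      simp only [hT, Finset.mem_filter, Finset.mem_product, Finset.mem_range]
      exact ⟨⟨by omega, by omega⟩, h⟩⟩ hTe

lemma prob_basic {n : ℕ} {α : ℝ} (hn : 1 ≤ n) (hα : 0 ≤ α) :
    0 < (n : ℝ) ^ (-α) ∧ (n : ℝ) ^ (-α) ≤ 1 :=
  ⟨Real.rpow_pos_of_pos (by exact_mod_cast hn) _,
    Real.rpow_le_one_of_one_le_of_nonpos (by exact_mod_cast hn) (by linarith)⟩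

lemma tendsto_rpow_neg_nat {κ : ℝ} (hκ : 0 < κ) :
    Tendsto (fun n : ℕ => (n : ℝ) ^ (-κ)) atTop (nhds 0) :=
  (tendsto_rpow_neg_atTop hκ).comp tendsto_natCast_atTop_atTop

lemma prob_N0 {α : ℝ} (hα : 0 ≤ α) (C : ℕ) :
    Tendsto (fun n : ℕ => Pr (EE n) ((n : ℝ) ^ (-α)) (fun S => ¬ EvN0 α C (gr S))) atTop (nhds 0) := by
  classical
  obtain ⟨κ, hκ, hk⟩ := exists_kappa α C ((C + 1) ^ 2)
  refine squeeze_zero' (g := fun n : ℕ => 2 ^ ((C + 1) ^ 2) * (C + 1) * (n : ℝ) ^ (-κ)) ?_ ?_ ?_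
  · filter_upwards [eventually_ge_atTop 1] with n hn
    exact Pr_nonneg (prob_basic hn hα).1.le (prob_basic hn hα).2 _
  · filter_upwards [eventually_ge_atTop 1] with n hn
    obtain ⟨p0, p1⟩ := prob_basic hn hα
    refine le_trans ?_ (sum_Bd (n := n) (C := C) (α := α) (κ := κ) hn)
    have : ∀ x ∈ Bd n C α κ, Pr (EE n) ((n : ℝ) ^ (-α)) (fun S => x.2 ⊆ S) =
        ((n : ℝ) ^ (-α)) ^ x.2.card := by
      intro x hx
      simp only [Bd, Finset.mem_filter] at hx
      exact Pr_subset _ hx.2.1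
    rw [← Finset.sum_congr rfl this]
    refine le_trans (Pr_mono p0.le p1 ?_) (Pr_union p0.le p1 _ _)
    intro S hS hN
    unfold EvN0 at hN
    push Not at hN
    obtain ⟨vs, es, hsub, hC, hmu⟩ := hN
    obtain ⟨h1, h2, h3⟩ := Sub_mem hS hsub
    refine ⟨⟨vs, es⟩, ?_, h1⟩
    simp only [Bd, Finset.mem_filter, Finset.mem_sigma, Finset.mem_univ, true_and,
      Finset.mem_powerset]
    refine ⟨⟨hC, h3⟩, h2, ?_, ?_⟩
    · by_contra h0
      have : vs = ∅ := by
        rw [← Finset.card_eq_zero]; omega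
      subst this
      have : es = ∅ := by simpa using h3
      subst this
      simp [mu] at hmu
    · exact hk _ _ hC ((Finset.card_le_card h3).trans (sym2_card_le vs C hC)) hmu
  · have := (tendsto_rpow_neg_nat hκ).const_mul (2 ^ ((C + 1) ^ 2) * ((C : ℝ) + 1))
    simpa using this

lemma one_sub_ge {x : ℝ} (h0 : 0 ≤ x) (h1 : x ≤ 1 / 2) : Real.exp (-(2 * x)) ≤ 1 - x := by
  have h2 : 2 * x + 1 ≤ Real.exp (2 * x) := Real.add_one_le_exp _
  rw [Real.exp_neg, inv_le_comm₀ (Real.exp_pos _) (by linarith)]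
  refine le_trans ?_ h2
  rw [inv_le_iff_one_le_mul₀ (by linarith)]
  nlinarith

lemma prob_N {α : ℝ} (hα : 0 ≤ α) (C : ℕ) :
    ∃ c : ℝ, 0 < c ∧ ∀ n : ℕ, 2 ≤ n → c ≤ Pr (EE n) ((n : ℝ) ^ (-α)) (fun S => EvN α C (gr S)) := by
  classical
  refine ⟨Real.exp (-(2 * (2 ^ ((C + 1) ^ 2) * (C + 1)))), Real.exp_pos _, fun n hn => ?_⟩
  have hn1 : 1 ≤ n := by omega
  obtain ⟨p0, p1⟩ := prob_basic hn1 hα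
  have hs := sum_Bd (n := n) (C := C) (α := α) (κ := 0) hn1
  simp only [neg_zero, Real.rpow_zero, mul_one] at hs
  have key := Pr_avoid (A := EE n) p0.le p1 (Bd n C α 0) (fun x => x.2) (by
    intro x hx
    simp only [Bd, Finset.mem_filter] at hx
    exact hx.2.1)
  calc _ ≤ Real.exp (-(2 * ∑ x ∈ Bd n C α 0, ((n : ℝ) ^ (-α)) ^ x.2.card)) := by
        apply Real.exp_le_exp.2; linarith
    _ = ∏ x ∈ Bd n C α 0, Real.exp (-(2 * ((n : ℝ) ^ (-α)) ^ x.2.card)) := by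
        rw [← Real.exp_sum, Finset.mul_sum, Finset.sum_neg_distrib]
    _ ≤ ∏ x ∈ Bd n C α 0, (1 - ((n : ℝ) ^ (-α)) ^ x.2.card) := by
        apply Finset.prod_le_prod
        · intros; exact (Real.exp_pos _).le
        · intro x hx
          apply one_sub_ge (by positivity)
          refine (Bd_term hn1 hx).trans ?_
          simp only [Bd, Finset.mem_filter] at hx
          have hv := hx.2.2.1
          have hn2 : (2 : ℝ) ≤ n := by exact_mod_cast hn
          rw [neg_zero, Real.rpow_zero, one_mul]
          calc (n : ℝ) ^ (-(x.1.card : ℝ)) ≤ (n : ℝ) ^ (-1 : ℝ) := by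
                apply Real.rpow_le_rpow_of_exponent_le (by linarith)
                have : (1 : ℝ) ≤ x.1.card := by exact_mod_cast hv
                linarith
            _ ≤ 1 / 2 := by
                rw [Real.rpow_neg_one, one_div]
                exact inv_anti₀ (by norm_num) hn2
    _ ≤ _ := key
    _ ≤ _ := by
        apply Pr_mono p0.le p1
        intro S hS h vs es hsub hv hC
        by_contra hmu
        obtain ⟨h1, h2, h3⟩ := Sub_mem hS hsub
        refine h ⟨vs, es⟩ ?_ h1
        simp only [Bd, Finset.mem_filter, Finset.mem_sigma, Finset.mem_univ, true_and,
          Finset.mem_powerset]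
        refine ⟨⟨hC, h3⟩, h2, hv, ?_⟩
        unfold mu at hmu
        linarith

section ext
set_option linter.unusedSectionVars false
variable {W R ε : Type} [Fintype W] [Fintype ε] [Fintype R]

def HasExt {V : Type} (sr tg : ε → W ⊕ R) (Γ : SimpleGraph V) (A : Finset V) (ρ : R → V) : Prop :=
  ∃ φ : W ⊕ R → V, Function.Injective φ ∧ (∀ r, φ (Sum.inr r) = ρ r) ∧
    (∀ w, φ (Sum.inl w) ∉ A) ∧ ∀ e, Γ.Adj (φ (sr e)) (φ (tg e))

lemma HasExt_of_Eim {n N : ℕ} {sr tg : ε → W ⊕ R} {S : Finset (Sym2 (Fin n))}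
    (hS : S ⊆ EE n) {A : Finset (Fin n)}
    {ψ : W × Fin N → Fin n} {ρ : R → Fin n} (h : EmbOK ψ ρ) (hA : ∀ x, ψ x ∉ A)
    {f : W → Fin N} (hf : Eim sr tg (emb ψ ρ f) ⊆ S) : HasExt sr tg (gr S) A ρ := by
  refine ⟨emb ψ ρ f, emb_inj h f, fun r => rfl, fun w => hA _, fun e => ?_⟩
  rw [← SimpleGraph.mem_edgeSet, mem_gr]
  have : s(emb ψ ρ f (sr e), emb ψ ρ f (tg e)) ∈ S := by
    apply hf
    simp only [Eim, Finset.mem_image]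
    exact ⟨e, Finset.mem_univ _, rfl⟩
  exact ⟨this, mem_EE.1 (hS this)⟩

lemma Eim_sub_EE {n N : ℕ} {sr tg : ε → W ⊕ R} (hP : PatOK sr tg)
    {ψ : W × Fin N → Fin n} {ρ : R → Fin n} (h : EmbOK ψ ρ) (f : W → Fin N) :
    Eim sr tg (emb ψ ρ f) ⊆ EE n := by
  intro e he
  simp only [Eim, Finset.mem_image, Finset.mem_univ, true_and] at he
  obtain ⟨e, rfl⟩ := he
  rw [mem_EE, Sym2.mk_isDiag_iff]
  intro h2
  exact hP.ne e (emb_inj h f h2)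

/-- Room for many disjoint families of colour classes. -/
lemma exists_room (M C : ℕ) : ∃ (K : ℝ) (n0 : ℕ), 1 ≤ K ∧ ∀ n, n0 ≤ n → ∃ N : ℕ,
    (n : ℝ) ≤ K * N ∧ ∀ B : Finset (Fin n), B.card ≤ C →
      ∃ Ψ : Fin M → W × Fin N → Fin n, (∀ i j x y, Ψ i x = Ψ j y → i = j ∧ x = y) ∧
        ∀ i x, Ψ i x ∉ B := by
  set Q := 2 * (M * Fintype.card W + 1) with hQ
  refine ⟨2 * Q, Q + 2 * C, ?_, ?_⟩
  · have : 1 ≤ 2 * Q := by omega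
    exact_mod_cast this
  intro n hn
  refine ⟨n / Q, ?_, ?_⟩
  · have h1 : 1 ≤ n / Q := (Nat.one_le_div_iff (by omega)).2 (by omega)
    have h2 := Nat.lt_mul_div_succ n (show 0 < Q by omega)
    have h3 : n ≤ 2 * Q * (n / Q) := by nlinarith
    exact_mod_cast h3
  · intro B hB
    have h1 : Q * (n / Q) ≤ n := Nat.mul_div_le n Q
    have h2 : M * Fintype.card W * (n / Q) * 2 ≤ n := by
      generalize n / Q = q at h1
      have h3 : Q * q = M * Fintype.card W * q * 2 + 2 * q := by rw [hQ]; ring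
      omega
    have hcard : Fintype.card (Fin M × W × Fin (n / Q)) ≤ Fintype.card {x // x ∈ Bᶜ} := by
      simp only [Fintype.card_prod, Fintype.card_fin, Fintype.card_coe, Finset.card_compl]
      rw [← mul_assoc]
      omega
    obtain ⟨g⟩ := Function.Embedding.nonempty_of_card_le hcard
    refine ⟨fun i x => (g (i, x)).1, ?_, ?_⟩
    · intro i j x y h
      have := g.injective (Subtype.ext h)
      simpa using this
    · intro i x h
      have := (g (i, x)).2
      rw [Finset.mem_compl] at this
      exact this h

lemma prob_emb [DecidableEq R] {α : ℝ} (hα : 0 ≤ α) {sr tg : ε → W ⊕ R} (hP : PatOK sr tg) [IsEmpty R]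
    (hbal : ∀ S : Finset W, S.Nonempty → 0 ≤ (S.card : ℝ) - α * cnt sr tg S) :
    ∃ c : ℝ, 0 < c ∧ ∀ᶠ n : ℕ in atTop,
      c ≤ Pr (EE n) ((n : ℝ) ^ (-α)) (fun S => HasExt sr tg (gr S) ∅ isEmptyElim) := by
  obtain ⟨K, n0, hK, hroom⟩ := exists_room (W := W) 1 0
  refine ⟨(1 + 2 ^ Fintype.card W * K ^ Fintype.card W)⁻¹, by positivity, ?_⟩
  filter_upwards [eventually_ge_atTop n0, eventually_ge_atTop 1] with n hn hn1
  obtain ⟨p0, p1⟩ := prob_basic hn1 hα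
  obtain ⟨N, hN, hB⟩ := hroom n hn
  obtain ⟨Ψ, hΨ, -⟩ := hB ∅ (by simp)
  have hE : EmbOK (Ψ 0) (isEmptyElim : R → Fin n) :=
    ⟨fun x y h => (hΨ 0 0 x y h).2, fun x => isEmptyElim x, fun a b => isEmptyElim b⟩
  have key := SM4 (A := EE n) hn1 hα hK hN hP hE (fun f => Eim_sub_EE hP hE f) hbal
  simp only [neg_zero, Real.rpow_zero, mul_one] at key
  rw [inv_le_iff_one_le_mul₀ (by positivity)]
  refine key.trans (mul_le_mul_of_nonneg_right ?_ (by positivity))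
  apply Pr_mono p0.le p1
  rintro S hS ⟨f, hf⟩
  exact HasExt_of_Eim hS hE (by simp) hf

lemma prob_one {α η K : ℝ} {n : ℕ} (hn : 1 ≤ n) (hα : 0 ≤ α)
    (hK : 1 ≤ K) {N : ℕ} (hN : (n : ℝ) ≤ K * N)
    {sr tg : ε → W ⊕ R} (hP : PatOK sr tg)
    {ψ : W × Fin N → Fin n} {ρ : R → Fin n} (h : EmbOK ψ ρ)
    (hbal : ∀ S : Finset W, S.Nonempty → η ≤ (S.card : ℝ) - α * cnt sr tg S) :
    Pr (EE n) ((n : ℝ) ^ (-α)) (fun S => ¬ ∃ f, Eim sr tg (emb ψ ρ f) ⊆ S) ≤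
      2 ^ Fintype.card W * K ^ Fintype.card W * (n : ℝ) ^ (-η) := by
  obtain ⟨p0, p1⟩ := prob_basic hn hα
  have key := SM4 (A := EE n) hn hα hK hN hP h (fun f => Eim_sub_EE hP h f) hbal
  rw [Pr_not]
  have h1 := Pr_le_one (A := EE n) p0.le p1 (fun S => ∃ f, Eim sr tg (emb ψ ρ f) ⊆ S)
  have h2 : 0 ≤ 2 ^ Fintype.card W * K ^ Fintype.card W * (n : ℝ) ^ (-η) := by positivity
  nlinarith

lemma prob_parts [DecidableEq R] {α η K : ℝ} {n M : ℕ} (hn : 1 ≤ n) (hα : 0 ≤ α)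
    (hK : 1 ≤ K) {N : ℕ} (hN : (n : ℝ) ≤ K * N)
    {sr tg : ε → W ⊕ R} (hP : PatOK sr tg)
    {A : Finset (Fin n)} {ρ : R → Fin n} (hρ : Function.Injective ρ)
    {Ψ : Fin M → W × Fin N → Fin n} (hΨ : ∀ i j x y, Ψ i x = Ψ j y → i = j ∧ x = y)
    (hA : ∀ i x, Ψ i x ∉ A) (hR : ∀ i x r, Ψ i x ≠ ρ r)
    (hbal : ∀ S : Finset W, S.Nonempty → η ≤ (S.card : ℝ) - α * cnt sr tg S) :
    Pr (EE n) ((n : ℝ) ^ (-α)) (fun S => ¬ HasExt sr tg (gr S) A ρ) ≤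
      (2 ^ Fintype.card W * K ^ Fintype.card W * (n : ℝ) ^ (-η)) ^ M := by
  classical
  obtain ⟨p0, p1⟩ := prob_basic hn hα
  have hE : ∀ i, EmbOK (Ψ i) ρ := fun i =>
    ⟨fun x y h => (hΨ i i x y h).2, hρ, fun a b => hR i a b⟩
  set T : Fin M → Finset (Sym2 (Fin n)) := fun i =>
    Finset.univ.biUnion fun f => Eim sr tg (emb (Ψ i) ρ f) with hT
  have hind := Pr_indep_prod (A := EE n) (p := (n : ℝ) ^ (-α)) (Finset.univ : Finset (Fin M)) T
    (fun i S => ¬ ∃ f, Eim sr tg (emb (Ψ i) ρ f) ⊆ S) ?_ ?_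
  · calc _ ≤ Pr (EE n) ((n : ℝ) ^ (-α)) (fun S => ∀ i ∈ (Finset.univ : Finset (Fin M)),
            ¬ ∃ f, Eim sr tg (emb (Ψ i) ρ f) ⊆ S) := by
          apply Pr_mono p0.le p1
          rintro S hS h i _ ⟨f, hf⟩
          exact h (HasExt_of_Eim hS (hE i) (hA i) hf)
      _ = _ := hind
      _ ≤ ∏ i : Fin M, (2 ^ Fintype.card W * K ^ Fintype.card W * (n : ℝ) ^ (-η)) := by
          apply Finset.prod_le_prod
          · intro i _; exact Pr_nonneg p0.le p1 _
          · intro i _; exact prob_one hn hα hK hN hP (hE i) hbal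
      _ = _ := by simp
  · intro i _ j _ hij
    rw [Finset.disjoint_left]
    intro x hx hx'
    simp only [hT, Finset.mem_biUnion, Finset.mem_univ, true_and, Eim, Finset.mem_image] at hx hx'
    obtain ⟨f, e, rfl⟩ := hx
    obtain ⟨g, e', he⟩ := hx'
    have main : ∀ x y : W ⊕ R, ∀ w, x = Sum.inl w → emb (Ψ i) ρ f x = emb (Ψ j) ρ g y → False := by
      intro x y w hw hh
      subst hw
      rcases y with w' | r
      · simp only [emb, Sum.elim_inl] at hh
        exact hij (hΨ _ _ _ _ hh).1
      · simp only [emb, Sum.elim_inl, Sum.elim_inr] at hh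
        exact hR _ _ _ hh
    rw [Sym2.eq_iff] at he
    rcases hP.root e with ⟨w, hw⟩ | ⟨w, hw⟩
    · rcases he with ⟨a, b⟩ | ⟨a, b⟩
      · exact main _ _ w hw a.symm
      · exact main _ _ w hw b.symm
    · rcases he with ⟨a, b⟩ | ⟨a, b⟩
      · exact main _ _ w hw b.symm
      · exact main _ _ w hw a.symm
  · intro i _ S
    rw [not_iff_not]
    refine exists_congr fun f => ?_
    rw [Finset.subset_inter_iff]
    constructor
    · intro h
      exact ⟨h, Finset.subset_biUnion_of_mem (fun f => Eim sr tg (emb (Ψ i) ρ f)) (Finset.mem_univ f)⟩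
    · exact fun h => h.1

def EvExt {V : Type} (sr tg : ε → W ⊕ R) (C : ℕ) (Γ : SimpleGraph V) : Prop :=
  ∀ A : Finset V, A.card ≤ C → ∀ ρ : R → V, Function.Injective ρ → HasExt sr tg Γ A ρ

lemma prob_Ext [DecidableEq R] {α η : ℝ} (hα : 0 ≤ α) (hη : 0 < η) {sr tg : ε → W ⊕ R}
    (hP : PatOK sr tg)
    (hbal : ∀ S : Finset W, S.Nonempty → η ≤ (S.card : ℝ) - α * cnt sr tg S) (C : ℕ) :
    Tendsto (fun n : ℕ => Pr (EE n) ((n : ℝ) ^ (-α)) (fun S => ¬ EvExt sr tg C (gr S)))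
      atTop (nhds 0) := by
  classical
  set r := Fintype.card R with hr
  obtain ⟨M, hM⟩ := exists_nat_ge (((C : ℝ) + r + 1) / η)
  rw [div_le_iff₀ hη] at hM
  obtain ⟨K, n0, hK, hroom⟩ := exists_room (W := W) M (C + r)
  set c0 : ℝ := 2 ^ Fintype.card W * K ^ Fintype.card W with hc0
  have hc0p : 0 ≤ c0 := by positivity
  refine squeeze_zero' (g := fun n : ℕ => ((C + 1) * c0 ^ M) * (n : ℝ) ^ (-1 : ℝ)) ?_ ?_ ?_
  · filter_upwards [eventually_ge_atTop 1] with n hn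
    exact Pr_nonneg (prob_basic hn hα).1.le (prob_basic hn hα).2 _
  · filter_upwards [eventually_ge_atTop n0, eventually_ge_atTop 1] with n hn hn1
    obtain ⟨p0, p1⟩ := prob_basic hn1 hα
    have hn0 : (0 : ℝ) < n := by exact_mod_cast hn1
    have hn1' : (1 : ℝ) ≤ n := by exact_mod_cast hn1
    obtain ⟨N, hN, hB⟩ := hroom n hn
    set I : Finset (Finset (Fin n) × (R → Fin n)) :=
      ((Finset.univ : Finset (Finset (Fin n))).filter (fun vs => vs.card ≤ C)) ×ˢ
      ((Finset.univ : Finset (R → Fin n)).filter Function.Injective) with hI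
    have hone : ∀ x ∈ I, Pr (EE n) ((n : ℝ) ^ (-α)) (fun S => ¬ HasExt sr tg (gr S) x.1 x.2) ≤
        (c0 * (n : ℝ) ^ (-η)) ^ M := by
      intro x hx
      simp only [hI, Finset.mem_product, Finset.mem_filter, Finset.mem_univ, true_and] at hx
      obtain ⟨Ψ, hΨ, hBB⟩ := hB (x.1 ∪ Finset.univ.image x.2) (by
        refine (Finset.card_union_le _ _).trans ?_
        have : (Finset.univ.image x.2).card ≤ r := Finset.card_image_le
        omega)
      refine prob_parts hn1 hα hK hN hP hx.2 hΨ ?_ ?_ hbal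
      · intro i w h; exact hBB i w (Finset.mem_union_left _ h)
      · intro i w r' h
        exact hBB i w (Finset.mem_union_right _ (by rw [h]; simp))
    have hcard : (I.card : ℝ) ≤ (C + 1) * (n : ℝ) ^ ((C : ℝ) + r) := by
      rw [hI, Finset.card_product]
      push_cast
      have h1 : ((((Finset.univ : Finset (Finset (Fin n))).filter (fun vs => vs.card ≤ C)).card : ℕ) : ℝ)
          ≤ (C + 1) * (n : ℝ) ^ (C : ℝ) := by
        have h2 := sum_vs n C hn1
        have h3 : ∑ vs ∈ (Finset.univ : Finset (Finset (Fin n))).filter (fun vs => vs.card ≤ C),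
            (n : ℝ) ^ (-(C : ℝ)) ≤ C + 1 := by
          refine le_trans (Finset.sum_le_sum ?_) h2
          intro vs hvs
          simp only [Finset.mem_filter] at hvs
          apply Real.rpow_le_rpow_of_exponent_le hn1'
          have : (vs.card : ℝ) ≤ C := by exact_mod_cast hvs.2
          linarith
        rw [Finset.sum_const, nsmul_eq_mul, Real.rpow_neg hn0.le, ← div_eq_mul_inv,
          div_le_iff₀ (by positivity)] at h3
        exact h3
      have h4 : ((((Finset.univ : Finset (R → Fin n)).filter Function.Injective).card : ℕ) : ℝ) ≤
          (n : ℝ) ^ (r : ℝ) := by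
        have : ((Finset.univ : Finset (R → Fin n)).filter Function.Injective).card ≤ n ^ r := by
          refine (Finset.card_le_univ _).trans ?_
          simp [hr]
        rw [Real.rpow_natCast]
        exact_mod_cast this
      rw [Real.rpow_add hn0, ← mul_assoc]
      exact mul_le_mul h1 h4 (by positivity) (by positivity)
    calc _ ≤ Pr (EE n) ((n : ℝ) ^ (-α)) (fun S => ∃ x ∈ I, ¬ HasExt sr tg (gr S) x.1 x.2) := by
          apply Pr_mono p0.le p1
          intro S hS h
          unfold EvExt at h
          push Not at h
          obtain ⟨A, hA, ρ, hρ, h⟩ := h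
          exact ⟨(A, ρ), by simp [hI, hA, hρ], h⟩
      _ ≤ ∑ x ∈ I, _ := Pr_union p0.le p1 _ _
      _ ≤ ∑ x ∈ I, (c0 * (n : ℝ) ^ (-η)) ^ M := Finset.sum_le_sum hone
      _ = I.card * (c0 * (n : ℝ) ^ (-η)) ^ M := by rw [Finset.sum_const, nsmul_eq_mul]
      _ ≤ ((C + 1) * (n : ℝ) ^ ((C : ℝ) + r)) * (c0 * (n : ℝ) ^ (-η)) ^ M :=
          mul_le_mul_of_nonneg_right hcard (by positivity)
      _ = ((C + 1) * c0 ^ M) * (n : ℝ) ^ ((C : ℝ) + r + -(M * η)) := by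
          rw [mul_pow, ← Real.rpow_natCast ((n : ℝ) ^ (-η)), ← Real.rpow_mul hn0.le,
            Real.rpow_add hn0 ((C : ℝ) + r)]
          have : -η * (M : ℝ) = -(M * η) := by ring
          rw [this]; ring
      _ ≤ _ := by
          apply mul_le_mul_of_nonneg_left _ (by positivity)
          apply Real.rpow_le_rpow_of_exponent_le hn1'
          linarith
  · have := (tendsto_rpow_neg_nat one_pos).const_mul ((C + 1) * c0 ^ M)
    simpa using this

end ext
end RGS

namespace RGS

lemma path_count (P : ℕ → Prop) [DecidablePred P] (d m : ℕ) (hm : m ≤ d) (hP : ¬ P m) :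
    ((Finset.range d).filter fun i => P i ∧ P (i + 1)).card ≤
      ((Finset.Ioo 0 d).filter P).card := by
  apply Finset.card_le_card_of_injOn (fun i => if i < m then i + 1 else i)
  · intro i hi
    simp only [Finset.coe_filter, Finset.mem_range, Set.mem_ofPred_eq] at hi
    simp only [Finset.coe_filter, Finset.mem_Ioo, Set.mem_ofPred_eq]
    have h1 : i ≠ m := fun h => hP (h ▸ hi.2.1)
    have h2 : i + 1 ≠ m := fun h => hP (h ▸ hi.2.2)
    split_ifs with h
    · exact ⟨by omega, hi.2.2⟩
    · exact ⟨by omega, hi.2.1⟩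
  · intro i hi j hj hij
    simp only [Finset.coe_filter, Finset.mem_range, Set.mem_ofPred_eq] at hi hj
    have h1 : i ≠ m := fun h => hP (h ▸ hi.2.1)
    have h2 : i + 1 ≠ m := fun h => hP (h ▸ hi.2.2)
    have h3 : j ≠ m := fun h => hP (h ▸ hj.2.1)
    have h4 : j + 1 ≠ m := fun h => hP (h ▸ hj.2.2)
    dsimp only at hij
    split_ifs at hij <;> omega

section sys
set_option linter.unusedSectionVars false
variable {K Q R : Type} {d : ℕ}

def pos (src tgt : Q → (K ⊕ Q × Fin (d - 1)) ⊕ R) (q : Q) (j : ℕ) : (K ⊕ Q × Fin (d - 1)) ⊕ R :=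
  if j = 0 then src q else if h : j - 1 < d - 1 then Sum.inl (Sum.inr (q, ⟨j - 1, h⟩)) else tgt q

def psr (src tgt : Q → (K ⊕ Q × Fin (d - 1)) ⊕ R) (e : Q × Fin d) : (K ⊕ Q × Fin (d - 1)) ⊕ R :=
  pos src tgt e.1 e.2
def ptg (src tgt : Q → (K ⊕ Q × Fin (d - 1)) ⊕ R) (e : Q × Fin d) : (K ⊕ Q × Fin (d - 1)) ⊕ R :=
  pos src tgt e.1 (e.2 + 1)

variable {src tgt : Q → (K ⊕ Q × Fin (d - 1)) ⊕ R}

lemma pos_zero (q : Q) : pos src tgt q 0 = src q := by simp [pos]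
lemma pos_d (hd : 1 ≤ d) (q : Q) : pos src tgt q d = tgt q := by
  unfold pos
  rw [if_neg (by omega), dif_neg (by omega)]
lemma pos_mid (q : Q) (j : ℕ) (h0 : 0 < j) (h1 : j < d) :
    pos src tgt q j = Sum.inl (Sum.inr (q, ⟨j - 1, by omega⟩)) := by
  unfold pos
  rw [if_neg (by omega), dif_pos (by omega)]

/-- owner path of an interior vertex -/
def own : (K ⊕ Q × Fin (d - 1)) ⊕ R → Option (Q × ℕ)
  | Sum.inl (Sum.inr x) => some (x.1, x.2.val + 1)
  | _ => none

lemma own_mid (q : Q) (j : ℕ) (h0 : 0 < j) (h1 : j < d) :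
    own (pos src tgt q j) = some (q, j) := by
  rw [pos_mid q j h0 h1]
  simp only [own, Option.some.injEq, Prod.mk.injEq, true_and]
  omega

structure Rk (src tgt : Q → (K ⊕ Q × Fin (d - 1)) ⊕ R) (rk : Q → ℕ) : Prop where
  s : ∀ q q' j, own (src q) = some (q', j) → rk q' < rk q
  t : ∀ q q' j, own (tgt q) = some (q', j) → rk q' < rk q

lemma pos_cases {rk : Q → ℕ} (h : Rk src tgt rk) (q q' : Q) (j i : ℕ) (h0 : 0 < j) (h1 : j < d)
    (hi : i ≤ d) (heq : pos src tgt q j = pos src tgt q' i) : (q = q' ∧ i = j) ∨ rk q < rk q' := by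
  have ho := own_mid (src := src) (tgt := tgt) q j h0 h1
  rw [heq] at ho
  by_cases hi0 : i = 0
  · subst hi0
    rw [pos_zero] at ho
    exact Or.inr (h.s _ _ _ ho)
  by_cases hid : i = d
  · subst hid
    rw [pos_d (by omega)] at ho
    exact Or.inr (h.t _ _ _ ho)
  · rw [own_mid q' i (by omega) (by omega)] at ho
    simp only [Option.some.injEq, Prod.mk.injEq] at ho
    exact Or.inl ⟨ho.1.symm, ho.2⟩

lemma patOK {rk : Q → ℕ} (h : Rk src tgt rk) (hd : 3 ≤ d) :
    PatOK (psr src tgt) (ptg src tgt) where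
  ne := by
    rintro ⟨q, i, hi⟩ he
    simp only [psr, ptg] at he
    by_cases h0 : i = 0
    · rcases pos_cases h q q (i + 1) i (by omega) (by omega) (by omega) he.symm with h1 | h1 <;> omega
    · rcases pos_cases h q q i (i + 1) (by omega) (by omega) (by omega) he with h1 | h1 <;> omega
  root := by
    rintro ⟨q, i, hi⟩
    simp only [psr, ptg]
    by_cases h0 : i = 0
    · right; rw [pos_mid q (i + 1) (by omega) (by omega)]; exact ⟨_, rfl⟩
    · left; rw [pos_mid q i (by omega) (by omega)]; exact ⟨_, rfl⟩
  inj := by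
    rintro ⟨q, i, hi⟩ ⟨q', i', hi'⟩ he
    simp only [psr, ptg] at he
    have hrk : ∀ (q q' : Q) (i i' : ℕ), i < d → i' < d →
        s(pos src tgt q i, pos src tgt q (i + 1)) = s(pos src tgt q' i', pos src tgt q' (i' + 1)) →
        q = q' ∨ rk q < rk q' := by
      intro q q' i i' hi hi' he
      rw [Sym2.eq_iff] at he
      by_cases h0 : i = 0
      · rcases he with ⟨_, b⟩ | ⟨_, b⟩
        · rcases pos_cases h q q' (i + 1) _ (by omega) (by omega) (by omega) b with h1 | h1
          · exact Or.inl h1.1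
          · exact Or.inr h1
        · rcases pos_cases h q q' (i + 1) _ (by omega) (by omega) (by omega) b with h1 | h1
          · exact Or.inl h1.1
          · exact Or.inr h1
      · rcases he with ⟨b, _⟩ | ⟨b, _⟩
        · rcases pos_cases h q q' i _ (by omega) (by omega) (by omega) b with h1 | h1
          · exact Or.inl h1.1
          · exact Or.inr h1
        · rcases pos_cases h q q' i _ (by omega) (by omega) (by omega) b with h1 | h1
          · exact Or.inl h1.1
          · exact Or.inr h1
    have hq : q = q' := by
      rcases hrk q q' i i' hi hi' he with h1 | h1
      · exact h1
      · rcases hrk q' q i' i hi' hi he.symm with h2 | h2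
        · exact h2.symm
        · omega
    subst hq
    have hpos : ∀ a b, a ≤ d → b ≤ d → pos src tgt q a = pos src tgt q b →
        a = b ∨ ((a = 0 ∨ a = d) ∧ (b = 0 ∨ b = d)) := by
      intro a b ha hb hab
      by_cases h1 : 0 < a ∧ a < d
      · rcases pos_cases h q q a b h1.1 h1.2 hb hab with h2 | h2 <;> omega
      · by_cases h2 : 0 < b ∧ b < d
        · rcases pos_cases h q q b a h2.1 h2.2 ha hab.symm with h2 | h2 <;> omega
        · omega
    rw [Sym2.eq_iff] at he
    have : i = i' := by
      rcases he with ⟨a, b⟩ | ⟨a, b⟩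
      · have h1 := hpos _ _ (by omega) (by omega) a
        have h2 := hpos _ _ (by omega) (by omega) b
        omega
      · have h1 := hpos _ _ (by omega) (by omega) a
        have h2 := hpos _ _ (by omega) (by omega) b
        omega
    subst this
    rfl

variable [Fintype K] [Fintype Q]

open Classical in
lemma bal_gen {α δ : ℝ} (hα0 : 0 ≤ α) (hα1 : α ≤ 1) (hδ : (d : ℝ) * (1 - α) = 1 - δ) (hd : 1 ≤ d)
    (hδ0 : 0 ≤ δ)
    (S : Finset (K ⊕ Q × Fin (d - 1))) :
    ∃ c : Q → ℝ, (∑ k : K, ind (Sum.inl k ∈ S)) + ∑ q, c q ≤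
      (S.card : ℝ) - α * cnt (psr src tgt) (ptg src tgt) S ∧
      ∀ q, -δ ≤ c q ∧ ∀ m, m ≤ d → ¬ inS S (pos src tgt q m) →
        0 ≤ c q ∧ ∀ i, 0 < i → i < d → inS S (pos src tgt q i) → 1 - α ≤ c q := by
  set P : Q → ℕ → Prop := fun q i => inS S (pos src tgt q i) with hP
  set ec : Q → ℕ := fun q => ((Finset.range d).filter fun i => P q i ∧ P q (i + 1)).card with hec
  set jc : Q → ℕ := fun q => ((Finset.Ioo 0 d).filter fun i => P q i).card with hjc
  have hcnt : cnt (psr src tgt) (ptg src tgt) S ≤ ∑ q, ec q := by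
    unfold cnt
    rw [Finset.card_filter, Fintype.sum_prod_type]
    apply Finset.sum_le_sum
    intro q _
    rw [hec, ← Finset.card_filter]
    apply Finset.card_le_card_of_injOn (fun i : Fin d => i.val)
    · intro i hi
      have hi2 := (Finset.mem_filter.1 (Finset.mem_coe.1 hi)).2
      simp only [Finset.coe_filter, Finset.mem_range, Set.mem_ofPred_eq]
      exact ⟨i.2, hi2⟩
    · intro i _ j _ h; exact Fin.ext h
  have hcard : (Finset.univ.filter fun k : K => Sum.inl k ∈ S).card + ∑ q, jc q ≤ S.card := by
    have h1 : S.card = ∑ w : K ⊕ Q × Fin (d - 1), if w ∈ S then 1 else 0 := by simp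
    rw [h1, Fintype.sum_sum_type, Fintype.sum_prod_type, Finset.card_filter]
    apply Nat.add_le_add_left
    apply Finset.sum_le_sum
    intro q _
    rw [hjc, ← Finset.card_filter]
    apply Finset.card_le_card_of_surjOn (fun i : Fin (d - 1) => i.val + 1)
    intro i hi
    simp only [Finset.coe_filter, Finset.mem_Ioo, Set.mem_ofPred_eq] at hi
    refine ⟨⟨i - 1, by omega⟩, ?_, by simp only; omega⟩
    simp only [Finset.coe_filter, Finset.mem_univ, true_and, Set.mem_ofPred_eq]
    have h2 := hi.2
    simp only [hP] at h2
    rw [pos_mid q i hi.1.1 hi.1.2] at h2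
    exact h2 _ rfl
  refine ⟨fun q => (jc q : ℝ) - α * ec q, ?_, ?_⟩
  · rw [Finset.sum_sub_distrib, ← Finset.mul_sum]
    have h1 : ((Finset.univ.filter fun k : K => Sum.inl k ∈ S).card : ℝ) + ∑ q, (jc q : ℝ) ≤ S.card := by
      exact_mod_cast hcard
    rw [Finset.card_filter] at h1
    push_cast at h1
    have h1b : ∑ k : K, ind (Sum.inl k ∈ S) = ∑ k : K, (if Sum.inl k ∈ S then (1:ℝ) else 0) :=
      Finset.sum_congr rfl fun k _ => by simp [ind]
    rw [h1b]
    have h2 : (cnt (psr src tgt) (ptg src tgt) S : ℝ) ≤ ∑ q, (ec q : ℝ) := by exact_mod_cast hcnt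
    nlinarith [mul_le_mul_of_nonneg_left h2 hα0]
  · intro q
    have hmiss : ∀ m, m ≤ d → ¬ inS S (pos src tgt q m) →
        (1 - α) * jc q ≤ (jc q : ℝ) - α * ec q := by
      intro m hm hn
      have := path_count (P q) d m hm hn
      have h3 : (ec q : ℝ) ≤ jc q := by exact_mod_cast this
      nlinarith [mul_le_mul_of_nonneg_left h3 hα0]
    have h1a : 0 ≤ 1 - α := by linarith
    constructor
    · by_cases hall : ∃ m, m ≤ d ∧ ¬ inS S (pos src tgt q m)
      · obtain ⟨m, hm, hn⟩ := hall
        have := hmiss m hm hn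
        have h3 : 0 ≤ (1 - α) * jc q := by positivity
        linarith
      · push Not at hall
        have h1 : ec q ≤ d := by
          rw [hec]; exact (Finset.card_filter_le _ _).trans (by simp)
        have h2 : jc q = d - 1 := by
          rw [hjc]
          have : ((Finset.Ioo 0 d).filter fun i => P q i) = Finset.Ioo 0 d := by
            apply Finset.filter_true_of_mem
            intro i hi
            exact hall i (Finset.mem_Ioo.1 hi).2.le
          simp [this]
        have h3 : (jc q : ℝ) = d - 1 := by
          rw [h2, Nat.cast_sub hd]; simp
        have h4 : (ec q : ℝ) ≤ d := by exact_mod_cast h1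
        simp only [h3]
        nlinarith [mul_le_mul_of_nonneg_left h4 hα0]
    · intro m hm hn
      have h2 := hmiss m hm hn
      have h3 : 0 ≤ (1 - α) * jc q := by positivity
      refine ⟨by linarith, ?_⟩
      intro i hi hid hS
      have : 1 ≤ jc q := Finset.card_pos.2 ⟨i, by simp [hP, hi, hid, hS]⟩
      have h4 : (1 : ℝ) ≤ jc q := by exact_mod_cast this
      nlinarith

end sys

/-! Star pattern -/
section star
variable {d t : ℕ}
def ssrc : Fin t → (Unit ⊕ Fin t × Fin (d - 1)) ⊕ Fin t := fun _ => Sum.inl (Sum.inl ())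
def stgt : Fin t → (Unit ⊕ Fin t × Fin (d - 1)) ⊕ Fin t := fun i => Sum.inr i

lemma star_rk : Rk (ssrc (d := d) (t := t)) stgt (fun _ => 0) where
  s := by intro q q' j h; simp [ssrc, own] at h
  t := by intro q q' j h; simp [stgt, own] at h

lemma star_bal {α δ : ℝ} (hα0 : 0 ≤ α) (hα1 : α ≤ 1) (hδ : (d : ℝ) * (1 - α) = 1 - δ) (hd : 1 ≤ d)
    (hδ0 : 0 ≤ δ) (hδt : (2 * t + 1) * δ = 2)
    (S : Finset (Unit ⊕ Fin t × Fin (d - 1))) (hS : S.Nonempty) :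
    min (1 - α) (δ / 2) ≤
      (S.card : ℝ) - α * cnt (psr (ssrc (d := d) (t := t)) stgt) (ptg ssrc stgt) S := by
  classical
  obtain ⟨c, hc, hq⟩ := bal_gen (src := ssrc (d := d) (t := t)) (tgt := stgt) hα0 hα1 hδ hd hδ0 S
  refine le_trans ?_ hc
  by_cases hz : Sum.inl () ∈ S
  · have h1 : ∑ k : Unit, ind ((Sum.inl k : Unit ⊕ Fin t × Fin (d - 1)) ∈ S) = 1 := by
      rw [Fintype.sum_unique]; exact ind_pos hz
    have h2 : ∑ q : Fin t, (-δ) ≤ ∑ q, c q := Finset.sum_le_sum fun q _ => (hq q).1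
    simp only [Finset.sum_const, Finset.card_univ, Fintype.card_fin, nsmul_eq_mul] at h2
    rw [h1]
    refine (min_le_right _ _).trans ?_
    push_cast
    linarith
  · have hmiss : ∀ q : Fin t, ¬ inS S (pos (ssrc (d := d) (t := t)) stgt q 0) := by
      intro q h
      exact hz (h _ (by simp [pos_zero, ssrc]))
    obtain ⟨w, hw⟩ := hS
    rcases w with u | ⟨q, i⟩
    · exact absurd hw hz
    · have h1 := ((hq q).2 0 (by omega) (hmiss q)).2 (i.val + 1) (by omega) (by omega) (by
        rw [pos_mid q _ (by omega) (by omega)]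
        intro w' hw'
        simp only [Sum.inl.injEq] at hw'
        subst hw'
        simpa using hw)
      have h2 : c q ≤ ∑ q, c q := Finset.single_le_sum
        (fun q _ => ((hq q).2 0 (by omega) (hmiss q)).1) (Finset.mem_univ q)
      refine (min_le_left _ _).trans ?_
      have h3 : (0 : ℝ) ≤ ∑ k : Unit, ind ((Sum.inl k : Unit ⊕ Fin t × Fin (d - 1)) ∈ S) :=
        Finset.sum_nonneg fun _ _ => ind_nonneg _
      linarith
end star

/-! Target graph -/
section tar
variable {h t : ℕ}
abbrev TQ (t : ℕ) := Option (Fin t) ⊕ Fin t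
abbrev TV (h t : ℕ) := (Bool ⊕ TQ t × Fin (2 * h - 1)) ⊕ Empty

def vx (h t : ℕ) : TV h t := Sum.inl (Sum.inl false)
def vy (h t : ℕ) : TV h t := Sum.inl (Sum.inl true)
def tmid (hh : 0 < h) (o : Option (Fin t)) : TV h t :=
  Sum.inl (Sum.inr (Sum.inl o, ⟨h - 1, by omega⟩))

def tsrc (hh : 0 < h) : TQ t → TV h t
  | Sum.inl _ => vx h t
  | Sum.inr i => tmid hh (some i)
def ttgt (hh : 0 < h) : TQ t → TV h t
  | Sum.inl _ => vy h t
  | Sum.inr _ => tmid hh none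

lemma tar_rk (hh : 0 < h) : Rk (tsrc (t := t) hh) (ttgt hh) (Sum.elim (fun _ => 0) (fun _ => 1)) where
  s := by
    rintro (o | i) q' j he
    · simp [tsrc, vx, own] at he
    · simp only [tsrc, tmid, own, Option.some.injEq, Prod.mk.injEq] at he
      rw [← he.1]; simp
  t := by
    rintro (o | i) q' j he
    · simp [ttgt, vy, own] at he
    · simp only [ttgt, tmid, own, Option.some.injEq, Prod.mk.injEq] at he
      rw [← he.1]; simp

lemma tar_pos_mid (hh : 0 < h) (o : Option (Fin t)) :
    pos (tsrc hh) (ttgt hh) (Sum.inl o) h = tmid hh o := by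
  rw [pos_mid _ _ hh (by omega)]; rfl

lemma tar_bal {α δ : ℝ} (hh : 0 < h) (hα0 : 0 ≤ α) (hα1 : α ≤ 1)
    (hδ : ((2 * h : ℕ) : ℝ) * (1 - α) = 1 - δ)
    (hδ0 : 0 ≤ δ) (hδt : (2 * t + 1) * δ = 2) (hδα : δ ≤ 1 - α)
    (S : Finset (Bool ⊕ TQ t × Fin (2 * h - 1))) :
    0 ≤ (S.card : ℝ) - α * cnt (psr (tsrc (t := t) hh) (ttgt hh)) (ptg (tsrc hh) (ttgt hh)) S := by
  classical
  obtain ⟨c, hc, hq⟩ := bal_gen (src := tsrc (t := t) hh) (tgt := ttgt hh) hα0 hα1 hδ (by omega) hδ0 S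
  refine le_trans ?_ hc
  rw [Fintype.sum_sum_type, Fintype.sum_option]
  rw [Fintype.sum_bool]
  have hth : ∀ o, -δ ≤ c (Sum.inl o) := fun o => (hq _).1
  have hli : ∀ i, -δ ≤ c (Sum.inr i) := fun o => (hq _).1
  have s1 : ∑ i : Fin t, (-δ) ≤ ∑ i, c (Sum.inr i) := Finset.sum_le_sum fun q _ => hli q
  have s2 : ∑ i : Fin t, (-δ) ≤ ∑ i, c (Sum.inl (some i)) := Finset.sum_le_sum fun q _ => hth _
  simp only [Finset.sum_const, Finset.card_univ, Fintype.card_fin, nsmul_eq_mul] at s1 s2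
  have hm : ((Sum.inl true : Bool ⊕ TQ t × Fin (2 * h - 1)) ∉ S ∨ (Sum.inl false : Bool ⊕ TQ t × Fin (2 * h - 1)) ∉ S) →
      ∀ o, ∃ m, m ≤ 2 * h ∧ ¬ inS S (pos (tsrc (t := t) hh) (ttgt hh) (Sum.inl o) m) := by
    rintro (h1 | h1) o
    · refine ⟨2 * h, le_rfl, ?_⟩
      rw [pos_d (by omega)]
      intro h2
      exact h1 (h2 _ rfl)
    · refine ⟨0, by omega, ?_⟩
      rw [pos_zero]
      intro h2
      exact h1 (h2 _ rfl)
  have hth0 : ((Sum.inl true : Bool ⊕ TQ t × Fin (2 * h - 1)) ∉ S ∨ (Sum.inl false : Bool ⊕ TQ t × Fin (2 * h - 1)) ∉ S) →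
      ∀ o, 0 ≤ c (Sum.inl o) := by
    intro h1 o
    obtain ⟨m, hm1, hm2⟩ := hm h1 o
    exact ((hq _).2 m hm1 hm2).1
  have hsum0 : ((Sum.inl true : Bool ⊕ TQ t × Fin (2 * h - 1)) ∉ S ∨ (Sum.inl false : Bool ⊕ TQ t × Fin (2 * h - 1)) ∉ S) →
      0 ≤ ∑ i, c (Sum.inl (some i)) + ∑ i, c (Sum.inr i) := by
    intro h1
    rw [← Finset.sum_add_distrib]
    apply Finset.sum_nonneg
    intro i _
    have h2 := hth0 h1 (some i)
    by_cases h3 : inS S (tmid (t := t) hh (some i))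
    · obtain ⟨m, hm1, hm2⟩ := hm h1 (some i)
      have := ((hq _).2 m hm1 hm2).2 h hh (by omega) (by rw [tar_pos_mid]; exact h3)
      linarith [hli i]
    · have := ((hq (Sum.inr i)).2 0 (by omega) (by rw [pos_zero]; exact h3)).1
      linarith
  by_cases h1 : (Sum.inl true : Bool ⊕ TQ t × Fin (2 * h - 1)) ∈ S
  · by_cases h2 : (Sum.inl false : Bool ⊕ TQ t × Fin (2 * h - 1)) ∈ S
    · rw [ind_pos h1, ind_pos h2]
      linarith [hth none]
    · rw [ind_pos h1, ind_neg h2]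
      have := hsum0 (Or.inr h2)
      have := hth0 (Or.inr h2) none
      linarith
  · have := hsum0 (Or.inl h1)
    have := hth0 (Or.inl h1) none
    have h5 := ind_nonneg ((Sum.inl false : Bool ⊕ TQ t × Fin (2 * h - 1)) ∈ S)
    rw [ind_neg h1]
    linarith
end tar
end RGS

namespace RGS

section walks
variable {V : Type} {Γ : SimpleGraph V}

/-- there is a walk of length at most `r` -/
def Dl (Γ : SimpleGraph V) (r : ℕ) (a b : V) : Prop := ∃ p : Γ.Walk a b, p.length ≤ r

lemma Dl.symm {r : ℕ} {a b : V} (h : Dl Γ r a b) : Dl Γ r b a := by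
  obtain ⟨p, hp⟩ := h
  exact ⟨p.reverse, by simpa using hp⟩
lemma Dl.trans {r s : ℕ} {a b c : V} (h : Dl Γ r a b) (h' : Dl Γ s b c) : Dl Γ (r + s) a c := by
  obtain ⟨p, hp⟩ := h
  obtain ⟨q, hq⟩ := h'
  exact ⟨p.append q, by rw [SimpleGraph.Walk.length_append]; omega⟩
lemma Dl.mono {r s : ℕ} {a b : V} (h : Dl Γ r a b) (hrs : r ≤ s) : Dl Γ s a b := by
  obtain ⟨p, hp⟩ := h
  exact ⟨p, hp.trans hrs⟩
lemma Dl.refl {r : ℕ} (a : V) : Dl Γ r a a := ⟨.nil, by simp⟩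

lemma Dl.path {r : ℕ} {a b : V} (h : Dl Γ r a b) : ∃ p : Γ.Walk a b, p.IsPath ∧ p.length ≤ r := by
  classical
  obtain ⟨p, hp⟩ := h
  exact ⟨p.bypass, p.bypass_isPath, (p.length_bypass_le_length).trans hp⟩

lemma stay (es : Finset (Sym2 V)) (N : Set V) {a b : V} (p : Γ.Walk a b)
    (hp : ∀ e ∈ p.edges, e ∈ es) (ha : a ∈ N)
    (hN : ∀ v w, v ∈ N → w ∈ p.support → s(v, w) ∈ es → w ∈ N) : b ∈ N := by
  induction p with
  | nil => exact ha
  | cons h q ih =>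
    apply ih
    · intro e he; exact hp e (by simp [he])
    · exact hN _ _ ha (by simp) (hp _ (by simp))
    · intro v w hv hw; exact hN v w hv (by simp [hw])

lemma path_edge_ends {a b : V} (p : Γ.Walk a b) (hp : p.IsPath) (h : s(a, b) ∈ p.edges) :
    p.length = 1 := by
  cases p with
  | nil => simp at h
  | cons hadj q =>
    rw [SimpleGraph.Walk.cons_isPath_iff] at hp
    simp only [SimpleGraph.Walk.edges_cons, List.mem_cons] at h
    rcases h with h | h
    · have hb : b = _ := Sym2.congr_right.1 h
      subst hb
      have := SimpleGraph.Walk.isPath_iff_eq_nil.1 hp.1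
      subst this
      simp
    · exact absurd (q.fst_mem_support_of_mem_edges h) hp.2

lemma path_ne {a b : V} (p : Γ.Walk a b) (hp : p.IsPath) (h : 0 < p.length) : a ≠ b := by
  rintro rfl
  have := SimpleGraph.Walk.isPath_iff_eq_nil.1 hp
  subst this
  simp at h

variable [DecidableEq V]

lemma exc_base {a b : V} (p : Γ.Walk a b) (hp : p.IsPath) {vs : Finset V} {es : Finset (Sym2 V)}
    (hs : Sub Γ vs es) (ha : a ∈ vs) (hb : b ∈ vs) (hne : ∃ e ∈ p.edges, e ∉ es)
    (hinn : ∀ v ∈ p.support, v ∈ vs → v = a ∨ v = b) :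
    Sub Γ (vs ∪ p.support.toFinset) (es ∪ p.edges.toFinset) ∧ 1 ≤ p.length ∧
    (vs ∪ p.support.toFinset).card = vs.card + (p.length - 1) ∧
    (es ∪ p.edges.toFinset).card = es.card + p.length := by
  have hlen : 1 ≤ p.length := by
    obtain ⟨e, he, _⟩ := hne
    rw [← p.length_edges]
    exact List.length_pos_of_mem he
  have hab := path_ne p hp hlen
  refine ⟨?_, hlen, ?_, ?_⟩
  · intro e he
    rcases Finset.mem_union.1 he with he | he
    · exact ⟨(hs e he).1, fun v hv => Finset.mem_union_left _ ((hs e he).2 v hv)⟩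
    · have he := List.mem_toFinset.1 he
      refine ⟨p.edges_subset_edgeSet he, fun v hv => Finset.mem_union_right _ ?_⟩
      exact List.mem_toFinset.2 (SimpleGraph.Walk.mem_support_of_mem_edges he hv)
  · have h1 : (p.support.toFinset \ vs) = (p.support.toFinset.erase a).erase b := by
      ext v
      simp only [Finset.mem_sdiff, List.mem_toFinset, Finset.mem_erase]
      constructor
      · rintro ⟨h1, h2⟩
        exact ⟨fun h => h2 (h ▸ hb), fun h => h2 (h ▸ ha), h1⟩
      · rintro ⟨h1, h2, h3⟩
        refine ⟨h3, fun h => ?_⟩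
        rcases hinn v h3 h with h | h
        · exact h2 h
        · exact h1 h
    rw [Finset.union_comm, ← Finset.sdiff_union_self_eq_union, Finset.card_union_of_disjoint
      Finset.sdiff_disjoint, h1, Finset.card_erase_of_mem, Finset.card_erase_of_mem,
      List.toFinset_card_of_nodup hp.support_nodup, p.length_support]
    · omega
    · simp
    · simp [hab.symm]
  · rw [Finset.card_union_of_disjoint, List.toFinset_card_of_nodup hp.isTrail.edges_nodup,
      p.length_edges]
    rw [Finset.disjoint_left]
    intro e he hep
    have hep := List.mem_toFinset.1 hep
    have hE : e = s(a, b) := by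
      have h1 := (hs e he).2
      have h2 := (hs e he).1
      induction e using Sym2.ind with
      | _ v w =>
        have hv := hinn v (SimpleGraph.Walk.mem_support_of_mem_edges hep (by simp)) (h1 v (by simp))
        have hw := hinn w (SimpleGraph.Walk.mem_support_of_mem_edges hep (by simp)) (h1 w (by simp))
        have hvw : v ≠ w := Γ.ne_of_adj h2
        rcases hv with rfl | rfl <;> rcases hw with rfl | rfl
        · exact absurd rfl hvw
        · rfl
        · exact Sym2.eq_swap
        · exact absurd rfl hvw
    have h1 := path_edge_ends p hp (hE ▸ hep)
    obtain ⟨e', he', hn'⟩ := hne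
    have h2 : p.edges.length = 1 := by rw [p.length_edges, h1]
    obtain ⟨e0, h0⟩ := List.length_eq_one_iff.1 h2
    rw [h0] at hep he'
    simp only [List.mem_singleton] at hep he'
    exact hn' (he'.trans hep.symm ▸ he)

lemma excursion (n : ℕ) : ∀ {a b : V} (p : Γ.Walk a b), p.length ≤ n → p.IsPath →
    ∀ {vs : Finset V} {es : Finset (Sym2 V)},
    Sub Γ vs es → a ∈ vs → b ∈ vs → (∃ e ∈ p.edges, e ∉ es) →
    ∃ vs' es' j, vs ⊆ vs' ∧ es' ⊆ es ∪ p.edges.toFinset ∧ Sub Γ vs' es' ∧ vs'.card = vs.card + j ∧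
      es'.card = es.card + (j + 1) ∧ j + 1 ≤ p.length ∧
      (j + 1 = p.length → vs' = vs ∪ p.support.toFinset ∧ es' = es ∪ p.edges.toFinset ∧
        ∀ v ∈ p.support, v ∈ vs → v = a ∨ v = b) := by
  induction n with
  | zero =>
    intro a b p hn hp vs es hs ha hb ⟨e, he, _⟩
    have := List.length_pos_of_mem he
    rw [p.length_edges] at this
    omega
  | succ n ih =>
    intro a b p hn hp vs es hs ha hb hne
    by_cases hinn : ∀ v ∈ p.support, v ∈ vs → v = a ∨ v = b
    · obtain ⟨h1, h2, h3, h4⟩ := exc_base p hp hs ha hb hne hinn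
      exact ⟨_, _, p.length - 1, Finset.subset_union_left, Finset.Subset.refl _, h1, h3,
        by omega, by omega, fun _ => ⟨rfl, rfl, hinn⟩⟩
    · push Not at hinn
      obtain ⟨v, hv, hvs, hva, hvb⟩ := hinn
      have hsp := p.take_spec hv
      have hl : (p.takeUntil v hv).length + (p.dropUntil v hv).length = p.length := by
        conv_rhs => rw [← hsp]
        rw [SimpleGraph.Walk.length_append]
      have l1 : 0 < (p.takeUntil v hv).length := by
        by_contra h
        exact hva (SimpleGraph.Walk.eq_of_length_eq_zero (p := p.takeUntil v hv) (by omega)).symm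
      have l2 : 0 < (p.dropUntil v hv).length := by
        by_contra h
        exact hvb (SimpleGraph.Walk.eq_of_length_eq_zero (p := p.dropUntil v hv) (by omega))
      obtain ⟨e, he, hees⟩ := hne
      rw [← hsp, SimpleGraph.Walk.edges_append, List.mem_append] at he
      rcases he with he | he
      · obtain ⟨vs', es', j, c1, c2, c3, c4, c5, c6, -⟩ :=
          ih (p.takeUntil v hv) (by omega) (hp.takeUntil hv) hs ha hvs ⟨e, he, hees⟩
        have c2 := c2.trans (Finset.union_subset_union_right fun e he => List.mem_toFinset.2
          (p.edges_takeUntil_subset_edges hv (List.mem_toFinset.1 he)))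
        exact ⟨vs', es', j, c1, c2, c3, c4, c5, by omega, fun h => by omega⟩
      · obtain ⟨vs', es', j, c1, c2, c3, c4, c5, c6, -⟩ :=
          ih (p.dropUntil v hv) (by omega) (hp.dropUntil hv) hs hvs hb ⟨e, he, hees⟩
        have c2 := c2.trans (Finset.union_subset_union_right fun e he => List.mem_toFinset.2
          (p.edges_dropUntil_subset_edges hv (List.mem_toFinset.1 he)))
        exact ⟨vs', es', j, c1, c2, c3, c4, c5, by omega, fun h => by omega⟩

end walks

structure Par (h t : ℕ) (α δ : ℝ) : Prop where
  hh : 4 ≤ h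
  hδ : 0 < δ
  ht : (2 * t + 1) * δ = 2
  hα : (2 * h : ℝ) * (1 - α) = 1 - δ
  sm : 28 * (h : ℝ) ^ 2 * δ ≤ 1

namespace Par
variable {h t : ℕ} {α δ : ℝ}
lemma h4 (P : Par h t α δ) : (4 : ℝ) ≤ h := by exact_mod_cast P.hh
lemma big (P : Par h t α δ) : 12 * h * δ ≤ 1 - α := by
  have h1 := P.h4; have h2 := P.hδ; have h3 := P.hα; have h4 := P.sm
  have : 12 * h * δ * (2 * h) ≤ (1 - α) * (2 * h) := by nlinarith
  exact le_of_mul_le_mul_right this (by linarith)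
lemma one_sub_pos (P : Par h t α δ) : 0 < 1 - α := by
  have h1 := P.h4; have h2 := P.hδ; have h3 := P.big
  nlinarith [mul_pos (show (0:ℝ) < h by linarith) h2]
lemma alpha_pos (P : Par h t α δ) : 0 < α := by
  have h1 := P.h4; have h2 := P.hδ; have h3 := P.hα
  nlinarith [P.one_sub_pos]
lemma step (P : Par h t α δ) {j : ℕ} (hj : j + 1 ≤ 2 * h) : (j : ℝ) - α * (j + 1) ≤ -δ := by
  have h3 := P.hα
  have h4 : ((j : ℝ) + 1) ≤ 2 * h := by exact_mod_cast hj
  nlinarith [mul_le_mul_of_nonneg_right h4 P.one_sub_pos.le]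
lemma step2 (P : Par h t α δ) {j : ℕ} (hj : j + 1 < 2 * h) :
    (j : ℝ) - α * (j + 1) ≤ -δ - 12 * h * δ := by
  have h3 := P.hα
  have h4 : ((j : ℝ) + 1) + 1 ≤ 2 * h := by exact_mod_cast hj
  nlinarith [mul_le_mul_of_nonneg_right h4 P.one_sub_pos.le, P.big]
end Par
end RGS

namespace RGS
section B
variable {V : Type} {Γ : SimpleGraph V} {h : ℕ} {x y : V}

def InD (Γ : SimpleGraph V) (h : ℕ) (x y a : V) : Prop := Dl Γ h a x ∧ Dl Γ h a y

lemma split_at {a b v : V} (p : Γ.Walk a b) (hv : v ∈ p.support) :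
    ∃ r s, r + s = p.length ∧ Dl Γ r a v ∧ Dl Γ s v b ∧ (r = 0 → v = a) ∧ (s = 0 → v = b) ∧
      p.getVert r = v := by
  classical
  refine ⟨(p.takeUntil v hv).length, (p.dropUntil v hv).length, ?_, ⟨_, le_rfl⟩, ⟨_, le_rfl⟩, ?_, ?_, ?_⟩
  · conv_rhs => rw [← p.take_spec hv]
    rw [SimpleGraph.Walk.length_append]
  · intro h; exact (SimpleGraph.Walk.eq_of_length_eq_zero h).symm
  · intro h; exact (SimpleGraph.Walk.eq_of_length_eq_zero h)
  · exact p.getVert_length_takeUntil hv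

lemma InD.far1 (hh : 4 ≤ h) (hxy : ¬ Dl Γ (2 * h - 1) x y) {a : V} (ha : InD Γ h x y a) {r : ℕ}
    (hr : Dl Γ r a x) : h ≤ r := by
  by_contra hc
  exact hxy ((hr.symm.trans ha.2).mono (by omega))

lemma InD.far2 (hh : 4 ≤ h) (hxy : ¬ Dl Γ (2 * h - 1) x y) {a : V} (ha : InD Γ h x y a) {r : ℕ}
    (hr : Dl Γ r a y) : h ≤ r := by
  by_contra hc
  exact hxy ((ha.1.symm.trans hr).mono (by omega))

lemma InD.nex (hh : 4 ≤ h) (hxy : ¬ Dl Γ (2 * h - 1) x y) {a : V} (ha : InD Γ h x y a) : a ≠ x := by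
  rintro rfl
  have := ha.far1 hh hxy (Dl.refl (r := 0) a)
  omega
lemma InD.ney (hh : 4 ≤ h) (hxy : ¬ Dl Γ (2 * h - 1) x y) {a : V} (ha : InD Γ h x y a) : a ≠ y := by
  rintro rfl
  have := ha.far2 hh hxy (Dl.refl (r := 0) a)
  omega

lemma thru (hh : 4 ≤ h) (hxy : ¬ Dl Γ (2 * h - 1) x y) {a : V} (ha : InD Γ h x y a) :
    ∃ p : Γ.Walk x y, p.IsPath ∧ p.length = 2 * h ∧ a ∈ p.support ∧
      ∀ a' ∈ p.support, InD Γ h x y a' → a' = a := by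
  classical
  obtain ⟨wx, hwx⟩ := ha.1
  obtain ⟨wy, hwy⟩ := ha.2
  set p := wx.reverse.append wy with hp
  have hl : p.length ≤ 2 * h := by
    rw [hp, SimpleGraph.Walk.length_append, SimpleGraph.Walk.length_reverse]; omega
  have hb : ∀ q : Γ.Walk x y, 2 * h ≤ q.length := by
    intro q; by_contra hc
    exact hxy ⟨q, by omega⟩
  have hpl : p.length = 2 * h := le_antisymm hl (hb p)
  have hmem : a ∈ p.support := by
    rw [hp, SimpleGraph.Walk.mem_support_append_iff]; right; simp
  have key : ∀ a' ∈ p.support, InD Γ h x y a' → p.getVert h = a' := by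
    intro a' ha' hD
    obtain ⟨r, s, hrs, h1, h2, -, -, hg⟩ := split_at p ha'
    have h3 := hD.far1 hh hxy h1.symm
    have h4 := hD.far2 hh hxy h2
    have : r = h := by omega
    rw [← this]; exact hg
  refine ⟨p, ?_, hpl, hmem, fun a' h1 h2 => (key a' h1 h2).symm.trans (key a hmem ha)⟩
  have := p.bypass_eq_self_of_length_le_length_bypass (hl.trans (hb _))
  rw [← this]
  exact p.bypass_isPath

lemma linkwalk (hh : 4 ≤ h) (hxy : ¬ Dl Γ (2 * h - 1) x y) {a u c : V} (ha : InD Γ h x y a)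
    (hu : InD Γ h x y u) (hcx : c ≠ x) (hcy : c ≠ y) (h1 : Dl Γ h a c) (h2 : Dl Γ h c u) :
    ∃ q : Γ.Walk a u, q.IsPath ∧ q.length ≤ 2 * h ∧ x ∉ q.support ∧ y ∉ q.support := by
  classical
  obtain ⟨p, hp⟩ := h1
  obtain ⟨q, hq⟩ := h2
  refine ⟨(p.append q).bypass, SimpleGraph.Walk.bypass_isPath _, ?_, ?_, ?_⟩
  · refine (SimpleGraph.Walk.length_bypass_le_length _).trans ?_
    rw [SimpleGraph.Walk.length_append]; omega
  · intro hx
    have hx := SimpleGraph.Walk.support_bypass_subset_support _ hx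
    rw [SimpleGraph.Walk.mem_support_append_iff] at hx
    rcases hx with hx | hx
    · obtain ⟨r, s, hrs, h1, h2, _, hs, -⟩ := split_at p hx
      have := ha.far1 hh hxy h1
      exact hcx (hs (by omega)).symm
    · obtain ⟨r, s, hrs, h1, h2, hr, _, -⟩ := split_at q hx
      have := hu.far1 hh hxy h2.symm
      exact hcx (hr (by omega)).symm
  · intro hx
    have hx := SimpleGraph.Walk.support_bypass_subset_support _ hx
    rw [SimpleGraph.Walk.mem_support_append_iff] at hx
    rcases hx with hx | hx
    · obtain ⟨r, s, hrs, h1, h2, _, hs, -⟩ := split_at p hx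
      have := ha.far2 hh hxy h1
      exact hcy (hs (by omega)).symm
    · obtain ⟨r, s, hrs, h1, h2, hr, _, -⟩ := split_at q hx
      have := hu.far2 hh hxy h2.symm
      exact hcy (hr (by omega)).symm

variable [DecidableEq V] {t : ℕ} {α δ : ℝ}

/-- excursion in terms of `mu` -/
lemma exc_mu (P : Par h t α δ) {a b : V} (p : Γ.Walk a b) (hl : p.length ≤ 2 * h) (hp : p.IsPath)
    {vs : Finset V} {es : Finset (Sym2 V)} (hs : Sub Γ vs es) (ha : a ∈ vs) (hb : b ∈ vs)
    (hne : ¬ ∀ e ∈ p.edges, e ∈ es) :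
    ∃ vs' es', vs ⊆ vs' ∧ Sub Γ vs' es' ∧ vs'.card + 1 ≤ vs.card + p.length ∧
      mu α vs' es' ≤ mu α vs es - δ ∧
      (mu α vs' es' ≤ mu α vs es - δ - 12 * h * δ ∨ (p.length = 2 * h ∧
        vs' = vs ∪ p.support.toFinset ∧ es' = es ∪ p.edges.toFinset ∧
        ∀ v ∈ p.support, v ∈ vs → v = a ∨ v = b)) := by
  push Not at hne
  obtain ⟨vs', es', j, c1, c2, c3, c4, c5, c6, c7⟩ := excursion _ p le_rfl hp hs ha hb hne
  have hmu : mu α vs' es' = mu α vs es + ((j : ℝ) - α * (j + 1)) := by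
    unfold mu; rw [c4, c5]; push_cast; ring
  refine ⟨vs', es', c1, c3, by omega, ?_, ?_⟩
  · rw [hmu]; linarith [P.step (j := j) (by omega)]
  · by_cases hj : j + 1 < 2 * h
    · left; rw [hmu]; linarith [P.step2 hj]
    · right
      exact ⟨by omega, c7 (by omega)⟩

def Inv (Γ : SimpleGraph V) (h : ℕ) (α δ : ℝ) (x y u : V) (A : Finset V) (k : ℕ) : Prop :=
  ∃ vs es, Sub Γ vs es ∧ x ∈ vs ∧ y ∈ vs ∧ u ∈ vs ∧ mu α vs es ≤ 2 - δ - 2 * δ * k ∧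
    (A ∩ vs).card ≤ k + 1 ∧ vs.card ≤ 2 * h + 1 + 6 * h * k

lemma inv_big (P : Par h t α δ) {u : V} {A : Finset V} {k : ℕ} {vs vs' : Finset V}
    {es' : Finset (Sym2 V)} (hx : x ∈ vs) (hy : y ∈ vs) (hu : u ∈ vs)
    (hA : (A ∩ vs).card ≤ k + 1) (hc : vs.card ≤ 2 * h + 1 + 6 * h * k)
    (hs : Sub Γ vs' es') (hsub : vs ⊆ vs') (hc' : vs'.card ≤ vs.card + 6 * h)
    (hmu : mu α vs' es' ≤ 2 - δ - 2 * δ * k - 12 * h * δ) :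
    Inv Γ h α δ x y u A (k + 6 * h) := by
  refine ⟨vs', es', hs, hsub hx, hsub hy, hsub hu, ?_, ?_, ?_⟩
  · push_cast; linarith
  · have h1 : A ∩ vs' ⊆ (A ∩ vs) ∪ (vs' \ vs) := by
      intro v hv
      simp only [Finset.mem_inter, Finset.mem_union, Finset.mem_sdiff] at *
      tauto
    have h2 := (Finset.card_le_card h1).trans (Finset.card_union_le _ _)
    rw [Finset.card_sdiff_of_subset hsub] at h2
    omega
  · have : 6 * h * 1 ≤ 6 * h * (6 * h) := Nat.mul_le_mul_left _ (by have := P.hh; omega)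
    rw [mul_add]; omega

lemma inv_step (P : Par h t α δ) (hxy : ¬ Dl Γ (2 * h - 1) x y) {u : V} (hu : InD Γ h x y u)
    {A : Finset V} (hA : ∀ a ∈ A, InD Γ h x y a)
    (hlink : ∀ a ∈ A, a ≠ u → ∃ c, c ≠ x ∧ c ≠ y ∧ Dl Γ h a c ∧ Dl Γ h c u)
    {k : ℕ} (hk : k + 1 < A.card) (hI : Inv Γ h α δ x y u A k) :
    Inv Γ h α δ x y u A (k + 1) ∨ Inv Γ h α δ x y u A (k + 6 * h) := by
  have hh := P.hh
  obtain ⟨vs, es, hs, hxv, hyv, huv, hmu, hAv, hc⟩ := hI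
  obtain ⟨a, haA, hav⟩ : ∃ a ∈ A, a ∉ vs := by
    by_contra hcon
    push Not at hcon
    have : A ∩ vs = A := Finset.inter_eq_left.2 hcon
    rw [this] at hAv; omega
  have haD := hA a haA
  obtain ⟨p, hp, hpl, hap, hpD⟩ := thru hh hxy haD
  have hne1 : ¬ ∀ e ∈ p.edges, e ∈ es := by
    intro hall
    apply hav
    have := stay es (↑vs : Set V) (p.takeUntil a hap)
      (fun e he => hall e (p.edges_takeUntil_subset_edges hap he)) hxv
      (fun v w _ _ he => (hs _ he).2 w (by simp))
    exact this
  obtain ⟨vs1, es1, hsub1, hs1, hc1, hmu1, hor1⟩ := exc_mu P p hpl.le hp hs hxv hyv hne1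
  rcases hor1 with hbig | ⟨-, hvs1, hes1, hint1⟩
  · right
    exact inv_big P hxv hyv huv hAv hc hs1 hsub1 (by omega) (by linarith [P.hδ])
  have hua : a ≠ u := by rintro rfl; exact hav huv
  obtain ⟨c, hcx, hcy, hac, hcu⟩ := hlink a haA hua
  obtain ⟨q, hq, hql, hqx, hqy⟩ := linkwalk hh hxy haD hu hcx hcy hac hcu
  have hne2 : ¬ ∀ e ∈ q.edges, e ∈ es1 := by
    intro hall
    have := stay es1 {v | v ∈ p.support ∧ v ≠ x ∧ v ≠ y} q hall
      ⟨hap, haD.nex hh hxy, haD.ney hh hxy⟩ (by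
        rintro v w ⟨hv1, hv2, hv3⟩ hw he
        have hwx : w ≠ x := fun hw' => hqx (hw' ▸ hw)
        have hwy : w ≠ y := fun hw' => hqy (hw' ▸ hw)
        refine ⟨?_, hwx, hwy⟩
        rw [hes1, Finset.mem_union] at he
        rcases he with he | he
        · rcases hint1 v hv1 ((hs _ he).2 v (by simp)) with h1 | h1
          · exact absurd h1 hv2
          · exact absurd h1 hv3
        · exact p.snd_mem_support_of_mem_edges (List.mem_toFinset.1 he))
    obtain ⟨h1, h2, h3⟩ := this
    rcases hint1 u h1 huv with h4 | h4
    · exact h2 h4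
    · exact h3 h4
  have hav1 : a ∈ vs1 := by rw [hvs1]; simp [hap]
  obtain ⟨vs2, es2, hsub2, hs2, hc2, hmu2, hor2⟩ := exc_mu P q hql hq hs1 hav1 (hsub1 huv) hne2
  rcases hor2 with hbig | ⟨-, hvs2, hes2, hint2⟩
  · right
    exact inv_big P hxv hyv huv hAv hc hs2 (hsub1.trans hsub2) (by omega) (by linarith [P.hδ])
  by_cases h3 : ∃ a' ∈ A, a' ∈ q.support ∧ a' ∉ vs1
  · right
    obtain ⟨a', ha'A, ha'q, ha'1⟩ := h3
    have ha'D := hA a' ha'A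
    obtain ⟨w, hw, hwl⟩ := ha'D.1.path
    have hna : a' ≠ a := fun he => ha'1 (he ▸ hav1)
    have hnu : a' ≠ u := fun he => ha'1 (he ▸ hsub1 huv)
    have hav' : a ∉ w.support := by
      intro hm
      obtain ⟨r, s, hrs, h1, h2, hr, _⟩ := split_at w hm
      have := haD.far1 hh hxy h2
      exact hna (hr (by omega)).symm
    have huv' : u ∉ w.support := by
      intro hm
      obtain ⟨r, s, hrs, h1, h2, hr, _⟩ := split_at w hm
      have := hu.far1 hh hxy h2
      exact hnu (hr (by omega)).symm
    have hne3 : ¬ ∀ e ∈ w.edges, e ∈ es2 := by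
      intro hall
      have := stay es2 {v | v ∈ q.support ∧ v ≠ a ∧ v ≠ u} w hall
        ⟨ha'q, hna, hnu⟩ (by
          rintro v w' ⟨hv1, hv2, hv3⟩ hw he
          have hwx : w' ≠ a := fun hw' => hav' (hw' ▸ hw)
          have hwy : w' ≠ u := fun hw' => huv' (hw' ▸ hw)
          refine ⟨?_, hwx, hwy⟩
          rw [hes2, Finset.mem_union] at he
          rcases he with he | he
          · rcases hint2 v hv1 ((hs1 _ he).2 v (by simp)) with h1 | h1
            · exact absurd h1 hv2
            · exact absurd h1 hv3
          · exact q.snd_mem_support_of_mem_edges (List.mem_toFinset.1 he))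
      exact hqx this.1
    have ha'2 : a' ∈ vs2 := by rw [hvs2]; simp [ha'q]
    obtain ⟨vs3, es3, hsub3, hs3, hc3, hmu3, hor3⟩ := exc_mu P w (by omega) hw hs2 ha'2
      (hsub2 (hsub1 hxv)) hne3
    rcases hor3 with hbig | ⟨hlen, -⟩
    · exact inv_big P hxv hyv huv hAv hc hs3 ((hsub1.trans hsub2).trans hsub3) (by omega)
        (by linarith [P.hδ])
    · omega
  · left
    push Not at h3
    refine ⟨vs2, es2, hs2, hsub2 (hsub1 hxv), hsub2 (hsub1 hyv), hsub2 (hsub1 huv), ?_, ?_, ?_⟩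
    · push_cast; linarith
    · have h4 : A ∩ vs2 ⊆ insert a (A ∩ vs) := by
        intro v hv
        simp only [Finset.mem_inter, Finset.mem_insert] at hv ⊢
        have hv1 : v ∈ vs1 := by
          by_contra hn
          rw [hvs2, Finset.mem_union, List.mem_toFinset] at hv
          rcases hv.2 with h5 | h5
          · exact hn h5
          · exact hn (h3 v hv.1 h5)
        rw [hvs1, Finset.mem_union, List.mem_toFinset] at hv1
        rcases hv1 with h5 | h5
        · exact Or.inr ⟨hv.1, h5⟩
        · exact Or.inl (hpD v h5 (hA v hv.1))
      have := (Finset.card_le_card h4).trans (Finset.card_insert_le _ _)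
      omega
    · rw [mul_add]; omega

lemma inv_zero (P : Par h t α δ) (hxy : ¬ Dl Γ (2 * h - 1) x y) {u : V} (hu : InD Γ h x y u)
    {A : Finset V} (hA : ∀ a ∈ A, InD Γ h x y a) : Inv Γ h α δ x y u A 0 := by
  obtain ⟨p, hp, hpl, hap, hpD⟩ := thru P.hh hxy hu
  have c1 : p.support.toFinset.card = 2 * h + 1 := by
    rw [List.toFinset_card_of_nodup hp.support_nodup, p.length_support, hpl]
  have c2 : p.edges.toFinset.card = 2 * h := by
    rw [List.toFinset_card_of_nodup hp.isTrail.edges_nodup, p.length_edges, hpl]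
  refine ⟨p.support.toFinset, p.edges.toFinset, ?_, by simp, by simp, by simp [hap], ?_, ?_, ?_⟩
  · intro e he
    have he := List.mem_toFinset.1 he
    refine ⟨p.edges_subset_edgeSet he, fun v hv => ?_⟩
    exact List.mem_toFinset.2 (SimpleGraph.Walk.mem_support_of_mem_edges he hv)
  · unfold mu
    rw [c1, c2]; push_cast
    linarith [P.hα]
  · have : A ∩ p.support.toFinset ⊆ {u} := by
      intro v hv
      simp only [Finset.mem_inter, List.mem_toFinset] at hv
      exact Finset.mem_singleton.2 (hpD v hv.2 (hA v hv.1))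
    simpa using Finset.card_le_card this
  · omega

lemma D_card (P : Par h t α δ) {C : ℕ} (hN : EvN α C Γ) (hC : 2 * h + 1 + 6 * h * (t + 6 * h) ≤ C)
    (hxy : ¬ Dl Γ (2 * h - 1) x y) {u : V} (hu : InD Γ h x y u)
    {A : Finset V} (hA : ∀ a ∈ A, InD Γ h x y a)
    (hlink : ∀ a ∈ A, a ≠ u → ∃ c, c ≠ x ∧ c ≠ y ∧ Dl Γ h a c ∧ Dl Γ h c u) : A.card ≤ t := by
  by_contra hcon
  have hend : ∃ k, t ≤ k ∧ k ≤ t + 6 * h ∧ Inv Γ h α δ x y u A k := by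
    have : ∀ s, s ≤ t → ∃ k, s ≤ k ∧ k ≤ t + 6 * h ∧ Inv Γ h α δ x y u A k := by
      intro s
      induction s with
      | zero => intro _; exact ⟨0, le_rfl, by omega, inv_zero P hxy hu hA⟩
      | succ s ih =>
        intro hs
        obtain ⟨k, h1, h2, h3⟩ := ih (by omega)
        by_cases hk : s + 1 ≤ k
        · exact ⟨k, hk, h2, h3⟩
        · have := P.hh
          rcases inv_step P hxy hu hA hlink (k := k) (by omega) h3 with h4 | h4
          · exact ⟨_, by omega, by omega, h4⟩
          · exact ⟨_, by omega, by omega, h4⟩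
    exact this t le_rfl
  obtain ⟨k, h1, h2, vs, es, hs, hx, -, -, hmu, -, hc⟩ := hend
  have h3 := hN vs es hs (Finset.card_pos.2 ⟨x, hx⟩)
    (hc.trans (le_trans (Nat.add_le_add_left (Nat.mul_le_mul_left _ h2) _) hC))
  have h4 : (t : ℝ) ≤ k := by exact_mod_cast h1
  nlinarith [P.ht, mul_le_mul_of_nonneg_right h4 P.hδ.le]

end B
end RGS

namespace RGS

lemma pos_Dl {V K Q R : Type} {d : ℕ} {Γ : SimpleGraph V}
    {src tgt : Q → (K ⊕ Q × Fin (d - 1)) ⊕ R} {φ : (K ⊕ Q × Fin (d - 1)) ⊕ R → V}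
    (hφ : ∀ e, Γ.Adj (φ (psr src tgt e)) (φ (ptg src tgt e))) (q : Q) (i l : ℕ) (hil : i + l ≤ d) :
    Dl Γ l (φ (pos src tgt q i)) (φ (pos src tgt q (i + l))) := by
  induction l with
  | zero => exact Dl.refl _
  | succ l ih =>
    have h1 : Γ.Adj (φ (pos src tgt q (i + l))) (φ (pos src tgt q (i + (l + 1)))) :=
      hφ (q, ⟨i + l, by omega⟩)
    exact (ih (by omega)).trans (s := 1) ⟨h1.toWalk, by simp⟩

section star2
variable {V : Type} {Γ : SimpleGraph V} {h t : ℕ} {α δ : ℝ} {x y : V}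

def sdep {d t : ℕ} : (Unit ⊕ Fin t × Fin (d - 1)) ⊕ Fin t → ℕ
  | Sum.inl (Sum.inl _) => 0
  | Sum.inl (Sum.inr x) => x.2.val + 1
  | Sum.inr _ => d

lemma sdep_pos {d t : ℕ} (q : Fin t) (j : ℕ) (hj : j ≤ d) :
    sdep (pos (ssrc (d := d) (t := t)) stgt q j) = j := by
  by_cases h0 : j = 0
  · subst h0; simp [pos_zero, ssrc, sdep]
  by_cases h1 : j = d
  · subst h1; rw [pos_d (by omega)]; simp [stgt, sdep]
  · rw [pos_mid q j (by omega) (by omega)]; simp only [sdep]; omega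

variable [DecidableEq V]

lemma star_walk {d t : ℕ} {φ : (Unit ⊕ Fin t × Fin (d - 1)) ⊕ Fin t → V}
    (hinj : Function.Injective φ) {vs : Finset V} {es : Finset (Sym2 V)} (hs : Sub Γ vs es)
    (hA : ∀ w, φ (Sum.inl w) ∉ vs) {a b : V} (p : Γ.Walk a b)
    (hp : ∀ e ∈ p.edges, e ∈ es ∪ Finset.univ.image fun e => s(φ (psr ssrc stgt e), φ (ptg ssrc stgt e)))
    : ∀ c, a = φ c → sdep c + p.length < d → ∃ c', b = φ c' ∧ sdep c' < d := by
  induction p with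
  | nil => intro c hc hl; exact ⟨c, hc, by simpa using hl⟩
  | cons hadj q ih =>
    rename_i a v b
    intro c hc hl
    rw [SimpleGraph.Walk.length_cons] at hl
    have he := hp s(a, v) (by simp)
    have hv : ∃ c', v = φ c' ∧ sdep c' ≤ sdep c + 1 := by
      rcases Finset.mem_union.1 he with he | he
      · exfalso
        have h1 := (hs _ he).2 a (by simp)
        rcases c with w | r
        · exact hA w (hc ▸ h1)
        · simp only [sdep] at hl; omega
      · obtain ⟨⟨q', j⟩, -, hj⟩ := Finset.mem_image.1 he
        simp only [psr, ptg] at hj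
        rw [Sym2.eq_iff] at hj
        rcases hj with ⟨h1, h2⟩ | ⟨h1, h2⟩
        · refine ⟨_, h2.symm, ?_⟩
          have h3 := hinj (h1.trans hc)
          rw [← h3, sdep_pos _ _ (by omega), sdep_pos _ _ (by omega)]
        · refine ⟨_, h1.symm, ?_⟩
          have h3 := hinj (h2.trans hc)
          rw [← h3, sdep_pos _ _ (by omega), sdep_pos _ _ (by omega)]; omega
    obtain ⟨c', hc', hd⟩ := hv
    exact ih (fun e he => hp e (by simp [he])) c' hc' (by omega)

lemma star_round (P : Par h t α δ) {ρ : Fin t → V} {vs : Finset V} {es : Finset (Sym2 V)}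
    (hs : Sub Γ vs es) (hx : x ∈ vs) (hy : y ∈ vs) (hρ : ∀ i, ρ i ∈ vs)
    (hext : HasExt (psr (ssrc (d := 2 * h) (t := t)) stgt) (ptg ssrc stgt) Γ vs ρ)
    (hno : ¬ ∃ z, ¬ Dl Γ h z x ∧ ¬ Dl Γ h z y ∧ ∀ i, ∃ c, Dl Γ h z c ∧ Dl Γ h c (ρ i)) :
    ∃ vs' es', Sub Γ vs' es' ∧ vs ⊆ vs' ∧ vs'.card ≤ vs.card + (t + 2) * (2 * h) ∧
      mu α vs' es' ≤ mu α vs es - δ / 2 := by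
  obtain ⟨φ, hinj, hr, hA, hadj⟩ := hext
  have hh := P.hh
  have hP := patOK (star_rk (d := 2 * h) (t := t)) (by omega)
  set z := φ (Sum.inl (Sum.inl ())) with hz
  have hmid : ∀ i, ∃ c, Dl Γ h z c ∧ Dl Γ h c (ρ i) := by
    intro i
    refine ⟨φ (pos ssrc stgt i (0 + h)), ?_, ?_⟩
    · have := pos_Dl hadj i 0 h (by omega)
      simpa [pos_zero, ssrc, ← hz] using this
    · have := pos_Dl hadj i (0 + h) h (by omega)
      rw [show 0 + h + h = 2 * h by ring, pos_d (by omega)] at this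
      rw [← hr]; exact this
  have hb : ∃ b ∈ vs, Dl Γ h z b := by
    by_contra hcon
    push Not at hcon
    exact hno ⟨z, hcon x hx, hcon y hy, hmid⟩
  obtain ⟨b, hbv, hzb⟩ := hb
  obtain ⟨p, hp, hpl⟩ := hzb.path
  set vs1 := vs ∪ Finset.univ.image (fun w => φ (Sum.inl w)) with hvs1
  set es1 := es ∪ Finset.univ.image (fun e => s(φ (psr ssrc stgt e), φ (ptg ssrc stgt e))) with hes1
  have hφmem : ∀ c, φ c ∈ vs1 := by
    rintro (w | r)
    · exact Finset.mem_union_right _ (Finset.mem_image.2 ⟨w, Finset.mem_univ _, rfl⟩)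
    · rw [hr]; exact Finset.mem_union_left _ (hρ r)
  have hs1 : Sub Γ vs1 es1 := by
    intro e he
    rcases Finset.mem_union.1 he with he | he
    · exact ⟨(hs e he).1, fun v hv => Finset.mem_union_left _ ((hs e he).2 v hv)⟩
    · obtain ⟨e', -, rfl⟩ := Finset.mem_image.1 he
      refine ⟨hadj e', ?_⟩
      intro v hv
      rcases Sym2.mem_iff.1 hv with rfl | rfl <;> exact hφmem _
  have hc1 : vs1.card = vs.card + (1 + t * (2 * h - 1)) := by
    rw [hvs1, Finset.card_union_of_disjoint, Finset.card_image_of_injective]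
    · simp
    · exact hinj.comp Sum.inl_injective
    · rw [Finset.disjoint_left]
      intro v hv hv'
      obtain ⟨w, -, rfl⟩ := Finset.mem_image.1 hv'
      exact hA w hv
  have hc2 : es1.card = es.card + t * (2 * h) := by
    rw [hes1, Finset.card_union_of_disjoint]
    · have := Eim_card hP hinj
      unfold Eim at this
      congr 1
      refine Eq.trans ?_ (this.trans ?_)
      · congr!
      · simp
    · rw [Finset.disjoint_left]
      intro e he he'
      obtain ⟨e', -, rfl⟩ := Finset.mem_image.1 he'
      rcases hP.root e' with ⟨w, hw⟩ | ⟨w, hw⟩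
      · exact hA w ((hs _ he).2 _ (by rw [hw]; simp))
      · exact hA w ((hs _ he).2 _ (by rw [hw]; simp))
  have hmu1 : mu α vs1 es1 = mu α vs es + δ / 2 := by
    unfold mu
    rw [hc1, hc2]
    have h1 : ((2 * h - 1 : ℕ) : ℝ) = 2 * h - 1 := by
      rw [Nat.cast_sub (by omega)]; simp
    push_cast
    rw [h1]
    have h2 := P.hα
    have h3 := P.ht
    linear_combination (t : ℝ) * h2 - h3 / 2
  have hne : ¬ ∀ e ∈ p.edges, e ∈ es1 := by
    intro hall
    obtain ⟨c', hc', hd⟩ := star_walk hinj hs hA p hall _ hz (by simp only [sdep]; omega)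
    rcases c' with w | r
    · exact hA w (hc' ▸ hbv)
    · simp [sdep] at hd
  obtain ⟨vs2, es2, g1, g2, g3, g4, -⟩ := exc_mu P p (by omega) hp hs1 (hφmem _)
    (Finset.mem_union_left _ hbv) hne
  refine ⟨vs2, es2, g2, Finset.subset_union_left.trans g1, ?_, by linarith⟩
  have : t * (2 * h - 1) ≤ t * (2 * h) := Nat.mul_le_mul_left _ (by omega)
  rw [add_mul]; omega

lemma star_z (P : Par h t α δ) {C : ℕ} (hN : EvN α C Γ)
    (hE : EvExt (psr (ssrc (d := 2 * h) (t := t)) stgt) (ptg ssrc stgt) C Γ)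
    (hC : t + 2 + ((t + 2) * (2 * t + 1)) * ((t + 2) * (2 * h)) ≤ C)
    {ρ : Fin t → V} (hρ : Function.Injective ρ) :
    ∃ z, ¬ Dl Γ h z x ∧ ¬ Dl Γ h z y ∧ ∀ i, ∃ c, Dl Γ h z c ∧ Dl Γ h c (ρ i) := by
  by_contra hno
  have key : ∀ s, s ≤ (t + 2) * (2 * t + 1) → ∃ vs es, Sub Γ vs es ∧ x ∈ vs ∧ y ∈ vs ∧
      (∀ i, ρ i ∈ vs) ∧ vs.card ≤ t + 2 + s * ((t + 2) * (2 * h)) ∧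
      mu α vs es ≤ t + 2 - s * (δ / 2) := by
    intro s
    induction s with
    | zero =>
      intro _
      refine ⟨Finset.univ.image ρ ∪ {x, y}, ∅, ?_, by simp, by simp, by simp, ?_, ?_⟩
      · intro e he; simp at he
      · refine (Finset.card_union_le _ _).trans ?_
        have h1 := Finset.card_image_le (s := Finset.univ) (f := ρ)
        have h2 := Finset.card_le_two (a := x) (b := y)
        simp at h1
        omega
      · have h0 : (Finset.univ.image ρ ∪ {x, y}).card ≤ t + 2 := by
          refine (Finset.card_union_le _ _).trans ?_
          have h1 := Finset.card_image_le (s := Finset.univ) (f := ρ)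
          have h2 := Finset.card_le_two (a := x) (b := y)
          simp at h1
          omega
        have h1 : ((Finset.univ.image ρ ∪ {x, y}).card : ℝ) ≤ t + 2 := by exact_mod_cast h0
        unfold mu
        simpa using h1
    | succ s ih =>
      intro hs
      obtain ⟨vs, es, h1, h2, h3, h4, h5, h6⟩ := ih (by omega)
      have hcard : vs.card ≤ C := by
        refine h5.trans (le_trans ?_ hC)
        exact Nat.add_le_add_left (Nat.mul_le_mul_right _ (by omega)) _
      obtain ⟨vs', es', g1, g2, g3, g4⟩ := star_round P h1 h2 h3 h4 (hE vs hcard ρ hρ) hno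
      refine ⟨vs', es', g1, g2 h2, g2 h3, fun i => g2 (h4 i), ?_, ?_⟩
      · rw [add_mul, one_mul]; omega
      · push_cast; linarith
  obtain ⟨vs, es, h1, h2, -, -, h5, h6⟩ := key _ le_rfl
  have := hN vs es h1 (Finset.card_pos.2 ⟨x, h2⟩) (h5.trans hC)
  push_cast at h6
  have h7 : ((t : ℝ) + 2) * (2 * t + 1) * (δ / 2) = t + 2 := by
    linear_combination ((t : ℝ) + 2) / 2 * P.ht
  linarith

end star2

/-- the property expressed by the sentence -/
def Phi {V : Type} (h : ℕ) (Γ : SimpleGraph V) : Prop :=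
  ∃ x y, ¬ Dl Γ (2 * h - 1) x y ∧
    (∃ u, InD Γ h x y u ∧ ∀ a, InD Γ h x y a → a ≠ u → ∃ c, c ≠ x ∧ c ≠ y ∧ Dl Γ h a c ∧ Dl Γ h c u) ∧
    ¬ ∃ z, ¬ Dl Γ h z x ∧ ¬ Dl Γ h z y ∧ ∀ a, InD Γ h x y a → ∃ c, Dl Γ h z c ∧ Dl Γ h c a

lemma not_Phi {V : Type} [Fintype V] {Γ : SimpleGraph V} {h t : ℕ} {α δ : ℝ}
    (P : Par h t α δ) {C : ℕ} (hN : EvN α C Γ)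
    (hE : EvExt (psr (ssrc (d := 2 * h) (t := t)) stgt) (ptg ssrc stgt) C Γ)
    (hC1 : t + 2 + ((t + 2) * (2 * t + 1)) * ((t + 2) * (2 * h)) ≤ C)
    (hC2 : 2 * h + 1 + 6 * h * (t + 6 * h) ≤ C) (hV : t ≤ Fintype.card V) : ¬ Phi h Γ := by
  classical
  rintro ⟨x, y, hxy, ⟨u, hu, hall⟩, hz⟩
  apply hz
  have hA : ∀ a ∈ Finset.univ.filter (InD Γ h x y), InD Γ h x y a := by simp
  have hcard := D_card P hN hC2 hxy hu hA (fun a ha => hall a (hA a ha))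
  obtain ⟨T, hT, -, hTc⟩ := Finset.exists_subsuperset_card_eq
    (Finset.subset_univ (Finset.univ.filter (InD Γ h x y))) hcard (by simpa using hV)
  let ρ : Fin t → V := fun i => (T.equivFinOfCardEq hTc).symm i
  have hρ : Function.Injective ρ := Subtype.val_injective.comp (Equiv.injective _)
  obtain ⟨z, h1, h2, h3⟩ := star_z P hN hE hC1 (x := x) (y := y) hρ
  refine ⟨z, h1, h2, fun a ha => ?_⟩
  have haT : a ∈ T := hT (by simp [ha])
  have := h3 (T.equivFinOfCardEq hTc ⟨a, haT⟩)
  simpa [ρ] using this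
end RGS

namespace RGS

section multi
variable {V : Type} {Γ : SimpleGraph V} {h t : ℕ} {α δ : ℝ} [DecidableEq V]

lemma multi {ι : Type} [DecidableEq ι] (P : Par h t α δ) {vs : Finset V} {es : Finset (Sym2 V)}
    (hs : Sub Γ vs es) {z : V} (hz : z ∉ vs) (w : ι → V) (hw : ∀ i, w i ∈ vs)
    (r : ∀ i, Γ.Walk z (w i)) (hr : ∀ i, (r i).IsPath) (hrl : ∀ i, (r i).length ≤ 2 * h)
    (hrs : ∀ i, ∀ v ∈ (r i).support, v ∈ vs → v = w i) (I : Finset ι)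
    (hinj : ∀ i ∈ I, ∀ j ∈ I, w i = w j → i = j) :
    ∃ vs' es', Sub Γ vs' es' ∧ z ∈ vs' ∧ vs ⊆ vs' ∧ vs'.card ≤ vs.card + 1 + 2 * h * I.card ∧
      mu α vs' es' ≤ mu α vs es + 1 + ∑ i ∈ I, ((r i).length * (1 - α) - 1) ∧
      ∀ e ∈ es', ∀ v ∈ e, v ∈ vs → e ∈ es ∨ ∃ i ∈ I, v = w i := by
  induction I using Finset.induction_on with
  | empty =>
    refine ⟨insert z vs, es, ?_, by simp, Finset.subset_insert _ _, ?_, ?_, ?_⟩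
    · intro e he
      exact ⟨(hs e he).1, fun v hv => Finset.mem_insert_of_mem ((hs e he).2 v hv)⟩
    · simpa using Finset.card_insert_le z vs
    · unfold mu
      rw [Finset.card_insert_of_notMem hz]; push_cast; simp; linarith
    · intro e he v _ _; exact Or.inl he
  | insert i I hi ih =>
    obtain ⟨vs1, es1, h1, h2, h3, h4, h5, h6⟩ := ih (fun a ha b hb =>
      hinj a (Finset.mem_insert_of_mem ha) b (Finset.mem_insert_of_mem hb))
    have hne : ¬ ∀ e ∈ (r i).edges, e ∈ es1 := by
      intro hall
      have := stay es1 {v | v ∈ (r i).support ∧ v ≠ w i} (r i) hall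
        ⟨by simp, fun he => hz (he ▸ hw i)⟩ (by
          rintro v w' ⟨hv1, hv2⟩ hw' he
          refine ⟨hw', ?_⟩
          rintro rfl
          rcases h6 _ he (w i) (by simp) (hw i) with h7 | ⟨j, hj, h7⟩
          · exact hv2 (hrs i v hv1 ((hs _ h7).2 v (by simp)))
          · have := hinj i (Finset.mem_insert_self _ _) j (Finset.mem_insert_of_mem hj) h7
            exact hi (this ▸ hj))
      exact this.2 rfl
    push Not at hne
    obtain ⟨vs', es', j, c1, c2, c3, c4, c5, c6, -⟩ :=
      excursion _ (r i) le_rfl (hr i) h1 h2 (h3 (hw i)) hne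
    refine ⟨vs', es', c3, c1 h2, h3.trans c1, ?_, ?_, ?_⟩
    · rw [Finset.card_insert_of_notMem hi, mul_add]
      have := hrl i
      omega
    · have hmu : mu α vs' es' = mu α vs1 es1 + ((j : ℝ) - α * (j + 1)) := by
        unfold mu; rw [c4, c5]; push_cast; ring
      rw [Finset.sum_insert hi, hmu]
      have h7 : (j : ℝ) + 1 ≤ (r i).length := by exact_mod_cast c6
      nlinarith [mul_le_mul_of_nonneg_right h7 P.one_sub_pos.le]
    · intro e he v hv hvs
      rcases Finset.mem_union.1 (c2 he) with h7 | h7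
      · rcases h6 e h7 v hv hvs with h8 | ⟨k, hk, h8⟩
        · exact Or.inl h8
        · exact Or.inr ⟨k, Finset.mem_insert_of_mem hk, h8⟩
      · refine Or.inr ⟨i, Finset.mem_insert_self _ _, ?_⟩
        exact hrs i v (SimpleGraph.Walk.mem_support_of_mem_edges (List.mem_toFinset.1 h7) hv) hvs
end multi

section tarpot
variable {h t : ℕ}

def pot (fb : Bool → ℕ) (g : TQ t → ℕ → ℕ) : TV h t → ℕ
  | Sum.inl (Sum.inl b) => fb b
  | Sum.inl (Sum.inr x) => g x.1 (x.2.val + 1)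
  | Sum.inr e => e.elim

structure PotOK (h : ℕ) (fb : Bool → ℕ) (g : TQ t → ℕ → ℕ) : Prop where
  a : ∀ o, g (Sum.inl o) 0 = fb false
  b : ∀ o, g (Sum.inl o) (2 * h) = fb true
  c : ∀ i, g (Sum.inr i) 0 = g (Sum.inl (some i)) h
  d : ∀ i, g (Sum.inr i) (2 * h) = g (Sum.inl none) h
  l : ∀ q j, j < 2 * h → g q (j + 1) ≤ g q j + 1 ∧ g q j ≤ g q (j + 1) + 1

lemma pot_mid (hh : 0 < h) (fb : Bool → ℕ) (g : TQ t → ℕ → ℕ) (o : Option (Fin t)) :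
    pot fb g (tmid hh o) = g (Sum.inl o) h := by
  simp only [tmid, pot]; congr 1; omega

lemma pot_pos (hh : 0 < h) {fb : Bool → ℕ} {g : TQ t → ℕ → ℕ} (hg : PotOK h fb g) (q : TQ t) (j : ℕ)
    (hj : j ≤ 2 * h) : pot fb g (pos (tsrc hh) (ttgt hh) q j) = g q j := by
  by_cases h0 : j = 0
  · subst h0
    rw [pos_zero]
    rcases q with o | i
    · simp only [tsrc, vx, pot]; exact (hg.a o).symm
    · simp only [tsrc]; rw [pot_mid]; exact (hg.c i).symm
  by_cases h1 : j = 2 * h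
  · subst h1
    rw [pos_d (by omega)]
    rcases q with o | i
    · simp only [ttgt, vy, pot]; exact (hg.b o).symm
    · simp only [ttgt]; rw [pot_mid]; exact (hg.d i).symm
  · rw [pos_mid q j (by omega) (by omega)]
    simp only [pot]; congr 1; omega

def tcomp : TV h t → Option (Fin t)
  | Sum.inl (Sum.inr (Sum.inl o, _)) => o
  | Sum.inl (Sum.inr (Sum.inr i, _)) => some i
  | _ => none

/-- adjacency in the target pattern -/
def TA (hh : 0 < h) (c c' : TV h t) : Prop :=
  ∃ q j, j < 2 * h ∧ ((c = pos (tsrc hh) (ttgt hh) q j ∧ c' = pos (tsrc hh) (ttgt hh) q (j + 1)) ∨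
    (c' = pos (tsrc hh) (ttgt hh) q j ∧ c = pos (tsrc hh) (ttgt hh) q (j + 1)))

def tlab : TQ t → Option (Fin t)
  | Sum.inl o => o
  | Sum.inr i => some i

lemma tcomp_pos (hh : 0 < h) (q : TQ t) (j : ℕ) (hj : j ≤ 2 * h) :
    tcomp (pos (tsrc hh) (ttgt hh) q j) = tlab q ∨ 
      (tcomp (pos (tsrc hh) (ttgt hh) q j) = none ∧ (pos (tsrc hh) (ttgt hh) q j = vx h t ∨
        pos (tsrc hh) (ttgt hh) q j = vy h t ∨ pos (tsrc hh) (ttgt hh) q j = tmid hh none)) := by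
  by_cases h0 : j = 0
  · subst h0
    rw [pos_zero]
    rcases q with o | i
    · right; simp [tsrc, vx, tcomp]
    · left; simp [tsrc, tmid, tcomp, tlab]
  by_cases h1 : j = 2 * h
  · subst h1
    rw [pos_d (by omega)]
    rcases q with o | i
    · right; simp [ttgt, vy, tcomp]
    · right; simp [ttgt, tmid, tcomp]
  · rw [pos_mid q j (by omega) (by omega)]
    left
    rcases q with o | i <;> simp [tcomp, tlab]

lemma TA_comp (hh : 0 < h) {c c' : TV h t} (hTA : TA hh c c') {i : Fin t} (hc : tcomp c = some i)
    (h1 : c' ≠ vx h t) (h2 : c' ≠ vy h t) (h3 : c' ≠ tmid hh none) : tcomp c' = some i := by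
  have key : ∀ q j j', j ≤ 2 * h → j' ≤ 2 * h → c = pos (tsrc hh) (ttgt hh) q j →
      c' = pos (tsrc hh) (ttgt hh) q j' → tcomp c' = some i := by
    intro q j j' hj hj' hq hq'
    have e1 := tcomp_pos hh q j hj
    have e2 := tcomp_pos hh q j' hj'
    rw [← hq] at e1
    rw [← hq'] at e2
    rcases e2 with e2 | e2
    · rcases e1 with e1 | e1
      · rw [e2, ← e1, hc]
      · rw [e1.1] at hc; simp at hc
    · rcases e2.2 with e | e | e
      · exact absurd e h1
      · exact absurd e h2
      · exact absurd e h3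
  obtain ⟨q, j, hj, ⟨e1, e2⟩ | ⟨e1, e2⟩⟩ := hTA
  · exact key q j (j + 1) (by omega) (by omega) e1 e2
  · exact key q (j + 1) j (by omega) (by omega) e2 e1

lemma TA_pot (hh : 0 < h) {fb : Bool → ℕ} {g : TQ t → ℕ → ℕ} (hg : PotOK h fb g) {c c' : TV h t}
    (hTA : TA hh c c') : pot fb g c' ≤ pot fb g c + 1 := by
  obtain ⟨q, j, hj, ⟨rfl, rfl⟩ | ⟨rfl, rfl⟩⟩ := hTA
  · rw [pot_pos hh hg q j (by omega), pot_pos hh hg q (j + 1) (by omega)]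
    exact (hg.l q j hj).1
  · rw [pot_pos hh hg q j (by omega), pot_pos hh hg q (j + 1) (by omega)]
    exact (hg.l q j hj).2

def gx (h : ℕ) : TQ t → ℕ → ℕ
  | Sum.inl _, j => j
  | Sum.inr _, j => h + min j (2 * h - j)
def gy (h : ℕ) : TQ t → ℕ → ℕ
  | Sum.inl _, j => 2 * h - j
  | Sum.inr _, j => h + min j (2 * h - j)
def gu (h : ℕ) : TQ t → ℕ → ℕ
  | Sum.inl none, j => (h - j) + (j - h)
  | Sum.inl (some _), j => h + min j (2 * h - j)
  | Sum.inr _, j => 2 * h - j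

lemma potx (h : ℕ) : PotOK (t := t) h (fun b => if b then 2 * h else 0) (gx h) where
  a o := by simp [gx]
  b o := by simp [gx]
  c i := by simp [gx]
  d i := by simp [gx]
  l q j hj := by rcases q with o | i <;> simp only [gx] <;> omega
lemma poty (h : ℕ) : PotOK (t := t) h (fun b => if b then 0 else 2 * h) (gy h) where
  a o := by simp [gy]
  b o := by simp [gy]
  c i := by simp only [gy]; omega
  d i := by simp only [gy]; omega
  l q j hj := by rcases q with o | i <;> simp only [gy] <;> omega
lemma potu (h : ℕ) : PotOK (t := t) h (fun _ => h) (gu h) where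
  a o := by rcases o with _ | i <;> simp [gu]
  b o := by rcases o with _ | i <;> simp only [gu] <;> omega
  c i := by simp only [gu]; omega
  d i := by simp only [gu]; omega
  l q j hj := by rcases q with (_ | o) | i <;> simp only [gu] <;> omega
end tarpot

section tarA
variable {V : Type} {Γ : SimpleGraph V} {h t : ℕ} {α δ : ℝ} [DecidableEq V]

/-- image of the target -/
def tvs (φ : TV h t → V) : Finset V := Finset.univ.image φ
def tes (hh : 0 < h) (φ : TV h t → V) : Finset (Sym2 V) :=
  Finset.univ.image fun e => s(φ (psr (tsrc hh) (ttgt hh) e), φ (ptg (tsrc hh) (ttgt hh) e))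

lemma mem_tvs (φ : TV h t → V) (c : TV h t) : φ c ∈ tvs φ :=
  Finset.mem_image.2 ⟨c, Finset.mem_univ _, rfl⟩

lemma tes_TA (hh : 0 < h) {φ : TV h t → V} (hinj : Function.Injective φ) {c : TV h t} {w : V}
    (he : s(φ c, w) ∈ tes hh φ) : ∃ c', w = φ c' ∧ TA hh c c' := by
  obtain ⟨⟨q, j⟩, -, hj⟩ := Finset.mem_image.1 he
  simp only [psr, ptg] at hj
  rw [Sym2.eq_iff] at hj
  rcases hj with ⟨h1, h2⟩ | ⟨h1, h2⟩
  · exact ⟨_, h2.symm, q, j, j.2, Or.inl ⟨(hinj h1).symm, rfl⟩⟩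
  · exact ⟨_, h1.symm, q, j, j.2, Or.inr ⟨rfl, (hinj h2).symm⟩⟩

lemma walk_pot (hh : 0 < h) {φ : TV h t → V} (hinj : Function.Injective φ)
    {fb : Bool → ℕ} {g : TQ t → ℕ → ℕ} (hg : PotOK h fb g) {a b : V} (p : Γ.Walk a b)
    (hp : ∀ e ∈ p.edges, e ∈ tes hh φ) : ∀ c, a = φ c →
    ∃ c', b = φ c' ∧ pot fb g c' ≤ pot fb g c + p.length := by
  induction p with
  | nil => intro c hc; exact ⟨c, hc, by simp⟩
  | cons hadj q ih =>
    rename_i a v b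
    intro c hc
    have he := hp s(a, v) (by simp)
    rw [hc] at he
    obtain ⟨c', hc', hTA⟩ := tes_TA hh hinj he
    obtain ⟨c2, hc2, h2⟩ := ih (fun e he => hp e (by simp [he])) c' hc'
    refine ⟨c2, hc2, ?_⟩
    have := TA_pot hh hg hTA
    rw [SimpleGraph.Walk.length_cons]; omega

structure TarEmb (Γ : SimpleGraph V) (hh : 0 < h) (φ : TV h t → V) : Prop where
  inj : Function.Injective φ
  adj : ∀ e, Γ.Adj (φ (psr (tsrc hh) (ttgt hh) e)) (φ (ptg (tsrc hh) (ttgt hh) e))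

variable {hh : 0 < h} {φ : TV h t → V} 

lemma TarEmb.sub (T : TarEmb Γ hh φ) : Sub Γ (tvs φ) (tes hh φ) := by
  intro e he
  obtain ⟨e', -, rfl⟩ := Finset.mem_image.1 he
  refine ⟨T.adj e', ?_⟩
  intro v hv
  rcases Sym2.mem_iff.1 hv with rfl | rfl <;> exact mem_tvs _ _

lemma TarEmb.cardv (T : TarEmb Γ hh φ) : (tvs φ).card = 2 + (2 * t + 1) * (2 * h - 1) := by
  unfold tvs
  rw [Finset.card_image_of_injective _ T.inj]
  simp only [Finset.card_univ, Fintype.card_sum, Fintype.card_prod, Fintype.card_option,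
    Fintype.card_fin, Fintype.card_bool, Fintype.card_empty]
  ring

lemma TarEmb.mu0 (T : TarEmb Γ hh φ) (P : Par h t α δ) : mu α (tvs φ) (tes hh φ) = 0 := by
  have hP := patOK (tar_rk (t := t) hh) (by have := P.hh; omega)
  have hc2 : (tes hh φ).card = (2 * t + 1) * (2 * h) := by
    have := Eim_card hP T.inj
    unfold Eim at this
    unfold tes
    refine Eq.trans ?_ (this.trans ?_)
    · congr!
    · simp only [Fintype.card_sum, Fintype.card_prod, Fintype.card_option, Fintype.card_fin]; ring
  unfold mu
  rw [T.cardv, hc2]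
  have h1 : ((2 * h - 1 : ℕ) : ℝ) = 2 * h - 1 := by
    rw [Nat.cast_sub (by omega)]; simp
  push_cast
  rw [h1]
  linear_combination (2 * (t : ℝ) + 1) * P.hα - P.ht

lemma TarEmb.closed (T : TarEmb Γ hh φ) (P : Par h t α δ) {C : ℕ} (hN : EvN0 α C Γ)
    (hC : (tvs φ).card + 2 * h ≤ C) {a b : V} (p : Γ.Walk a b) (hp : p.IsPath)
    (hl : p.length ≤ 2 * h) (ha : a ∈ tvs φ) (hb : b ∈ tvs φ) : ∀ e ∈ p.edges, e ∈ tes hh φ := by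
  by_contra hne
  obtain ⟨vs', es', h1, h2, h3, h4, -⟩ := exc_mu P p hl hp T.sub ha hb hne
  have := hN vs' es' h2 (by omega)
  rw [T.mu0 P] at h4
  linarith [P.hδ]

lemma TarEmb.pot (T : TarEmb Γ hh φ) (P : Par h t α δ) {C : ℕ} (hN : EvN0 α C Γ)
    (hC : (tvs φ).card + 2 * h ≤ C) {fb : Bool → ℕ} {g : TQ t → ℕ → ℕ} (hg : PotOK h fb g)
    {c c' : TV h t} {r : ℕ} (hr : r ≤ 2 * h) (hD : Dl Γ r (φ c) (φ c')) :
    pot fb g c' ≤ pot fb g c + r := by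
  obtain ⟨p, hp, hl⟩ := hD.path
  obtain ⟨c2, h1, h2⟩ := walk_pot hh T.inj hg p
    (T.closed P hN hC p hp (by omega) (mem_tvs _ _) (mem_tvs _ _)) c rfl
  have := T.inj h1
  subst this
  omega

lemma TarEmb.comp (T : TarEmb Γ hh φ) {a b : V} (p : Γ.Walk a b) (hp : ∀ e ∈ p.edges, e ∈ tes hh φ)
    (hx : φ (vx h t) ∉ p.support) (hy : φ (vy h t) ∉ p.support) (hu : φ (tmid hh none) ∉ p.support)
    {i : Fin t} (hb : b = φ (tmid hh (some i))) : ∃ c, a = φ c ∧ tcomp c = some i := by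
  have := stay (Γ := Γ) (tes hh φ) {v | ∃ c, v = φ c ∧ tcomp c = some i} p.reverse
    (fun e he => hp e (by simpa using he)) ⟨_, hb, by simp [tmid, tcomp]⟩ (by
      rintro v w ⟨c, rfl, hc⟩ hw he
      have hw : w ∈ p.support := by simpa using hw
      obtain ⟨c', rfl, hTA⟩ := tes_TA hh T.inj he
      refine ⟨c', rfl, TA_comp hh hTA hc ?_ ?_ ?_⟩
      · rintro rfl; exact hx hw
      · rintro rfl; exact hy hw
      · rintro rfl; exact hu hw)
  exact this

lemma TarEmb.Dmid (T : TarEmb Γ hh φ) (o : Option (Fin t)) :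
    InD Γ h (φ (vx h t)) (φ (vy h t)) (φ (tmid hh o)) := by
  have h1 := pos_Dl T.adj (Sum.inl o) 0 h (by omega)
  have h2 := pos_Dl T.adj (Sum.inl o) h h (by omega)
  rw [zero_add, pos_zero, tar_pos_mid] at h1
  rw [← two_mul, pos_d (by omega), tar_pos_mid] at h2
  exact ⟨h1.symm, h2⟩

lemma TarEmb.nxy (T : TarEmb Γ hh φ) (P : Par h t α δ) {C : ℕ} (hN : EvN0 α C Γ)
    (hC : (tvs φ).card + 2 * h ≤ C) : ¬ Dl Γ (2 * h - 1) (φ (vx h t)) (φ (vy h t)) := by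
  intro hD
  have := T.pot P hN hC (potx h) (by omega) hD
  simp [RGS.pot, vx, vy] at this
  omega

lemma TarEmb.Dcases (T : TarEmb Γ hh φ) (P : Par h t α δ) {C : ℕ} (hN : EvN0 α C Γ)
    (hC : (tvs φ).card + 2 * h ≤ C) {a : V} (ha : InD Γ h (φ (vx h t)) (φ (vy h t)) a) :
    ∃ o, a = φ (tmid hh o) := by
  obtain ⟨p, hp, hpl, hap, -⟩ := thru P.hh (T.nxy P hN hC) ha
  have hcl := T.closed P hN hC p hp hpl.le (mem_tvs _ _) (mem_tvs _ _)
  obtain ⟨c, rfl, -⟩ := walk_pot hh T.inj (potx h) (p.takeUntil a hap)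
      (fun e he => hcl e (p.edges_takeUntil_subset_edges hap he)) _ rfl
  have h1 := T.pot P hN hC (potx h) (by omega) ha.1.symm
  have h2 := T.pot P hN hC (poty h) (by omega) ha.2.symm
  rcases c with (b | ⟨q, i⟩) | e
  · cases b <;> simp [RGS.pot, vx, vy] at h1 h2 <;> omega
  · rcases q with o | q
    · refine ⟨o, ?_⟩
      simp [RGS.pot, vx, vy, gx, gy] at h1 h2
      congr 1
      simp only [tmid, Sum.inl.injEq, Sum.inr.injEq, Prod.mk.injEq, true_and, Fin.ext_iff]
      omega
    · simp [RGS.pot, vx, vy, gx, gy] at h1 h2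
      have := i.2
      omega
  · exact e.elim

lemma TarEmb.link (T : TarEmb Γ hh φ) {a : V} {o : Option (Fin t)} (ha : a = φ (tmid hh o))
    (hne : a ≠ φ (tmid hh none)) : ∃ c, c ≠ φ (vx h t) ∧ c ≠ φ (vy h t) ∧ Dl Γ h a c ∧
      Dl Γ h c (φ (tmid hh none)) := by
  subst ha
  rcases o with _ | i
  · exact absurd rfl hne
  have h1 := pos_Dl T.adj (Sum.inr i) 0 h (by omega)
  have h2 := pos_Dl T.adj (Sum.inr i) h h (by omega)
  rw [zero_add, pos_zero] at h1
  rw [← two_mul, pos_d (by omega)] at h2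
  refine ⟨_, ?_, ?_, h1, h2⟩
  · intro he
    have := T.inj he
    rw [pos_mid _ _ (by omega) (by omega)] at this
    simp [vx] at this
  · intro he
    have := T.inj he
    rw [pos_mid _ _ (by omega) (by omega)] at this
    simp [vy] at this
end tarA
end RGS

namespace RGS
section tarB
variable {V : Type} {Γ : SimpleGraph V} {h t : ℕ} {α δ : ℝ} [DecidableEq V]
variable {hh : 0 < h} {φ : TV h t → V}

lemma TarEmb.avoid (T : TarEmb Γ hh φ) (P : Par h t α δ) {C : ℕ} (hN : EvN0 α C Γ)
    (hC : (tvs φ).card + 2 * h ≤ C) {z : V} (hzx : ¬ Dl Γ h z (φ (vx h t)))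
    (hzy : ¬ Dl Γ h z (φ (vy h t))) {i : Fin t} (p : Γ.Walk z (φ (tmid hh (some i))))
    (hl : p.length ≤ 2 * h) : φ (vx h t) ∉ p.support ∧ φ (vy h t) ∉ p.support ∧
      φ (tmid hh none) ∉ p.support := by
  refine ⟨fun hv => ?_, fun hv => ?_, fun hv => ?_⟩
  · obtain ⟨r, s, hrs, h1, h2, -⟩ := split_at p hv
    have := T.pot P hN hC (potx h) (by omega) h2
    rw [pot_mid] at this
    simp [RGS.pot, vx, gx] at this
    exact hzx (h1.mono (by omega))
  · obtain ⟨r, s, hrs, h1, h2, -⟩ := split_at p hv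
    have := T.pot P hN hC (poty h) (by omega) h2
    rw [pot_mid] at this
    simp [RGS.pot, vy, gy] at this
    exact hzy (h1.mono (by omega))
  · obtain ⟨r, s, hrs, h1, h2, h3, -⟩ := split_at p hv
    have := T.pot P hN hC (potu h) (by omega) h2
    rw [pot_mid, pot_mid] at this
    simp [gu] at this
    have h4 := h3 (by omega)
    have h5 := (T.Dmid none).1
    rw [h4] at h5
    exact hzx h5

lemma Par.t2 (P : Par h t α δ) : 2 ≤ t := by
  have h1 : (4 : ℝ) ≤ h := by exact_mod_cast P.hh
  have h2 : 16 * δ ≤ (h : ℝ) ^ 2 * δ := mul_le_mul_of_nonneg_right (by nlinarith) P.hδ.le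
  have h3 : δ ≤ 1 / 28 := by nlinarith [P.sm, P.hδ]
  by_contra hlt
  have : (t : ℝ) ≤ 1 := by exact_mod_cast (by omega : t ≤ 1)
  nlinarith [P.ht, P.hδ]

lemma TarEmb.noz (T : TarEmb Γ hh φ) (P : Par h t α δ) {C : ℕ} (hN : EvN0 α C Γ)
    (hC : (tvs φ).card + 1 + 2 * h * (t + 1) + 2 * h ≤ C) {z : V}
    (hzx : ¬ Dl Γ h z (φ (vx h t))) (hzy : ¬ Dl Γ h z (φ (vy h t)))
    (hz : ∀ o, Dl Γ (2 * h) z (φ (tmid hh o))) : False := by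
  have hC' : (tvs φ).card + 2 * h ≤ C := by omega
  have t2 := P.t2
  choose p hp hpl using fun o => (hz o).path
  have hav := fun i => T.avoid P hN hC' hzx hzy (p (some i)) (hpl (some i))
  by_cases hzt : z ∈ tvs φ
  · have hc := fun i => T.comp (p (some i)) (T.closed P hN hC' _ (hp _) (hpl _) hzt (mem_tvs _ _))
      (hav i).1 (hav i).2.1 (hav i).2.2 rfl
    obtain ⟨c1, h1, h2⟩ := hc ⟨0, by omega⟩
    obtain ⟨c2, h3, h4⟩ := hc ⟨1, by omega⟩
    have := T.inj (h1.symm.trans h3)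
    subst this
    rw [h2] at h4
    simp at h4
  have hex : ∀ o, ∃ w, ∃ r : Γ.Walk z w, ∃ s : Γ.Walk w (φ (tmid hh o)), w ∈ tvs φ ∧ r.IsPath ∧
      s.IsPath ∧ r.length + s.length ≤ 2 * h ∧ (∀ v ∈ r.support, v ∈ tvs φ → v = w) ∧
      ∀ v ∈ s.support, v ∈ (p o).support := by
    intro o
    obtain ⟨w, hw, hx, hw2⟩ := (p o).exists_mem_support_forall_mem_support_imp_eq (tvs φ)
      ⟨φ (tmid hh o), by simp [mem_tvs]⟩
    refine ⟨w, (p o).takeUntil w hx, (p o).dropUntil w hx, hw, (hp o).takeUntil hx,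
      (hp o).dropUntil hx, ?_, fun v hv hvt => hw2 v hvt hv,
      fun v hv => (p o).support_dropUntil_subset_support hx hv⟩
    have := congrArg SimpleGraph.Walk.length ((p o).take_spec hx)
    rw [SimpleGraph.Walk.length_append] at this
    have := hpl o
    omega
  choose w r s hw hr hs hrs hhit hss using hex
  have hsome : ∀ i, ∃ c, w (some i) = φ c ∧ tcomp c = some i := by
    intro i
    refine T.comp (s (some i)) (T.closed P hN hC' _ (hs _) ?_ (hw _) (mem_tvs _ _)) 
      (fun h => (hav i).1 (hss _ _ h)) (fun h => (hav i).2.1 (hss _ _ h))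
      (fun h => (hav i).2.2 (hss _ _ h)) rfl
    have := hrs (some i); omega
  have hwinj : ∀ i j, w (some i) = w (some j) → i = j := by
    intro i j hij
    obtain ⟨c1, h1, h2⟩ := hsome i
    obtain ⟨c2, h3, h4⟩ := hsome j
    have := T.inj (h1.symm.trans (hij.trans h3))
    subst this
    rw [h2] at h4
    simpa using h4
  have ha := P.one_sub_pos
  have hle : ∀ o, ((r o).length : ℝ) * (1 - α) - 1 ≤ -δ := by
    intro o
    have h1 : ((r o).length : ℝ) ≤ 2 * h := by
      exact_mod_cast (by have := hrs o; omega : (r o).length ≤ 2 * h)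
    nlinarith [P.hα, mul_le_mul_of_nonneg_right h1 ha.le]
  have hm := multi P T.sub hzt w hw r hr (fun o => by have := hrs o; omega) hhit
  have hδ := P.hδ
  have ht := P.ht
  by_cases hcase : ∃ i, w none = w (some i)
  · obtain ⟨i, hi⟩ := hcase
    have hlen : 2 * h ≤ (s none).length + (s (some i)).length := by
      by_contra hlt
      have hD : Dl Γ ((s none).length + (s (some i)).length) (φ (tmid hh none))
          (φ (tmid hh (some i))) := by
        refine Dl.trans (b := w none) (Dl.symm ⟨s none, le_rfl⟩) ?_
        rw [hi]; exact ⟨s (some i), le_rfl⟩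
      have := T.pot P hN hC' (potu h) (by omega) hD
      rw [pot_mid, pot_mid] at this
      simp [gu] at this
      omega
    have hmin : ∃ j k : Option (Fin t), j ≠ k ∧ (r k).length ≤ h ∧ (j = none ∨ j = some i) := by
      have h1 := hrs none
      have h2 := hrs (some i)
      by_cases h3 : (r none).length ≤ h
      · exact ⟨some i, none, by simp, h3, Or.inr rfl⟩
      · exact ⟨none, some i, by simp, by omega, Or.inl rfl⟩
    obtain ⟨j, k, hjk, hk, hj⟩ := hmin
    obtain ⟨vs', es', h1, -, -, h4, h5, -⟩ := hm (Finset.univ.erase j) (by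
      intro a ha b hb hab
      have ha := (Finset.mem_erase.1 ha).1
      have hb := (Finset.mem_erase.1 hb).1
      rcases a with _ | a <;> rcases b with _ | b
      · rfl
      · have := hwinj _ _ (hi.symm.trans hab)
        subst this
        rcases hj with rfl | rfl
        · exact absurd rfl ha
        · exact absurd rfl hb
      · have := hwinj _ _ (hi.symm.trans hab.symm)
        subst this
        rcases hj with rfl | rfl
        · exact absurd rfl hb
        · exact absurd rfl ha
      · rw [hwinj _ _ hab])
    have hcard : (Finset.univ.erase j).card = t := by
      rw [Finset.card_erase_of_mem (Finset.mem_univ _)]; simp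
    rw [hcard] at h4
    have h6 := hN vs' es' h1 (by nlinarith)
    have hkm : k ∈ Finset.univ.erase j := Finset.mem_erase.2 ⟨hjk.symm, Finset.mem_univ _⟩
    rw [← Finset.add_sum_erase _ _ hkm, T.mu0 P] at h5
    have h7 : ∑ o ∈ (Finset.univ.erase j).erase k, (((r o).length : ℝ) * (1 - α) - 1) ≤
        (t - 1) * (-δ) := by
      refine (Finset.sum_le_card_nsmul _ _ _ fun o _ => hle o).trans ?_
      rw [Finset.card_erase_of_mem hkm, hcard, nsmul_eq_mul, Nat.cast_sub (by omega)]
      simp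
    have h8 : ((r k).length : ℝ) * (1 - α) ≤ h * (1 - α) :=
      mul_le_mul_of_nonneg_right (by exact_mod_cast hk) ha.le
    have h9 : (2 : ℝ) ≤ t := by exact_mod_cast t2
    nlinarith [P.hα]
  · push Not at hcase
    obtain ⟨vs', es', h1, -, -, h4, h5, -⟩ := hm Finset.univ (by
      intro a _ b _ hab
      rcases a with _ | a <;> rcases b with _ | b
      · rfl
      · exact absurd hab (hcase _)
      · exact absurd hab.symm (hcase _)
      · rw [hwinj _ _ hab])
    have hcard : (Finset.univ : Finset (Option (Fin t))).card = t + 1 := by simp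
    rw [hcard] at h4
    have h6 := hN vs' es' h1 (by omega)
    have h7 : ∑ o, (((r o).length : ℝ) * (1 - α) - 1) ≤ (t + 1) * (-δ) := by
      refine (Finset.sum_le_card_nsmul _ _ _ fun o _ => hle o).trans ?_
      rw [hcard, nsmul_eq_mul]; push_cast; rfl
    rw [T.mu0 P] at h5
    nlinarith

lemma TarEmb.Phi (T : TarEmb Γ hh φ) (P : Par h t α δ) {C : ℕ} (hN : EvN0 α C Γ)
    (hC : (tvs φ).card + 1 + 2 * h * (t + 1) + 2 * h ≤ C) : Phi h Γ := by
  have hC' : (tvs φ).card + 2 * h ≤ C := by omega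
  refine ⟨φ (vx h t), φ (vy h t), T.nxy P hN hC', ⟨φ (tmid hh none), T.Dmid none, ?_⟩, ?_⟩
  · intro a ha hne
    obtain ⟨o, ho⟩ := T.Dcases P hN hC' ha
    exact T.link ho hne
  · rintro ⟨z, hzx, hzy, hz⟩
    refine T.noz P hN hC hzx hzy fun o => ?_
    obtain ⟨c, h1, h2⟩ := hz _ (T.Dmid o)
    exact (h1.trans h2).mono (by omega)
end tarB
end RGS

namespace RGS
open FirstOrder.Language RandomGraphSpectra

/-- A predicate on tuples of vertices definable with quantifier depth at most `d`. -/
def Df (d n : ℕ) (P : ∀ V : Type, SimpleGraph V → (Fin n → V) → Prop) : Prop :=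
  ∃ ψ : Language.graph.BoundedFormula Empty n, qDepth ψ ≤ d ∧
    ∀ (V : Type) (Γ : SimpleGraph V) (v : Empty → V) (xs : Fin n → V),
      @BoundedFormula.Realize Language.graph V Γ.structure Empty n ψ v xs ↔ P V Γ xs

variable {d n : ℕ} {P Q : ∀ V : Type, SimpleGraph V → (Fin n → V) → Prop}

lemma Df.congr (h : Df d n P) (he : ∀ V Γ xs, P V Γ xs ↔ Q V Γ xs) : Df d n Q := by
  obtain ⟨ψ, h1, h2⟩ := h
  exact ⟨ψ, h1, fun V Γ v xs => (h2 V Γ v xs).trans (he V Γ xs)⟩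

lemma Df.mono (h : Df d n P) {d' : ℕ} (hd : d ≤ d') : Df d' n P := by
  obtain ⟨ψ, h1, h2⟩ := h
  exact ⟨ψ, h1.trans hd, h2⟩

lemma Df.fals : Df d n (fun _ _ _ => False) :=
  ⟨.falsum, by simp [qDepth], fun V Γ v xs => Iff.rfl⟩

lemma Df.imp (h : Df d n P) (h' : Df d n Q) : Df d n (fun V Γ xs => P V Γ xs → Q V Γ xs) := by
  obtain ⟨ψ, h1, h2⟩ := h
  obtain ⟨ψ', h3, h4⟩ := h'
  refine ⟨.imp ψ ψ', by simp [qDepth, h1, h3], fun V Γ v xs => ?_⟩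
  beta_reduce
  rw [← h2 V Γ v xs, ← h4 V Γ v xs]
  exact Iff.rfl

lemma Df.not (h : Df d n P) : Df d n (fun V Γ xs => ¬ P V Γ xs) := h.imp Df.fals

lemma Df.or (h : Df d n P) (h' : Df d n Q) : Df d n (fun V Γ xs => P V Γ xs ∨ Q V Γ xs) :=
  (h.not.imp h').congr fun _ _ _ => by tauto

lemma Df.and (h : Df d n P) (h' : Df d n Q) : Df d n (fun V Γ xs => P V Γ xs ∧ Q V Γ xs) :=
  (h.imp h'.not).not.congr fun _ _ _ => by tauto

lemma Df.all {P : ∀ V : Type, SimpleGraph V → (Fin (n + 1) → V) → Prop} (h : Df d (n + 1) P) :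
    Df (d + 1) n (fun V Γ xs => ∀ a, P V Γ (Fin.snoc xs a)) := by
  obtain ⟨ψ, h1, h2⟩ := h
  refine ⟨.all ψ, by simp [qDepth, h1], fun V Γ v xs => ?_⟩
  have : (∀ a, P V Γ (Fin.snoc xs a)) ↔ ∀ a : V,
    @BoundedFormula.Realize Language.graph V Γ.structure Empty (n + 1) ψ v (Fin.snoc xs a) :=
    forall_congr' fun a => (h2 V Γ v _).symm
  beta_reduce
  rw [this]
  exact Iff.rfl

lemma Df.ex {P : ∀ V : Type, SimpleGraph V → (Fin (n + 1) → V) → Prop} (h : Df d (n + 1) P) :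
    Df (d + 1) n (fun V Γ xs => ∃ a, P V Γ (Fin.snoc xs a)) :=
  h.not.all.not.congr fun _ _ _ => by simp

lemma Df.eq (i j : Fin n) : Df d n (fun _ _ xs => xs i = xs j) :=
  ⟨.equal (.var (.inr i)) (.var (.inr j)), by simp [qDepth], fun V Γ v xs => Iff.rfl⟩

lemma Df.adj (i j : Fin n) : Df d n (fun _ Γ xs => Γ.Adj (xs i) (xs j)) :=
  ⟨.rel Language.adj ![.var (.inr i), .var (.inr j)], by simp [qDepth], fun V Γ v xs => Iff.rfl⟩

lemma Dl_zero {V : Type} {Γ : SimpleGraph V} {a b : V} : Dl Γ 0 a b ↔ a = b := by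
  constructor
  · rintro ⟨p, hp⟩
    exact SimpleGraph.Walk.eq_of_length_eq_zero (Nat.le_zero.1 hp)
  · rintro rfl; exact ⟨.nil, by simp⟩

lemma Dl_one {V : Type} {Γ : SimpleGraph V} {a b : V} : Dl Γ 1 a b ↔ a = b ∨ Γ.Adj a b := by
  constructor
  · rintro ⟨p, hp⟩
    rcases Nat.lt_or_ge p.length 1 with h | h
    · exact Or.inl (SimpleGraph.Walk.eq_of_length_eq_zero (p := p) (by omega))
    · exact Or.inr (SimpleGraph.Walk.adj_of_length_eq_one (p := p) (by omega))
  · rintro (rfl | h)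
    · exact ⟨.nil, by simp⟩
    · exact ⟨.cons h .nil, by simp⟩

lemma Dl_split {V : Type} {Γ : SimpleGraph V} {a b : V} (r s : ℕ) :
    Dl Γ (r + s) a b ↔ ∃ c, Dl Γ r a c ∧ Dl Γ s c b := by
  constructor
  · rintro ⟨p, hp⟩
    refine ⟨p.getVert r, ⟨p.take r, ?_⟩, ⟨p.drop r, ?_⟩⟩
    · rw [SimpleGraph.Walk.take_length]; omega
    · rw [SimpleGraph.Walk.drop_length]; omega
  · rintro ⟨c, h1, h2⟩; exact h1.trans h2

lemma Df.dist (d : ℕ) : ∀ (n r : ℕ) (_ : r ≤ 2 ^ d) (i j : Fin n),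
    Df d n (fun _ Γ xs => Dl Γ r (xs i) (xs j)) := by
  induction d with
  | zero =>
    intro n r hr i j
    have : r = 0 ∨ r = 1 := by simp at hr; omega
    rcases this with rfl | rfl
    · exact (Df.eq i j).congr fun _ _ _ => Dl_zero.symm
    · exact ((Df.eq i j).or (Df.adj i j)).congr fun _ _ _ => Dl_one.symm
  | succ d ih =>
    intro n r hr i j
    rw [pow_succ] at hr
    have h1 := ih (n + 1) (r / 2) (by omega) i.castSucc (Fin.last n)
    have h2 := ih (n + 1) (r - r / 2) (by omega) (Fin.last n) j.castSucc
    refine (h1.and h2).ex.congr fun V Γ xs => ?_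
    have : r = r / 2 + (r - r / 2) := by omega
    conv_rhs => rw [this]
    rw [Dl_split]
    simp

lemma Phi_Df (m h : ℕ) (hm : 2 * h = 2 ^ (m + 1)) :
    ∃ φ : Language.graph.Sentence, qDepth φ ≤ m + 5 ∧
      ∀ (V : Type) (Γ : SimpleGraph V), GraphSat Γ φ ↔ Phi h Γ := by
  have hh : h ≤ 2 ^ m := by rw [pow_succ] at hm; omega
  have D := fun n (i j : Fin n) => Df.dist m n h hh i j
  have A : Df (m + 1) 2 (fun _ Γ xs => ¬ Dl Γ (2 * h - 1) (xs 0) (xs 1)) :=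
    (Df.dist (m + 1) 2 (2 * h - 1) (by omega) 0 1).not
  have I4 : Df m 4 (fun _ Γ xs => InD Γ h (xs 0) (xs 1) (xs 3)) := (D 4 3 0).and (D 4 3 1)
  have I3 : Df m 3 (fun _ Γ xs => InD Γ h (xs 0) (xs 1) (xs 2)) := (D 3 2 0).and (D 3 2 1)
  have B1 : Df (m + 1) 4 (fun _ Γ xs => ∃ c, c ≠ xs 0 ∧ c ≠ xs 1 ∧ Dl Γ h (xs 3) c ∧
      Dl Γ h c (xs 2)) :=
    ((Df.eq 4 0).not.and ((Df.eq 4 1).not.and ((D 5 3 4).and (D 5 4 2)))).ex.congr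
      fun _ _ _ => Iff.rfl
  have B2 : Df (m + 2) 3 (fun _ Γ xs => ∀ a, InD Γ h (xs 0) (xs 1) a → a ≠ xs 2 →
      ∃ c, c ≠ xs 0 ∧ c ≠ xs 1 ∧ Dl Γ h a c ∧ Dl Γ h c (xs 2)) :=
    ((I4.mono (Nat.le_succ m)).imp ((Df.eq 3 2).not.imp B1)).all.congr fun _ _ _ => Iff.rfl
  have B3 : Df (m + 3) 2 (fun _ Γ xs => ∃ u, InD Γ h (xs 0) (xs 1) u ∧
      ∀ a, InD Γ h (xs 0) (xs 1) a → a ≠ u →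
      ∃ c, c ≠ xs 0 ∧ c ≠ xs 1 ∧ Dl Γ h a c ∧ Dl Γ h c u) :=
    ((I3.mono (by omega)).and B2).ex.congr fun _ _ _ => Iff.rfl
  have C1 : Df (m + 1) 4 (fun _ Γ xs => ∃ c, Dl Γ h (xs 2) c ∧ Dl Γ h c (xs 3)) :=
    ((D 5 2 4).and (D 5 4 3)).ex.congr fun _ _ _ => Iff.rfl
  have C2 : Df (m + 2) 3 (fun _ Γ xs => ∀ a, InD Γ h (xs 0) (xs 1) a →
      ∃ c, Dl Γ h (xs 2) c ∧ Dl Γ h c a) :=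
    ((I4.mono (Nat.le_succ m)).imp C1).all.congr fun _ _ _ => Iff.rfl
  have C3 : Df (m + 3) 2 (fun _ Γ xs => ∃ z, ¬ Dl Γ h z (xs 0) ∧ ¬ Dl Γ h z (xs 1) ∧
      ∀ a, InD Γ h (xs 0) (xs 1) a → ∃ c, Dl Γ h z c ∧ Dl Γ h c a) :=
    (((D 3 2 0).not.mono (by omega)).and (((D 3 2 1).not.mono (by omega)).and C2)).ex.congr
      fun _ _ _ => Iff.rfl
  have F := ((A.mono (by omega)).and (B3.and C3.not)).ex.ex
  obtain ⟨ψ, h1, h2⟩ := F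
  refine ⟨ψ, h1, fun V Γ => ?_⟩
  exact (h2 V Γ _ _).trans Iff.rfl
end RGS

namespace RGS
open RandomGraphSpectra

lemma lower_Phi {h t : ℕ} {α δ : ℝ} (P : Par h t α δ) : ∃ c : ℝ, 0 < c ∧ ∀ᶠ n : ℕ in atTop,
    c ≤ Pr (EE n) ((n : ℝ) ^ (-α)) (fun S => Phi h (gr S)) := by
  have hh : 0 < h := by have := P.hh; omega
  have ha := P.alpha_pos
  have hb := P.one_sub_pos
  have h4 := P.h4
  obtain ⟨c, hc, hc2⟩ := prob_emb (α := α) ha.le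
    (patOK (tar_rk (t := t) hh) (by have := P.hh; omega))
    (fun S _ => tar_bal hh ha.le (by linarith) (by push_cast; exact P.hα) P.hδ.le P.ht
      (by nlinarith [P.big, P.hδ]) S)
  set C := (2 + (2 * t + 1) * (2 * h - 1)) + 1 + 2 * h * (t + 1) + 2 * h with hC
  have h0 := prob_N0 ha.le C
  refine ⟨c / 2, by positivity, ?_⟩
  filter_upwards [hc2, h0.eventually (gt_mem_nhds (show (0 : ℝ) < c / 2 by positivity)),
    eventually_ge_atTop 1] with n h1 h2 hn
  obtain ⟨p0, p1⟩ := prob_basic hn ha.le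
  have h3 := Pr_and_ge (A := EE n) p0.le p1
    (fun S => HasExt (psr (tsrc (t := t) hh) (ttgt hh)) (ptg (tsrc hh) (ttgt hh)) (gr S) ∅ isEmptyElim)
    (fun S => EvN0 α C (gr S))
  refine le_trans (by linarith) (h3.trans (Pr_mono p0.le p1 ?_))
  rintro S - ⟨⟨φ, f1, -, -, f4⟩, hN⟩
  have T : TarEmb (gr S) hh φ := ⟨f1, f4⟩
  exact T.Phi P hN (by rw [T.cardv])

lemma lower_notPhi {h t : ℕ} {α δ : ℝ} (P : Par h t α δ) : ∃ c : ℝ, 0 < c ∧ ∀ᶠ n : ℕ in atTop,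
    c ≤ Pr (EE n) ((n : ℝ) ^ (-α)) (fun S => ¬ Phi h (gr S)) := by
  have hh : 0 < h := by have := P.hh; omega
  have ha := P.alpha_pos
  have hb := P.one_sub_pos
  have hδ := P.hδ
  set C := (t+2+((t+2)*(2*t+1))*((t+2)*(2*h))) + (2*h+1+6*h*(t+6*h)) with hC
  obtain ⟨c, hc, hc2⟩ := prob_N ha.le C
  have h0 := prob_Ext (α := α) (η := min (1 - α) (δ / 2)) ha.le (lt_min hb (by positivity))
    (patOK (star_rk (d := 2 * h) (t := t)) (by have := P.hh; omega))
    (fun S hS => star_bal ha.le (by linarith) (by push_cast; exact P.hα) (by omega) P.hδ.le P.ht S hS) C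
  refine ⟨c / 2, by positivity, ?_⟩
  filter_upwards [h0.eventually (gt_mem_nhds (show (0 : ℝ) < c / 2 by positivity)),
    eventually_ge_atTop (t + 2)] with n h2 hn
  have h1 := hc2 n (by omega)
  obtain ⟨p0, p1⟩ := prob_basic (show 1 ≤ n by omega) ha.le
  have h3 := Pr_and_ge (A := EE n) p0.le p1 (fun S => EvN α C (gr S))
    (fun S => EvExt (psr (ssrc (d := 2 * h) (t := t)) stgt) (ptg ssrc stgt) C (gr S))
  refine le_trans (by linarith) (h3.trans (Pr_mono p0.le p1 ?_))
  rintro S - ⟨hN, hE⟩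
  exact not_Phi P hN hE (by omega) (by omega) (by simp; omega)

lemma mem_S1 {k h t : ℕ} {α δ : ℝ} (hk : 8 ≤ k) (hh : h = 2 ^ (k - 6)) (P : Par h t α δ) : α ∈ S1 k := by
  obtain ⟨φ, hq, hφ⟩ := Phi_Df (k - 6) h (by rw [pow_succ, ← hh]; ring)
  refine ⟨⟨P.alpha_pos, by linarith [P.one_sub_pos]⟩, φ, by omega, ?_⟩
  have he : ∀ n : ℕ, probSat n ((n : ℝ) ^ (-α)) φ =
      Pr (EE n) ((n : ℝ) ^ (-α)) (fun S => Phi h (gr S)) := by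
    intro n
    unfold probSat
    rw [probPred_eq]
    simp only [hφ]
  simp only [he]
  obtain ⟨c, hc, h1⟩ := lower_Phi P
  obtain ⟨c', hc', h2⟩ := lower_notPhi P
  rintro (ht | ht)
  · have := ge_of_tendsto ht h1
    linarith
  · have : (1 : ℝ) ≤ 1 - c' := by
      refine le_of_tendsto ht ?_
      filter_upwards [h2] with n hn
      rw [Pr_not] at hn
      linarith
    linarith

lemma acc (k : ℕ) (hk : 8 ≤ k) :
    AccPt ((1 : ℝ) - 1 / (2 : ℝ) ^ (k - 5)) (Filter.principal (S1 k)) := by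
  set h : ℕ := 2 ^ (k - 6) with hh
  have hp : (2 : ℝ) ^ (k - 5) = 2 * h := by
    rw [show k - 5 = (k - 6) + 1 by omega, pow_succ, hh]; push_cast; ring
  have h4 : 4 ≤ h := by
    calc 4 = 2 ^ 2 := by norm_num
      _ ≤ _ := Nat.pow_le_pow_right (by norm_num) (by omega)
  have h4' : (4 : ℝ) ≤ h := by exact_mod_cast h4
  rw [accPt_iff_frequently, hp]
  set dl : ℕ → ℝ := fun t => 2 / (2 * t + 1) with hdl
  have hlim : Tendsto dl atTop (nhds 0) := by
    refine Tendsto.div_atTop tendsto_const_nhds ?_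
    refine tendsto_atTop_add_const_right _ _ ?_
    exact Tendsto.const_mul_atTop (by norm_num) tendsto_natCast_atTop_atTop
  have hpos : ∀ t, 0 < dl t := fun t => by simp only [hdl]; positivity
  have hlim2 : Tendsto (fun t => (1 : ℝ) - (1 - dl t) / (2 * h)) atTop (nhds (1 - 1 / (2 * h))) := by
    have := ((hlim.const_sub 1).div_const (2 * (h : ℝ))).const_sub 1
    simpa using this
  refine hlim2.frequently (Eventually.frequently ?_)
  filter_upwards [hlim.eventually (gt_mem_nhds (show (0 : ℝ) < 1 / (28 * (h : ℝ) ^ 2) by positivity))]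
    with t ht
  have hd := hpos t
  constructor
  · intro he
    have : dl t / (2 * h) = 0 := by
      rw [sub_div] at he; linarith
    have : 0 < dl t / (2 * (h : ℝ)) := by positivity
    linarith
  · refine mem_S1 (δ := dl t) (t := t) hk hh ⟨h4, hd, ?_, ?_, ?_⟩
    · simp only [hdl]; field_simp
    · field_simp; ring
    · rw [lt_div_iff₀ (by positivity)] at ht
      linarith
end RGS

namespace RandomGraphSpectra

/-- For every integer `k ≥ 8`, the number `1 - 1/2^{k-5}` is a limit point of `S_k^1`. -/
theorem limit_point_near_one (k : ℕ) (hk : 8 ≤ k) :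
    AccPt ((1 : ℝ) - 1 / (2 : ℝ) ^ (k - 5)) (Filter.principal (S1 k)) := by
  exact RGS.acc k hk

end RandomGraphSpectra
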